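/- Let G be a 3-edge-connected reduced graph. Suppose G has a spanning connected bipartite subgraph H with bipartition {X, Y} such that |X| ≤ 7, |Y| ≥ |X|, and every vertex v ∈ Y has degree d_H(v) ≥ 3 in H. Then G is supereulerian. -/

import Mathlib

open scoped Classical

/-- A finite loopless multigraph on vertex type `V`, given by a multiset of edges. -/
structure Multigraph (V : Type) where
  edges : Multiset (Sym2 V)
  loopless : ∀ e ∈ edges, ¬ e.IsDiag

namespace Multigraph

variable {V W : Type}

/-- The degree of a vertex with respect to a multiset of edges. -/
noncomputable def degIn (E : Multiset (Sym2 V)) (v : V) : ℕ :=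
  Multiset.card (E.filter fun e => v ∈ e)

/-- The degree of a vertex in a multigraph. -/
noncomputable def deg (G : Multigraph V) (v : V) : ℕ :=
  degIn G.edges v

/-- All endpoints of the edges in `E` lie in `S`. -/
def Within (S : Set V) (E : Multiset (Sym2 V)) : Prop :=
  ∀ e ∈ E, ∀ v ∈ e, v ∈ S

/-- The graph with vertex set `S` and edge multiset `E` is connected (and spans `S`). -/
def ConnOn (S : Set V) (E : Multiset (Sym2 V)) : Prop :=
  S.Nonempty ∧ Within S E ∧
    ∀ u ∈ S, ∀ v ∈ S, Relation.ReflTransGen (fun a b => s(a, b) ∈ E) u v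

/-- The graph with vertex set `S` and edge multiset `E` is collapsible: for every even subset
`R` of `S` there is a spanning connected subgraph whose set of odd-degree vertices is `R`. -/
def CollapsiblePair (S : Set V) (E : Multiset (Sym2 V)) : Prop :=
  S.Nonempty ∧ Within S E ∧
    ∀ R : Set V, R ⊆ S → R.Finite → Even R.ncard →
      ∃ E' ≤ E, ConnOn S E' ∧ ∀ x ∈ S, (Odd (degIn E' x) ↔ x ∈ R)

/-- `(S, E)` is a subgraph of `G`. -/
def IsSubpair (G : Multigraph V) (S : Set V) (E : Multiset (Sym2 V)) : Prop :=
  E ≤ G.edges ∧ Within S E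

/-- A multigraph is reduced if it has no collapsible subgraph with more than one vertex. -/
def Reduced (G : Multigraph V) : Prop :=
  ∀ S E, G.IsSubpair S E → CollapsiblePair S E → S.ncard ≤ 1

/-- `(S, E)` is a maximal collapsible subgraph of `G`. -/
def MaxCollapsibleSub (G : Multigraph V) (S : Set V) (E : Multiset (Sym2 V)) : Prop :=
  G.IsSubpair S E ∧ CollapsiblePair S E ∧
    ∀ S' E', G.IsSubpair S' E' → CollapsiblePair S' E' → S ⊆ S' → E ≤ E' → S' = S ∧ E' = E

/-- `(S, E)` is a nontrivial maximal collapsible subgraph of `G`. -/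
def NontrivMaxCollapsible (G : Multigraph V) (S : Set V) (E : Multiset (Sym2 V)) : Prop :=
  G.MaxCollapsibleSub S E ∧ 1 < S.ncard

/-- The multiset of edges of `G` with both ends in `S`. -/
noncomputable def inducedEdges (G : Multigraph V) (S : Set V) : Multiset (Sym2 V) :=
  G.edges.filter fun e => ∀ v ∈ e, v ∈ S

/-- `S` is the vertex set of a maximal collapsible subgraph of `G`. -/
def IsMaxCollapsibleSet (G : Multigraph V) (S : Set V) : Prop :=
  CollapsiblePair S (G.inducedEdges S) ∧
    ∀ T : Set V, S ⊆ T → CollapsiblePair T (G.inducedEdges T) → T = S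

/-- `G'` (on vertex type `W`) is the reduction of `G`, witnessed by the contraction map `f`:
the fibres of `f` are exactly the (vertex sets of the) maximal collapsible subgraphs of `G`,
and the edges of `G'` are obtained by contracting each fibre to a point and deleting the
resulting loops. -/
def IsReduction (G : Multigraph V) (f : V → W) (G' : Multigraph W) : Prop :=
  Function.Surjective f ∧ (∀ w : W, G.IsMaxCollapsibleSet (f ⁻¹' {w})) ∧
    G'.edges = (G.edges.map (Sym2.map f)).filter fun e => ¬ e.IsDiag

/-- A multigraph is supereulerian if it has a spanning connected subgraph in which every
vertex has even degree. -/
def Supereulerian (G : Multigraph V) : Prop :=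
  ∃ E' ≤ G.edges, ConnOn Set.univ E' ∧ ∀ x : V, Even (degIn E' x)

/-- A multigraph is connected. -/
def Connected (G : Multigraph V) : Prop :=
  ConnOn Set.univ G.edges

/-- A multigraph is 3-edge-connected (edge connectivity at least 3): removing any at most two
edges leaves a spanning connected graph. -/
def ThreeEdgeConnected (G : Multigraph V) : Prop :=
  ∀ F : Multiset (Sym2 V), F ≤ G.edges → Multiset.card F ≤ 2 →
    ConnOn Set.univ (G.edges - F)

/-- A spanning tree: spanning connected with `|V| - 1` edges. -/
def IsSpanningTree [Fintype V] (E : Multiset (Sym2 V)) : Prop :=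
  ConnOn Set.univ E ∧ Multiset.card E = Fintype.card V - 1

/-- The edge multiset `E` contains two edge-disjoint spanning trees. -/
def HasTwoDisjointSpanningTrees [Fintype V] (E : Multiset (Sym2 V)) : Prop :=
  ∃ T₁ T₂ : Multiset (Sym2 V), T₁ + T₂ ≤ E ∧ IsSpanningTree T₁ ∧ IsSpanningTree T₂

/-- `F(G)`: the minimum number of extra (loopless) edges whose addition to `G` produces a
spanning supergraph having two edge-disjoint spanning trees. -/
noncomputable def FVal [Fintype V] (G : Multigraph V) : ℕ :=
  sInf {k : ℕ | ∃ Eadd : Multiset (Sym2 V), (∀ e ∈ Eadd, ¬ e.IsDiag) ∧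
    Multiset.card Eadd = k ∧ HasTwoDisjointSpanningTrees (G.edges + Eadd)}

/-- `σ̄₂(G)`: the minimum of `deg u + deg v` over edges `uv` of `G`. -/
noncomputable def sigma2bar (G : Multigraph V) : ℕ :=
  sInf {k : ℕ | ∃ u v : V, s(u, v) ∈ G.edges ∧ G.deg u + G.deg v = k}

/-- `G` contains a cycle of length four. -/
def HasFourCycle (G : Multigraph V) : Prop :=
  ∃ a b c d : V, a ≠ b ∧ a ≠ c ∧ a ≠ d ∧ b ≠ c ∧ b ≠ d ∧ c ≠ d ∧
    s(a, b) ∈ G.edges ∧ s(b, c) ∈ G.edges ∧ s(c, d) ∈ G.edges ∧ s(d, a) ∈ G.edges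

/-- `M` is a matching: distinct edges share no endpoint. -/
def IsMatching (M : Multiset (Sym2 V)) : Prop :=
  M.Nodup ∧ ∀ e ∈ M, ∀ f ∈ M, e ≠ f → ∀ x : V, x ∈ e → x ∉ f

/-- `{X, Y}` is a bipartition (of the full vertex set) for the edge multiset `E`:
every edge has one end in `X` and one end in `Y`. -/
def IsBipartition [Fintype V] (X Y : Finset V) (E : Multiset (Sym2 V)) : Prop :=
  Disjoint X Y ∧ X ∪ Y = Finset.univ ∧
    ∀ e ∈ E, (∃ a ∈ e, a ∈ X) ∧ (∃ b ∈ e, b ∈ Y)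

/-- The edge multiset of Catlin's π-reduction `G/π` obtained from the induced four-cycle
`u v z w`: remove the four cycle edges, identify `z` with `u` (forming `x = u`) and `w` with
`v` (forming `y = v`), and add the new edge `e_π = xy = s(u, v)`. -/
noncomputable def piEdges (G : Multigraph V) (u v z w : V) : Multiset (Sym2 V) :=
  ((G.edges - {s(u, v), s(v, z), s(z, w), s(w, u)}).map
      (Sym2.map fun a => if a = z then u else if a = w then v else a)) + {s(u, v)}

/-- `(S, E)` is the multigraph `Φ(c, t)`: a star `K_{1,t}` with centre `c` in which every
edge is doubled. -/
def IsPhi (S : Set V) (E : Multiset (Sym2 V)) (c : V) (t : ℕ) : Prop :=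
  ∃ A : Finset V, c ∉ A ∧ A.card = t ∧ S = insert c (↑A : Set V) ∧
    E = A.val.map (fun a => s(c, a)) + A.val.map (fun a => s(c, a))

/-- The multigraph associated with a simple graph. -/
noncomputable def ofSimple [Fintype V] (G : SimpleGraph V) : Multigraph V where
  edges := G.edgeSet.toFinset.val
  loopless := by
    intro e he
    have he' : e ∈ G.edgeSet := by simpa using he
    exact G.not_isDiag_of_mem_edgeSet he'

/-- Isomorphism of multigraphs. -/
def MIso {A B : Type} (G : Multigraph A) (H : Multigraph B) : Prop :=
  ∃ φ : A ≃ B, H.edges = G.edges.map (Sym2.map φ)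

end Multigraph

/-- Vertices of the Petersen graph: the 2-element subsets of a 5-element set. -/
abbrev PetersenVert : Type := {s : Finset (Fin 5) // s.card = 2}

/-- The Petersen graph (as the Kneser graph on 2-subsets of a 5-set). -/
def petersenSimple : SimpleGraph PetersenVert :=
  SimpleGraph.fromRel fun a b => Disjoint a.1 b.1

noncomputable def petersen : Multigraph PetersenVert :=
  Multigraph.ofSimple petersenSimple

/-- The graph `P₁₄`: obtained from the Petersen graph (outer cycle `0 1 2 3 4`, spokes
`i — i+5`, inner cycle `5 7 9 6 8 5`) by replacing the vertex `9` (whose neighbours were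
`4`, `7`, `6`) by a copy of `K_{2,3}` with degree-three vertices `9`, `10` and degree-two
vertices `11`, `12`, `13`, joined to `4`, `7`, `6` respectively. -/
def p14Simple : SimpleGraph (Fin 14) :=
  SimpleGraph.fromRel fun a b =>
    (a, b) ∈ ([(0, 1), (1, 2), (2, 3), (3, 4), (4, 0), (0, 5), (1, 6), (2, 7), (3, 8),
      (5, 7), (6, 8), (8, 5), (9, 11), (9, 12), (9, 13), (10, 11), (10, 12), (10, 13),
      (11, 4), (12, 7), (13, 6)] : List (Fin 14 × Fin 14))

noncomputable def p14 : Multigraph (Fin 14) :=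
  Multigraph.ofSimple p14Simple


/-! ### Collapsibility via cut functions -/

namespace S6

section coll

variable {α β : Type}

/-- The functional `w ↦ w a + w b` of an edge `ab`. -/
def edgeL (e : Sym2 α) : (α → ZMod 2) →ₗ[ZMod 2] ZMod 2 :=
  Sym2.lift ⟨fun a b => LinearMap.proj a + LinearMap.proj b, fun a b => add_comm _ _⟩ e

/-- The boundary of an edge multiset, as a functional. -/
def bd (E : Multiset (Sym2 α)) : (α → ZMod 2) →ₗ[ZMod 2] ZMod 2 :=
  (E.map edgeL).sum

theorem edgeL_mk (a b : α) (w : α → ZMod 2) : edgeL s(a, b) w = w a + w b := by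
  simp [edgeL]

theorem bd_zero : bd (0 : Multiset (Sym2 α)) = 0 := by simp [bd]

theorem bd_cons (e : Sym2 α) (E : Multiset (Sym2 α)) : bd (e ::ₘ E) = edgeL e + bd E := by
  simp [bd]

theorem bd_add (E F : Multiset (Sym2 α)) : bd (E + F) = bd E + bd F := by
  simp [bd]

theorem bd_map (f : α → β) (E : Multiset (Sym2 α)) (w : β → ZMod 2) :
    bd (E.map (Sym2.map f)) w = bd E (w ∘ f) := by
  induction E using Multiset.induction_on with
  | empty => simp [bd]
  | cons e E ih =>
    rw [Multiset.map_cons, bd_cons, bd_cons, LinearMap.add_apply, LinearMap.add_apply, ih]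
    congr 1
    induction e using Sym2.ind with
    | _ a b => simp [edgeL_mk]

/-- `w` is constant on the edges of `E`. -/
def Flat (E : Multiset (Sym2 α)) (w : α → ZMod 2) : Prop :=
  ∀ a b, s(a, b) ∈ E → w a = w b

/-- Connectivity expressed by cut functions. -/
def Conn (S : List α) (E : Multiset (Sym2 α)) : Prop :=
  ∀ w : α → ZMod 2, Flat E w → ∀ u ∈ S, ∀ v ∈ S, w u = w v

/-- Collapsibility, in functional form. -/
def Coll (S : List α) (E : Multiset (Sym2 α)) : Prop :=
  ∀ r : (α → ZMod 2) →ₗ[ZMod 2] ZMod 2,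
    (∀ w : α → ZMod 2, (∀ u ∈ S, ∀ v ∈ S, w u = w v) → r w = 0) →
    ∃ E' ≤ E, Conn S E' ∧ bd E' = r

theorem flat_add {E F : Multiset (Sym2 α)} {w : α → ZMod 2} :
    Flat (E + F) w ↔ Flat E w ∧ Flat F w := by
  unfold Flat
  constructor
  · intro h
    exact ⟨fun a b hab => h a b (Multiset.mem_add.2 (Or.inl hab)),
      fun a b hab => h a b (Multiset.mem_add.2 (Or.inr hab))⟩
  · rintro ⟨h1, h2⟩ a b hab
    rcases Multiset.mem_add.1 hab with h | h
    · exact h1 a b h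
    · exact h2 a b h

theorem flat_cons {E : Multiset (Sym2 α)} {w : α → ZMod 2} {a b : α} :
    Flat (s(a, b) ::ₘ E) w ↔ w a = w b ∧ Flat E w := by
  unfold Flat
  constructor
  · intro h
    exact ⟨h a b (by simp), fun c d hcd => h c d (by simp [hcd])⟩
  · rintro ⟨h1, h2⟩ c d hcd
    rcases Multiset.mem_cons.1 hcd with h | h
    · rcases Sym2.eq_iff.1 h with ⟨rfl, rfl⟩ | ⟨rfl, rfl⟩
      · exact h1
      · exact h1.symm
    · exact h2 c d h

theorem flat_zero {w : α → ZMod 2} : Flat (0 : Multiset (Sym2 α)) w := by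
  intro a b h
  simp at h

theorem flat_map {E : Multiset (Sym2 α)} {f : α → β} {w : β → ZMod 2}
    (h : Flat E (w ∘ f)) : Flat (E.map (Sym2.map f)) w := by
  intro a b hab
  obtain ⟨e, he, heq⟩ := Multiset.mem_map.1 hab
  induction e using Sym2.ind with
  | _ c d =>
    have hcd := h c d he
    rw [Sym2.map_mk] at heq
    rcases Sym2.eq_iff.1 heq with ⟨rfl, rfl⟩ | ⟨rfl, rfl⟩
    · exact hcd
    · exact hcd.symm

theorem exists_lift {f : α → β} {E : Multiset α} {F : Multiset β} (h : F ≤ E.map f) :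
    ∃ F0 ≤ E, F0.map f = F := by
  induction E using Quotient.inductionOn with
  | _ l =>
  induction F using Quotient.inductionOn with
  | _ m =>
    have h' : List.Subperm m (l.map f) := h
    obtain ⟨m', hm', hs⟩ := h'
    obtain ⟨l', hl', rfl⟩ := List.sublist_map_iff.1 hs
    refine ⟨(l' : Multiset α), Multiset.coe_le.2 hl'.subperm, ?_⟩
    exact Quotient.sound hm'

theorem z2 (z : ZMod 2) : z = 0 ∨ z = 1 := by
  revert z; decide

theorem z2_add_self (z : ZMod 2) : z + z = 0 := by
  revert z; decide

theorem coll_single (S : List α) (a : α) (h : ∀ u ∈ S, u = a) (E : Multiset (Sym2 α)) :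
    Coll S E := by
  intro r hr
  refine ⟨0, Multiset.zero_le _, ?_, ?_⟩
  · intro w _ u hu v hv
    rw [h u hu, h v hv]
  · ext w
    rw [hr _ (fun u hu v hv => by rw [h u hu, h v hv]), bd_zero]
    rfl

end coll

section moves

theorem cle {α : Type} {e : α} {F E : Multiset α} (h : F ≤ E) : e ::ₘ F ≤ e ::ₘ E :=
  Multiset.cons_le_cons _ h

theorem sle {α : Type} {e : α} {F E : Multiset α} (h : F ≤ E) : F ≤ e ::ₘ E :=
  h.trans (Multiset.le_cons_self _ _)

/-- Contraction of vertex `b` to `a`. -/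
def mer (b a : ℕ) (i : ℕ) : ℕ := if Nat.beq i b then a else i

theorem mer_self (b a : ℕ) : mer b a b = a := by simp [mer]

theorem mer_ne {b a i : ℕ} (h : i ≠ b) : mer b a i = i := by
  simp [mer, h]

theorem merge_decomp {a b : ℕ} (w : ℕ → ZMod 2) :
    w = w ∘ mer b a + (w b + w a) • (Pi.single b 1 : ℕ → ZMod 2) := by
  funext i
  by_cases hi : i = b
  · subst hi
    simp only [Pi.add_apply, Function.comp, mer_self, Pi.smul_apply, Pi.single_eq_same,
      smul_eq_mul, mul_one]
    have := z2_add_self (w a)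
    linear_combination -this
  · simp [mer_ne hi, Pi.single_eq_of_ne hi]

theorem restrict_comp {S : List ℕ} {ρ : ℕ → ℕ} {r : (ℕ → ZMod 2) →ₗ[ZMod 2] ZMod 2}
    (hr : ∀ w : ℕ → ZMod 2, (∀ u ∈ S, ∀ v ∈ S, w u = w v) → r w = 0) :
    ∀ w : ℕ → ZMod 2, (∀ u ∈ S.map ρ, ∀ v ∈ S.map ρ, w u = w v) →
      (r ∘ₗ LinearMap.funLeft (ZMod 2) (ZMod 2) ρ) w = 0 := by
  intro w hw
  apply hr
  intro u hu v hv
  exact hw _ (List.mem_map_of_mem hu) _ (List.mem_map_of_mem hv)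

/-- Contracting a double edge. -/
theorem coll_double {S : List ℕ} {E0 : Multiset (Sym2 ℕ)} {a b : ℕ}
    (h : Coll (S.map (mer b a)) (E0.map (Sym2.map (mer b a)))) :
    Coll S (s(a, b) ::ₘ s(a, b) ::ₘ E0) := by
  intro r hr
  obtain ⟨F', hF', hc, hB⟩ := h _ (restrict_comp (ρ := mer b a) hr)
  obtain ⟨F, hF, rfl⟩ := exists_lift hF'
  have hB' : ∀ w : ℕ → ZMod 2, bd F (w ∘ mer b a) = r (w ∘ mer b a) := by
    intro w
    rw [← bd_map, hB]
    rfl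
  set d := (r - bd F) (Pi.single b 1) with hd
  have key : ∀ w, r w = bd F w + (w b + w a) * d := by
    intro w
    have h1 : (r - bd F) w = (w b + w a) * d := by
      conv_lhs => rw [merge_decomp (a := a) (b := b) w]
      rw [map_add, map_smul, LinearMap.sub_apply, hB', sub_self, zero_add, smul_eq_mul]
    rw [LinearMap.sub_apply] at h1
    linear_combination h1
  have hconn : ∀ w : ℕ → ZMod 2, Flat F w → w a = w b → ∀ u ∈ S, ∀ v ∈ S, w u = w v := by
    intro w hw hab u hu v hv
    have hρ : w ∘ mer b a = w := by
      funext i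
      by_cases hi : i = b
      · subst hi; simp [mer_self, hab]
      · simp [mer_ne hi]
    have := hc w (flat_map (by rw [hρ]; exact hw)) _ (List.mem_map_of_mem hu) _
      (List.mem_map_of_mem hv)
    have e1 : ∀ i, w (mer b a i) = w i := fun i => congrFun hρ i
    rwa [e1, e1] at this
  rcases z2 d with h0 | h1
  · refine ⟨s(a, b) ::ₘ s(a, b) ::ₘ F, Multiset.cons_le_cons _ (Multiset.cons_le_cons _ hF), ?_, ?_⟩
    · intro w hw
      rw [flat_cons, flat_cons] at hw
      exact hconn w hw.2.2 hw.1
    · refine LinearMap.ext fun w => ?_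
      rw [key, h0, bd_cons, bd_cons]
      simp only [LinearMap.add_apply, edgeL_mk]
      have := z2_add_self (w a + w b)
      linear_combination this
  · refine ⟨s(a, b) ::ₘ F, Multiset.cons_le_cons _ (hF.trans (Multiset.le_cons_self _ _)), ?_, ?_⟩
    · intro w hw
      rw [flat_cons] at hw
      exact hconn w hw.2 hw.1
    · refine LinearMap.ext fun w => ?_
      rw [key, h1, bd_cons]
      simp only [LinearMap.add_apply, edgeL_mk]
      ring

/-- Simultaneous contraction of `b` to `a` and `d` to `c`. -/
def mer2 (b a d c : ℕ) (i : ℕ) : ℕ := if Nat.beq i b then a else if Nat.beq i d then c else i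

theorem merge2_decomp {a b c d : ℕ} (hbd : b ≠ d) (w : ℕ → ZMod 2) :
    w = w ∘ mer2 b a d c + (w b + w a) • (Pi.single b 1 : ℕ → ZMod 2)
      + (w d + w c) • (Pi.single d 1 : ℕ → ZMod 2) := by
  funext i
  by_cases hi : i = b
  · subst hi
    have h1 : mer2 i a d c i = a := by simp [mer2]
    simp only [Pi.add_apply, Function.comp, h1, Pi.smul_apply, Pi.single_eq_same,
      Pi.single_eq_of_ne hbd, smul_eq_mul, mul_one, mul_zero]
    have := z2_add_self (w a)
    linear_combination -this
  · by_cases hi' : i = d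
    · subst hi'
      have h1 : mer2 b a i c i = c := by simp [mer2, hi]
      simp only [Pi.add_apply, Function.comp, h1, Pi.smul_apply, Pi.single_eq_same,
        Pi.single_eq_of_ne hi, smul_eq_mul, mul_one, mul_zero]
      have := z2_add_self (w c)
      linear_combination -this
    · have h1 : mer2 b a d c i = i := by simp [mer2, hi, hi']
      simp [h1, Pi.single_eq_of_ne hi, Pi.single_eq_of_ne hi']

theorem comp_mer2 {a b c d : ℕ} {w : ℕ → ZMod 2} (h1 : w a = w b) (h2 : w c = w d) :
    w ∘ mer2 b a d c = w := by
  funext i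
  by_cases hi : i = b
  · subst hi; simp [mer2, h1]
  · by_cases hi' : i = d
    · subst hi'; simp [mer2, hi, h2]
    · simp [mer2, hi, hi']

theorem key2 {a b c d : ℕ} (hbd : b ≠ d) {F : Multiset (Sym2 ℕ)}
    {r r' : (ℕ → ZMod 2) →ₗ[ZMod 2] ZMod 2}
    (hB : ∀ w, r (w ∘ mer2 b a d c) = bd F (w ∘ mer2 b a d c) + r' w) (w : ℕ → ZMod 2) :
    r w = bd F w + r' w + (w b + w a) * (r - bd F) (Pi.single b 1)
      + (w d + w c) * (r - bd F) (Pi.single d 1) := by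
  have h1 : (r - bd F) w = r' w + (w b + w a) * (r - bd F) (Pi.single b 1)
      + (w d + w c) * (r - bd F) (Pi.single d 1) := by
    conv_lhs => rw [merge2_decomp (a := a) (c := c) hbd w]
    rw [map_add, map_add, map_smul, map_smul, LinearMap.sub_apply r (bd F) (w ∘ _), hB,
      smul_eq_mul, smul_eq_mul]
    ring
  rw [LinearMap.sub_apply r (bd F) w] at h1
  linear_combination h1

/-- Contracting a triangle. -/
theorem coll_triangle {S : List ℕ} {E0 : Multiset (Sym2 ℕ)} {a b c : ℕ} (hbc : b ≠ c)
    (h : Coll (S.map (mer2 b a c a)) (E0.map (Sym2.map (mer2 b a c a)))) :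
    Coll S (s(a, b) ::ₘ s(b, c) ::ₘ s(a, c) ::ₘ E0) := by
  intro r hr
  obtain ⟨F', hF', hc, hB⟩ := h _ (restrict_comp (ρ := mer2 b a c a) hr)
  obtain ⟨F, hF, rfl⟩ := exists_lift hF'
  have key := key2 (a := a) (c := a) hbc (F := F) (r := r) (r' := 0) (fun w => by
    rw [← bd_map, hB, LinearMap.zero_apply, add_zero]; rfl)
  have hconn : ∀ w : ℕ → ZMod 2, Flat F w → w a = w b → w a = w c →
      ∀ u ∈ S, ∀ v ∈ S, w u = w v := by
    intro w hw hab hac u hu v hv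
    have hρ := comp_mer2 hab hac
    have := hc w (flat_map (by rw [hρ]; exact hw)) _ (List.mem_map_of_mem hu) _
      (List.mem_map_of_mem hv)
    have e1 : ∀ i, w (mer2 b a c a i) = w i := fun i => congrFun hρ i
    rwa [e1, e1] at this
  generalize (r - bd F) (Pi.single b 1) = p at key
  generalize (r - bd F) (Pi.single c 1) = q at key
  rcases z2 p with rfl | rfl <;> rcases z2 q with rfl | rfl
  · refine ⟨s(a, b) ::ₘ s(b, c) ::ₘ s(a, c) ::ₘ F, cle (cle (cle hF)), ?_, ?_⟩
    · intro w hw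
      simp only [flat_cons] at hw
      exact hconn w hw.2.2.2 hw.1 hw.2.2.1
    · refine LinearMap.ext fun w => ?_
      rw [key]
      simp only [bd_cons, LinearMap.add_apply, edgeL_mk, LinearMap.zero_apply]
      linear_combination z2_add_self (w a + w b + w c)
  · refine ⟨s(a, b) ::ₘ s(b, c) ::ₘ F, cle (cle (sle hF)), ?_, ?_⟩
    · intro w hw
      simp only [flat_cons] at hw
      exact hconn w hw.2.2 hw.1 (hw.1.trans hw.2.1)
    · refine LinearMap.ext fun w => ?_
      rw [key]
      simp only [bd_cons, LinearMap.add_apply, edgeL_mk, LinearMap.zero_apply]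
      linear_combination z2_add_self (w b)
  · refine ⟨s(b, c) ::ₘ s(a, c) ::ₘ F, sle (cle (cle hF)), ?_, ?_⟩
    · intro w hw
      simp only [flat_cons] at hw
      exact hconn w hw.2.2 (hw.2.1.trans hw.1.symm) hw.2.1
    · refine LinearMap.ext fun w => ?_
      rw [key]
      simp only [bd_cons, LinearMap.add_apply, edgeL_mk, LinearMap.zero_apply]
      linear_combination z2_add_self (w c)
  · refine ⟨s(a, b) ::ₘ s(a, c) ::ₘ F, cle (sle (cle hF)), ?_, ?_⟩
    · intro w hw
      simp only [flat_cons] at hw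
      exact hconn w hw.2.2 hw.1 hw.2.1
    · refine LinearMap.ext fun w => ?_
      rw [key]
      simp only [bd_cons, LinearMap.add_apply, edgeL_mk, LinearMap.zero_apply]
      ring

theorem z2_ne {x y : ZMod 2} (h : x ≠ y) : y = x + 1 := by
  revert x y; decide

/-- Catlin's `π`-reduction. -/
theorem coll_pi {S : List ℕ} {E0 : Multiset (Sym2 ℕ)} {x₁ y₁ x₂ y₂ : ℕ} (hxy : x₂ ≠ y₂)
    (hx : x₁ ∈ S.map (mer2 x₂ x₁ y₂ y₁)) (hy : y₁ ∈ S.map (mer2 x₂ x₁ y₂ y₁))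
    (h : Coll (S.map (mer2 x₂ x₁ y₂ y₁))
      (s(x₁, y₁) ::ₘ E0.map (Sym2.map (mer2 x₂ x₁ y₂ y₁)))) :
    Coll S (s(x₁, y₁) ::ₘ s(y₁, x₂) ::ₘ s(x₂, y₂) ::ₘ s(y₂, x₁) ::ₘ E0) := by
  intro r hr
  obtain ⟨F', hF', hc, hB⟩ := h _ (restrict_comp (ρ := mer2 x₂ x₁ y₂ y₁) hr)
  by_cases he : s(x₁, y₁) ∈ F'
  · obtain ⟨F'', rfl⟩ := Multiset.exists_cons_of_mem he
    obtain ⟨F, hF, rfl⟩ := exists_lift ((Multiset.cons_le_cons_iff _).1 hF')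
    have key := key2 (a := x₁) (c := y₁) hxy (F := F) (r := r) (r' := edgeL s(x₁, y₁))
      (fun w => by
        rw [← bd_map]
        have := congrArg (fun l => l w) hB
        simp only [bd_cons, LinearMap.add_apply] at this
        rw [add_comm, this]
        rfl)
    have hconn : ∀ w : ℕ → ZMod 2, Flat F w → w x₁ = w x₂ → w y₁ = w y₂ → w x₁ = w y₁ →
        ∀ u ∈ S, ∀ v ∈ S, w u = w v := by
      intro w hw hab hac hxy1 u hu v hv
      have hρ := comp_mer2 hab hac
      have := hc w (flat_cons.2 ⟨hxy1, flat_map (by rw [hρ]; exact hw)⟩) _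
        (List.mem_map_of_mem hu) _ (List.mem_map_of_mem hv)
      have e1 : ∀ i, w (mer2 x₂ x₁ y₂ y₁ i) = w i := fun i => congrFun hρ i
      rwa [e1, e1] at this
    generalize (r - bd F) (Pi.single x₂ 1) = p at key
    generalize (r - bd F) (Pi.single y₂ 1) = q at key
    rcases z2 p with rfl | rfl <;> rcases z2 q with rfl | rfl
    · refine ⟨s(y₁, x₂) ::ₘ s(x₂, y₂) ::ₘ s(y₂, x₁) ::ₘ F, sle (cle (cle (cle hF))), ?_, ?_⟩
      · intro w hw
        simp only [flat_cons] at hw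
        obtain ⟨h1, h2, h3, h4⟩ := hw
        exact hconn w h4 (by rw [h2, h3]) (by rw [h1, h2]) (by rw [h1, h2, h3])
      · refine LinearMap.ext fun w => ?_
        rw [key]
        simp only [bd_cons, LinearMap.add_apply, edgeL_mk]
        linear_combination z2_add_self (w x₂) + z2_add_self (w y₂)
    · refine ⟨s(x₁, y₁) ::ₘ s(y₁, x₂) ::ₘ s(x₂, y₂) ::ₘ F, cle (cle (cle (sle hF))), ?_, ?_⟩
      · intro w hw
        simp only [flat_cons] at hw
        obtain ⟨h1, h2, h3, h4⟩ := hw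
        exact hconn w h4 (by rw [h1, h2]) (by rw [h2, h3]) h1
      · refine LinearMap.ext fun w => ?_
        rw [key]
        simp only [bd_cons, LinearMap.add_apply, edgeL_mk]
        linear_combination z2_add_self (w x₂)
    · refine ⟨s(x₁, y₁) ::ₘ s(x₂, y₂) ::ₘ s(y₂, x₁) ::ₘ F, cle (sle (cle (cle hF))), ?_, ?_⟩
      · intro w hw
        simp only [flat_cons] at hw
        obtain ⟨h1, h2, h3, h4⟩ := hw
        exact hconn w h4 (by rw [h2, h3]) (by rw [h3, h1]) h1
      · refine LinearMap.ext fun w => ?_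
        rw [key]
        simp only [bd_cons, LinearMap.add_apply, edgeL_mk]
        linear_combination z2_add_self (w y₂)
    · refine ⟨s(x₁, y₁) ::ₘ s(y₁, x₂) ::ₘ s(y₂, x₁) ::ₘ F, cle (cle (sle (cle hF))), ?_, ?_⟩
      · intro w hw
        simp only [flat_cons] at hw
        obtain ⟨h1, h2, h3, h4⟩ := hw
        exact hconn w h4 (by rw [h1, h2]) (by rw [h3, h1]) h1
      · refine LinearMap.ext fun w => ?_
        rw [key]
        simp only [bd_cons, LinearMap.add_apply, edgeL_mk]
        ring
  · obtain ⟨F, hF, rfl⟩ := exists_lift ((Multiset.le_cons_of_notMem he).1 hF')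
    have key := key2 (a := x₁) (c := y₁) hxy (F := F) (r := r) (r' := 0) (fun w => by
      rw [← bd_map, hB, LinearMap.zero_apply, add_zero]; rfl)
    have hflat : ∀ w : ℕ → ZMod 2, Flat F w → w x₁ = w x₂ → w y₁ = w y₂ →
        w x₁ = w y₁ ∧ ∀ u ∈ S, ∀ v ∈ S, w u = w v := by
      intro w hw hab hac
      have hρ := comp_mer2 hab hac
      have hcc := hc w (flat_map (by rw [hρ]; exact hw))
      refine ⟨hcc _ hx _ hy, fun u hu v hv => ?_⟩
      have := hcc _ (List.mem_map_of_mem hu) _ (List.mem_map_of_mem hv)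
      have e1 : ∀ i, w (mer2 x₂ x₁ y₂ y₁ i) = w i := fun i => congrFun hρ i
      rwa [e1, e1] at this
    have hadd : ∀ f g : ℕ → ZMod 2, Flat F f → Flat F g → Flat F (f + g) := by
      intro f g hf hg a b hab
      simp [hf a b hab, hg a b hab]
    generalize (r - bd F) (Pi.single x₂ 1) = p at key
    generalize (r - bd F) (Pi.single y₂ 1) = q at key
    rcases z2 p with rfl | rfl <;> rcases z2 q with rfl | rfl
    · refine ⟨s(x₁, y₁) ::ₘ s(y₁, x₂) ::ₘ s(x₂, y₂) ::ₘ s(y₂, x₁) ::ₘ F,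
        cle (cle (cle (cle hF))), ?_, ?_⟩
      · intro w hw
        simp only [flat_cons] at hw
        obtain ⟨h1, h2, h3, h3', h4⟩ := hw
        exact (hflat w h4 (by rw [h1, h2]) (by rw [h2, h3])).2
      · refine LinearMap.ext fun w => ?_
        rw [key]
        simp only [bd_cons, LinearMap.add_apply, edgeL_mk, LinearMap.zero_apply]
        linear_combination z2_add_self (w x₂ + w x₁ + w y₂ + w y₁)
    · by_cases hopt : Conn S (s(x₁, y₁) ::ₘ s(y₂, x₁) ::ₘ F)
      · refine ⟨_, cle (sle (sle (cle hF))), hopt, ?_⟩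
        refine LinearMap.ext fun w => ?_
        rw [key]
        simp only [bd_cons, LinearMap.add_apply, edgeL_mk, LinearMap.zero_apply]
        linear_combination z2_add_self (w x₁)
      · refine ⟨s(y₁, x₂) ::ₘ s(x₂, y₂) ::ₘ F, sle (cle (cle (sle hF))), ?_, ?_⟩
        · intro g hg
          simp only [flat_cons] at hg
          obtain ⟨g1, g2, g3⟩ := hg
          by_contra hcon
          apply hopt
          intro f hf
          simp only [flat_cons] at hf
          obtain ⟨f1, f2, f3⟩ := hf
          by_contra hcon'
          have hg' : g x₂ ≠ g x₁ := fun hh => hcon (hflat g g3 hh.symm (by rw [g1, g2])).2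
          have hf' : f x₁ ≠ f x₂ := fun hh => hcon' (hflat f f3 hh (by rw [← f1, f2])).2
          have e1 := z2_ne hg'
          have e2 := z2_ne hf'
          have := (hflat (f + g) (hadd f g f3 g3)
            (by simp only [Pi.add_apply]; rw [e1, e2]
                linear_combination -(z2_add_self (0 : ZMod 2)))
            (by simp only [Pi.add_apply]; rw [← f1, f2, g1, g2])).1
          simp only [Pi.add_apply, ← f1, g1] at this
          rw [e1] at this
          have h1 : (1 : ZMod 2) = 0 := by linear_combination this
          exact absurd h1 (by decide)
        · refine LinearMap.ext fun w => ?_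
          rw [key]
          simp only [bd_cons, LinearMap.add_apply, edgeL_mk, LinearMap.zero_apply]
          linear_combination z2_add_self (w x₂)
    · by_cases hopt : Conn S (s(x₁, y₁) ::ₘ s(y₁, x₂) ::ₘ F)
      · refine ⟨_, cle (cle (sle (sle hF))), hopt, ?_⟩
        refine LinearMap.ext fun w => ?_
        rw [key]
        simp only [bd_cons, LinearMap.add_apply, edgeL_mk, LinearMap.zero_apply]
        linear_combination z2_add_self (w y₁)
      · refine ⟨s(x₂, y₂) ::ₘ s(y₂, x₁) ::ₘ F, sle (sle (cle (cle hF))), ?_, ?_⟩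
        · intro g hg
          simp only [flat_cons] at hg
          obtain ⟨g1, g2, g3⟩ := hg
          by_contra hcon
          apply hopt
          intro f hf
          simp only [flat_cons] at hf
          obtain ⟨f1, f2, f3⟩ := hf
          by_contra hcon'
          have hg' : g y₂ ≠ g y₁ := fun hh => hcon (hflat g g3 (by rw [g1, g2]) hh.symm).2
          have hf' : f y₁ ≠ f y₂ := fun hh => hcon' (hflat f f3 (by rw [f1, f2]) hh).2
          have e1 := z2_ne hg'
          have e2 := z2_ne hf'
          have := (hflat (f + g) (hadd f g f3 g3)
            (by simp only [Pi.add_apply]; rw [f1, f2, g1, g2])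
            (by simp only [Pi.add_apply]; rw [e1, e2]
                linear_combination -(z2_add_self (0 : ZMod 2)))).1
          simp only [Pi.add_apply, f1, ← g2] at this
          rw [e1] at this
          have h1 : (1 : ZMod 2) = 0 := by linear_combination -this
          exact absurd h1 (by decide)
        · refine LinearMap.ext fun w => ?_
          rw [key]
          simp only [bd_cons, LinearMap.add_apply, edgeL_mk, LinearMap.zero_apply]
          linear_combination z2_add_self (w y₂)
    · by_cases hopt : Conn S (s(x₁, y₁) ::ₘ s(x₂, y₂) ::ₘ F)
      · refine ⟨_, cle (sle (cle (sle hF))), hopt, ?_⟩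
        refine LinearMap.ext fun w => ?_
        rw [key]
        simp only [bd_cons, LinearMap.add_apply, edgeL_mk, LinearMap.zero_apply]
        ring
      · refine ⟨s(y₁, x₂) ::ₘ s(y₂, x₁) ::ₘ F, sle (cle (sle (cle hF))), ?_, ?_⟩
        · intro g hg
          simp only [flat_cons] at hg
          obtain ⟨g1, g2, g3⟩ := hg
          by_contra hcon
          apply hopt
          intro f hf
          simp only [flat_cons] at hf
          obtain ⟨f1, f2, f3⟩ := hf
          by_contra hcon'
          have hg' : g x₁ ≠ g x₂ := fun hh => hcon (hflat g g3 hh (by rw [g1, g2, hh])).2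
          have hf' : f x₁ ≠ f x₂ := fun hh => hcon' (hflat f f3 hh (by rw [← f1, ← f2, hh])).2
          have e1 := z2_ne hg'
          have e2 := z2_ne hf'
          have := (hflat (f + g) (hadd f g f3 g3)
            (by simp only [Pi.add_apply]; rw [e1, e2]
                linear_combination -(z2_add_self (1 : ZMod 2)))
            (by simp only [Pi.add_apply]; rw [← f1, g1, ← f2, g2, e1, e2]; ring)).1
          simp only [Pi.add_apply] at this
          rw [← f1, g1, e1] at this
          have h1 : (1 : ZMod 2) = 0 := by linear_combination -this
          exact absurd h1 (by decide)
        · refine LinearMap.ext fun w => ?_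
          rw [key]
          simp only [bd_cons, LinearMap.add_apply, edgeL_mk, LinearMap.zero_apply]
          ring

end moves

end S6

namespace S6

open Multigraph

/-! ### Transport to multigraphs -/

section transport

variable {V : Type}

theorem conn_transport {S : List ℕ} {E : Multiset (Sym2 ℕ)} (φ : ℕ → V) (hS : S ≠ [])
    (hE : ∀ e ∈ E, ∀ i ∈ e, i ∈ S) (hc : Conn S E) :
    ConnOn {x | ∃ i ∈ S, φ i = x} (E.map (Sym2.map φ)) := by
  refine ⟨?_, ?_, ?_⟩
  · obtain ⟨a, ha⟩ := List.exists_mem_of_ne_nil S hS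
    exact ⟨φ a, a, ha, rfl⟩
  · intro e he v hv
    obtain ⟨e', he', rfl⟩ := Multiset.mem_map.1 he
    obtain ⟨i, hi, rfl⟩ := Sym2.mem_map.1 hv
    exact ⟨i, hE e' he' i hi, rfl⟩
  · rintro u ⟨i, hi, rfl⟩ v ⟨j, hj, rfl⟩
    set rel := fun a b => s(a, b) ∈ E.map (Sym2.map φ) with hrel
    have hflat : Flat E (fun k => if Relation.ReflTransGen rel (φ i) (φ k) then 1 else 0) := by
      intro a b hab
      have h1 : rel (φ a) (φ b) := Multiset.mem_map.2 ⟨s(a, b), hab, rfl⟩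
      have h2 : rel (φ b) (φ a) := Multiset.mem_map.2 ⟨s(a, b), hab, by
        rw [Sym2.map_mk]; exact Sym2.eq_swap⟩
      have : Relation.ReflTransGen rel (φ i) (φ a) ↔ Relation.ReflTransGen rel (φ i) (φ b) :=
        ⟨fun h => h.tail h1, fun h => h.tail h2⟩
      simp only [this]
    have := hc _ hflat i hi j hj
    by_contra hcon
    rw [if_pos Relation.ReflTransGen.refl, if_neg hcon] at this
    exact absurd this (by decide)

theorem deg_parity (E : Multiset (Sym2 V)) (hE : ∀ e ∈ E, ¬ e.IsDiag) (x : V) :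
    (degIn E x : ZMod 2) = bd E (Pi.single x 1) := by
  induction E using Multiset.induction_on with
  | empty => simp [degIn, bd]
  | cons e E ih =>
    have ih' := ih (fun e he => hE e (Multiset.mem_cons_of_mem he))
    have he := hE e (Multiset.mem_cons_self _ _)
    rw [bd_cons, LinearMap.add_apply, ← ih']
    unfold degIn
    induction e using Sym2.ind with
    | _ a b =>
      rw [Sym2.mk_isDiag_iff] at he
      rw [edgeL_mk]
      by_cases ha : x = a
      · subst ha
        rw [Multiset.filter_cons_of_pos _ (by simp)]
        simp [Ne.symm he, add_comm]
      · by_cases hb : x = b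
        · subst hb
          rw [Multiset.filter_cons_of_pos _ (by simp)]
          simp [he, add_comm]
        · rw [Multiset.filter_cons_of_neg _ (by simp [ha, hb])]
          simp [Pi.single_apply, Ne.symm ha, Ne.symm hb]

theorem odd_iff_cast (n : ℕ) : Odd n ↔ (n : ZMod 2) = 1 := by
  rw [← Nat.not_even_iff_odd, ← ZMod.natCast_eq_zero_iff_even]
  rcases z2 (n : ZMod 2) with h | h <;> rw [h] <;> decide

theorem coll_pair {S : List ℕ} {E : Multiset (Sym2 ℕ)} (φ : ℕ → V) (hS : S ≠ [])
    (hE : ∀ e ∈ E, ∀ i ∈ e, i ∈ S) (hc : Coll S E)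
    (hl : ∀ e ∈ E.map (Sym2.map φ), ¬ e.IsDiag) :
    CollapsiblePair {x | ∃ i ∈ S, φ i = x} (E.map (Sym2.map φ)) := by
  refine ⟨?_, ?_, ?_⟩
  · obtain ⟨a, ha⟩ := List.exists_mem_of_ne_nil S hS
    exact ⟨φ a, a, ha, rfl⟩
  · intro e he v hv
    obtain ⟨e', he', rfl⟩ := Multiset.mem_map.1 he
    obtain ⟨i, hi, rfl⟩ := Sym2.mem_map.1 hv
    exact ⟨i, hE e' he' i hi, rfl⟩
  · intro R hRS hfin heven
    have hψ : ∀ x : V, ∃ i : ℕ, x ∈ R → i ∈ S ∧ φ i = x := by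
      intro x
      by_cases hx : x ∈ R
      · obtain ⟨i, hi, hix⟩ := hRS hx
        exact ⟨i, fun _ => ⟨hi, hix⟩⟩
      · exact ⟨0, fun h => absurd h hx⟩
    choose ψ hψ using hψ
    obtain ⟨E', hE', hconn, hbd⟩ := hc
      (∑ x ∈ hfin.toFinset, LinearMap.proj (ψ x)) (by
        intro w hw
        obtain ⟨a, ha⟩ := List.exists_mem_of_ne_nil S hS
        rw [LinearMap.sum_apply]
        have : ∀ x ∈ hfin.toFinset, (LinearMap.proj (R := ZMod 2) (φ := fun _ : ℕ => ZMod 2)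
            (ψ x)) w = w a := by
          intro x hx
          exact hw _ (hψ x (hfin.mem_toFinset.1 hx)).1 _ ha
        rw [Finset.sum_congr rfl this, Finset.sum_const, ← Set.ncard_eq_toFinset_card R hfin]
        obtain ⟨k, hk⟩ := heven
        rw [hk, add_nsmul]
        exact z2_add_self _)
    refine ⟨E'.map (Sym2.map φ), Multiset.map_le_map hE', ?_, ?_⟩
    · exact conn_transport φ hS (fun e he => hE e (Multiset.mem_of_le hE' he)) hconn
    · intro x hx
      rw [odd_iff_cast, deg_parity _ (fun e he => hl e
        (Multiset.mem_of_le (Multiset.map_le_map hE') he)), bd_map, hbd, LinearMap.sum_apply]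
      have : ∀ y ∈ hfin.toFinset, (LinearMap.proj (R := ZMod 2) (φ := fun _ : ℕ => ZMod 2)
            (ψ y)) ((Pi.single x 1 : V → ZMod 2) ∘ φ) = if y = x then 1 else 0 := by
        intro y hy
        rw [LinearMap.proj_apply, Function.comp, (hψ y (hfin.mem_toFinset.1 hy)).2,
          Pi.single_apply]
      rw [Finset.sum_congr rfl this, Finset.sum_ite_eq']
      by_cases hxR : x ∈ R <;> simp [hxR]

theorem no_coll {G : Multigraph V} (hred : G.Reduced) {S : List ℕ} {E : Multiset (Sym2 ℕ)}
    (φ : ℕ → V) (hE : ∀ e ∈ E, ∀ i ∈ e, i ∈ S) (hc : Coll S E)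
    (hle : E.map (Sym2.map φ) ≤ G.edges) {u v : ℕ} (hu : u ∈ S) (hv : v ∈ S)
    (huv : φ u ≠ φ v) : False := by
  have hS : S ≠ [] := List.ne_nil_of_mem hu
  have hp := coll_pair φ hS hE hc (fun e he => G.loopless e (Multiset.mem_of_le hle he))
  have h1 := hred _ _ ⟨hle, hp.2.1⟩ hp
  have hfin : {x | ∃ i ∈ S, φ i = x}.Finite := by
    have : {x | ∃ i ∈ S, φ i = x} = φ '' {i | i ∈ S} := by
      ext x; simp
    rw [this]
    exact (List.finite_toSet S).image φ
  have := (Set.ncard_le_one hfin).1 h1 (φ u) ⟨u, hu, rfl⟩ (φ v) ⟨v, hv, rfl⟩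
  exact huv this

theorem edges_nodup {G : Multigraph V} (hred : G.Reduced) : G.edges.Nodup := by
  rw [Multiset.nodup_iff_count_le_one]
  intro e
  by_contra hcon
  push Not at hcon
  have hmem : e ∈ G.edges := Multiset.count_pos.1 (by omega)
  have hle : Multiset.replicate 2 e ≤ G.edges := Multiset.le_count_iff_replicate_le.1 hcon
  have hloop := G.loopless e hmem
  induction e using Sym2.ind with
  | _ a b =>
    rw [Sym2.mk_isDiag_iff] at hloop
    refine no_coll hred (S := [0, 1]) (E := s(0, 1) ::ₘ s(0, 1) ::ₘ 0)
      (fun i => if i = 0 then a else b) ?_ ?_ ?_ (u := 0) (v := 1) (by simp) (by simp)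
      (by simpa using hloop)
    · intro e he i hi
      simp only [Multiset.mem_cons, Multiset.notMem_zero, or_false, or_self] at he
      subst he
      simpa using hi
    · apply coll_double
      exact coll_single _ 0 (by simp [mer]) _
    · simpa [Multiset.replicate_succ] using hle

end transport

/-! ### Checking collapsibility of explicit graphs -/

/-- The edge multiset of a list of pairs. -/
def toM (E : List (ℕ × ℕ)) : Multiset (Sym2 ℕ) := ↑(E.map fun e => s(e.1, e.2))

theorem toM_cons (e : ℕ × ℕ) (E : List (ℕ × ℕ)) : toM (e :: E) = s(e.1, e.2) ::ₘ toM E := rfl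

/-- Relabel the ends of edges. -/
def mapE (ρ : ℕ → ℕ) (E : List (ℕ × ℕ)) : List (ℕ × ℕ) := E.map fun e => (ρ e.1, ρ e.2)

theorem toM_mapE (ρ : ℕ → ℕ) (E : List (ℕ × ℕ)) :
    toM (mapE ρ E) = (toM E).map (Sym2.map ρ) := by
  simp [toM, mapE, Function.comp_def]

/-- Remove one copy of the edge `ab`. -/
def takeE (a b : ℕ) : List (ℕ × ℕ) → Option (List (ℕ × ℕ))
  | [] => none
  | e :: E =>
    bif (Nat.beq a e.1 && Nat.beq b e.2) || (Nat.beq a e.2 && Nat.beq b e.1) then some E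
    else match takeE a b E with
      | none => none
      | some E' => some (e :: E')

theorem takeE_some {a b : ℕ} {E E' : List (ℕ × ℕ)} (h : takeE a b E = some E') :
    toM E = s(a, b) ::ₘ toM E' := by
  induction E generalizing E' with
  | nil => simp [takeE] at h
  | cons e E ih =>
    rw [takeE] at h
    cases hb : ((Nat.beq a e.1 && Nat.beq b e.2) || (Nat.beq a e.2 && Nat.beq b e.1)) with
    | true =>
      rw [hb, cond_true, Option.some.injEq] at h
      subst h
      rw [toM_cons]
      congr 1
      simp only [Bool.or_eq_true, Bool.and_eq_true, Nat.beq_eq] at hb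
      rcases hb with ⟨rfl, rfl⟩ | ⟨rfl, rfl⟩
      · rfl
      · exact Sym2.eq_swap
    | false =>
      rw [hb, cond_false] at h
      cases ht : takeE a b E with
      | none => simp [ht] at h
      | some E1 =>
        rw [ht] at h
        simp only [Option.some.injEq] at h
        subst h
        rw [toM_cons, toM_cons, ih ht, Multiset.cons_swap]

/-- Remove a list of edges. -/
def takes : List (ℕ × ℕ) → List (ℕ × ℕ) → Option (List (ℕ × ℕ))
  | [], E => some E
  | e :: es, E => match takeE e.1 e.2 E with
    | none => none
    | some E' => takes es E'

theorem takes_some {es E E' : List (ℕ × ℕ)} (h : takes es E = some E') :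
    toM E = toM es + toM E' := by
  induction es generalizing E with
  | nil =>
    simp only [takes, Option.some.injEq] at h
    subst h
    simp [toM]
  | cons e es ih =>
    rw [takes] at h
    cases ht : takeE e.1 e.2 E with
    | none => simp [ht] at h
    | some E1 =>
      rw [ht] at h
      rw [takeE_some ht, ih h, toM_cons, Multiset.cons_add]

/-- Membership test. -/
def memB (a : ℕ) (S : List ℕ) : Bool := S.any fun b => Nat.beq a b

theorem memB_iff {a : ℕ} {S : List ℕ} (h : memB a S = true) : a ∈ S := by
  simpa [memB] using h

/-- Run a sequence of reductions: `[a, b]` contracts a double edge, `[a, b, c]` a triangle,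
`[x₁, y₁, x₂, y₂]` is a `π`-reduction. -/
def run : List (List ℕ) → List ℕ → List (ℕ × ℕ) → Bool
  | [], S, _ => match S with
    | [] => false
    | a :: S' => S'.all fun b => Nat.beq b a
  | m :: tr, S, E => match m with
    | [a, b] => match takes [(a, b), (a, b)] E with
      | none => false
      | some E' => run tr (S.map (mer b a)) (mapE (mer b a) E')
    | [a, b, c] => match takes [(a, b), (b, c), (a, c)] E with
      | none => false
      | some E' => !(Nat.beq b c) && run tr (S.map (mer2 b a c a)) (mapE (mer2 b a c a) E')
    | [x₁, y₁, x₂, y₂] => match takes [(x₁, y₁), (y₁, x₂), (x₂, y₂), (y₂, x₁)] E with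
      | none => false
      | some E' => !(Nat.beq x₂ y₂) && (memB x₁ (S.map (mer2 x₂ x₁ y₂ y₁)) &&
          (memB y₁ (S.map (mer2 x₂ x₁ y₂ y₁)) &&
          run tr (S.map (mer2 x₂ x₁ y₂ y₁)) ((x₁, y₁) :: mapE (mer2 x₂ x₁ y₂ y₁) E')))
    | _ => false

theorem run_sound {tr : List (List ℕ)} {S : List ℕ} {E : List (ℕ × ℕ)}
    (h : run tr S E = true) : Coll S (toM E) := by
  induction tr generalizing S E with
  | nil =>
    cases S with
    | nil => simp [run] at h
    | cons a S' =>
      simp only [run, List.all_eq_true, Nat.beq_eq] at h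
      refine coll_single _ a ?_ _
      intro u hu
      rcases List.mem_cons.1 hu with rfl | hu
      · rfl
      · exact h u hu
  | cons m tr ih =>
    rw [run.eq_def] at h
    simp only at h
    split at h
    · rename_i a b
      split at h
      · simp at h
      · rename_i E' ht
        rw [takes_some ht]
        have := ih h
        rw [toM_mapE] at this
        exact coll_double this
    · rename_i a b c
      split at h
      · simp at h
      · rename_i E' ht
        rw [takes_some ht]
        simp only [Bool.and_eq_true, Bool.not_eq_true'] at h
        have := ih h.2
        rw [toM_mapE] at this
        exact coll_triangle (Nat.ne_of_beq_eq_false h.1) this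
    · rename_i x₁ y₁ x₂ y₂
      split at h
      · simp at h
      · rename_i E' ht
        rw [takes_some ht]
        simp only [Bool.and_eq_true, Bool.not_eq_true'] at h
        have := ih h.2.2.2
        rw [toM_cons, toM_mapE] at this
        exact coll_pi (Nat.ne_of_beq_eq_false h.1) (memB_iff h.2.1) (memB_iff h.2.2.1) this
    · simp at h

/-- All ends of edges. -/
def verts (E : List (ℕ × ℕ)) : List ℕ := E.map Prod.fst ++ E.map Prod.snd

/-- No repeated pair. -/
def ndB : List (ℕ × ℕ) → Bool
  | [] => true
  | e :: E => E.all (fun d => !(Nat.beq e.1 d.1 && Nat.beq e.2 d.2)) && ndB E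

theorem ndB_sound {E : List (ℕ × ℕ)} (h : ndB E = true) : E.Nodup := by
  induction E with
  | nil => exact List.nodup_nil
  | cons e E ih =>
    simp only [ndB, Bool.and_eq_true, List.all_eq_true, Bool.not_eq_true'] at h
    refine List.nodup_cons.2 ⟨fun he => ?_, ih h.2⟩
    have := h.1 e he
    simp at this

/-- The full check for an explicit graph. -/
def cc (E : List (ℕ × ℕ)) (tr : List (List ℕ)) : Bool :=
  !E.isEmpty && (E.all (fun e => Nat.blt e.1 e.2) && (ndB E && run tr (verts E) E))

theorem cc_sound {V : Type} {G : Multigraph V} (hred : G.Reduced) {E : List (ℕ × ℕ)}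
    {tr : List (List ℕ)} (h : cc E tr = true) (φ : ℕ → V) (θ : V → ℕ)
    (hE : ∀ e ∈ E, s(φ e.1, φ e.2) ∈ G.edges ∧ θ (φ e.1) = e.1 ∧ θ (φ e.2) = e.2) :
    False := by
  simp only [cc, Bool.and_eq_true, List.all_eq_true, Bool.not_eq_true', List.isEmpty_eq_false_iff,
    Nat.blt_eq] at h
  obtain ⟨hne, hlt, hnd, hrun⟩ := h
  obtain ⟨e, he⟩ := List.exists_mem_of_ne_nil E hne
  refine no_coll hred φ (S := verts E) (E := toM E) ?_ (run_sound hrun) ?_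
    (u := e.1) (v := e.2) ?_ ?_ ?_
  · intro d hd i hi
    have hd' : d ∈ E.map fun e => s(e.1, e.2) := hd
    obtain ⟨c, hc, rfl⟩ := List.mem_map.1 hd'
    rcases Sym2.mem_iff.1 hi with rfl | rfl
    · exact List.mem_append_left _ (List.mem_map_of_mem hc)
    · exact List.mem_append_right _ (List.mem_map_of_mem hc)
  · have hmap : (toM E).map (Sym2.map φ) = ↑(E.map fun e => s(φ e.1, φ e.2)) := by
      simp [toM, Function.comp_def]
    rw [hmap]
    refine (Multiset.le_iff_subset ?_).2 ?_
    · rw [Multiset.coe_nodup]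
      refine (List.nodup_map_iff_inj_on (ndB_sound hnd)).2 ?_
      intro c hc d hd hcd
      obtain ⟨-, c1, c2⟩ := hE c hc
      obtain ⟨-, d1, d2⟩ := hE d hd
      rcases Sym2.eq_iff.1 hcd with ⟨h1, h2⟩ | ⟨h1, h2⟩
      · rw [h1, d1] at c1
        rw [h2, d2] at c2
        exact Prod.ext c1.symm c2.symm
      · rw [h1, d2] at c1
        rw [h2, d1] at c2
        have := hlt c hc
        have := hlt d hd
        omega
    · intro d hd
      have hd' : d ∈ E.map fun e => s(φ e.1, φ e.2) := hd
      obtain ⟨c, hc, rfl⟩ := List.mem_map.1 hd'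
      exact (hE c hc).1
  · exact List.mem_append_left _ (List.mem_map_of_mem he)
  · exact List.mem_append_right _ (List.mem_map_of_mem he)
  · intro hh
    obtain ⟨-, c1, c2⟩ := hE e he
    have := hlt e he
    rw [hh, c2] at c1
    omega

end S6

namespace S6

open Multigraph

/-! ### Systems of triples and their realizations -/

/-- The 35 triples of `{0, …, 6}` as bit masks. -/
def triples : List ℕ :=
  [7, 11, 19, 35, 67, 13, 21, 37, 69, 25, 41, 73, 49, 81, 97, 14, 22, 38, 70, 26, 42, 74, 50, 82,
    98, 28, 44, 76, 52, 84, 100, 56, 88, 104, 112]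

theorem triples_specB : ((List.range 7).all fun a => (List.range 7).all fun b =>
    (List.range 7).all fun c => Nat.beq a b || (Nat.beq a c || (Nat.beq b c ||
      triples.any fun t => Nat.beq (2 ^ a ||| 2 ^ b ||| 2 ^ c) t))) = true := by
  decide +kernel

theorem triples_spec : ∀ a < 7, ∀ b < 7, ∀ c < 7, a ≠ b → a ≠ c → b ≠ c →
    2 ^ a ||| 2 ^ b ||| 2 ^ c ∈ triples := by
  intro a ha b hb c hc hab hac hbc
  have h := triples_specB
  rw [List.all_eq_true] at h
  have h := h a (List.mem_range.2 ha)
  rw [List.all_eq_true] at h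
  have h := h b (List.mem_range.2 hb)
  rw [List.all_eq_true] at h
  have h := h c (List.mem_range.2 hc)
  simp only [Bool.or_eq_true, Nat.beq_eq, List.any_eq_true] at h
  rcases h with h | h | h | ⟨t, ht, h⟩
  · exact absurd h hab
  · exact absurd h hac
  · exact absurd h hbc
  · rw [h]; exact ht

/-- Image of a mask under the relabelling `i ↦ gs[i]`. -/
def mapMask : List ℕ → ℕ → ℕ
  | [], _ => 0
  | g :: gs, m => match m % 2 with
    | 0 => mapMask gs (m / 2)
    | _ => 2 ^ g ||| mapMask gs (m / 2)

theorem mapMask_testBit {gs : List ℕ} {m k : ℕ} (h : (mapMask gs m).testBit k = true) :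
    ∃ i, m.testBit i = true ∧ gs[i]? = some k := by
  induction gs generalizing m with
  | nil => simp [mapMask] at h
  | cons g gs ih =>
    rw [mapMask] at h
    split at h
    · obtain ⟨i, hi, hk⟩ := ih h
      refine ⟨i + 1, ?_, by simpa using hk⟩
      rw [Nat.testBit_succ]
      exact hi
    · rename_i hm
      rw [Nat.testBit_lor, Bool.or_eq_true] at h
      rcases h with h | h
      · rw [Nat.testBit_two_pow] at h
        refine ⟨0, ?_, by simpa using h⟩
        rw [Nat.testBit_zero]
        have : m % 2 = 1 := by
          have := Nat.mod_lt m (show 0 < 2 by norm_num)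
          have : m % 2 ≠ 0 := hm
          omega
        simp [this]
      · obtain ⟨i, hi, hk⟩ := ih h
        refine ⟨i + 1, ?_, by simpa using hk⟩
        rw [Nat.testBit_succ]
        exact hi

/-- Remove the first mask containing `m`. -/
def takeM (m : ℕ) : List ℕ → Option (List ℕ)
  | [] => none
  | l :: L => bif Nat.beq (Nat.land m l) m then some L else match takeM m L with
    | none => none
    | some L' => some (l :: L')

/-- `c` is dominated by `L`. -/
def dom : List ℕ → List ℕ → Bool
  | [], _ => true
  | m :: c, L => match takeM m L with
    | none => false
    | some L' => dom c L'

/-- The first digits in base eight. -/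
def digits : ℕ → ℕ → List ℕ
  | 0, _ => []
  | k + 1, n => n % 8 :: digits k (n / 8)

/-- Two-level lookup. -/
def look (tg : List (List (List ℕ))) (i : ℕ) : Option (List ℕ) :=
  match tg[i / 16]? with
  | none => none
  | some l => l[i % 16]?

theorem look_mem {tg : List (List (List ℕ))} {i : ℕ} {c : List ℕ} (h : look tg i = some c) :
    c ∈ tg.flatten := by
  unfold look at h
  split at h
  · simp at h
  · rename_i l hl
    exact List.mem_flatten.2 ⟨l, List.mem_of_getElem? hl, List.mem_of_getElem? h⟩

/-- One certificate: `L`, relabelled, dominates a system in the table. -/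
def chk (tg : List (List (List ℕ))) (L : List ℕ) (e : ℕ) : Bool :=
  match look tg (e % 512) with
  | none => false
  | some c => (fun gs => Nat.beq (mapMask gs 127) 127 && dom c (L.map (mapMask gs)))
      (digits 7 (e / 512))

/-- Certificates for all the one-triple extensions of `r`. -/
def stepGo (tg : List (List (List ℕ))) (r : List ℕ) : List ℕ → ℕ → Bool
  | [], _ => true
  | t :: ts, n => chk tg (t :: r) (n % 1073741824) && stepGo tg r ts (n / 1073741824)

/-- More points than triples. -/
def suppB (r : List ℕ) : Bool :=
  Nat.blt r.length ((List.range 7).filter fun i => r.any fun m => Nat.testBit m i).length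

/-- Check a whole level. -/
def levelB (tg : List (List (List ℕ))) : List (List ℕ) → List ℕ → Bool
  | [], _ => true
  | _ :: _, [] => false
  | r :: rs, n :: ns => suppB r && (stepGo tg r triples n && levelB tg rs ns)

/-- Check all the systems obtained by adding the point `x` to a triple. -/
def incB (tg : List (List (List ℕ))) (L : List ℕ) (x : ℕ) (es : List ℕ) : Bool :=
  (List.range L.length).all fun j => Nat.testBit (L.getD j 0) x ||
    chk tg (L.set j (L.getD j 0 ||| 2 ^ x)) (es.getD j 0)

section real

variable {V : Type} (G : Multigraph V) (X Y : Finset V)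

/-- `y` is joined to the points of the mask `m`, labels being given by `q`. -/
def Hit (q : V → ℕ) (m : ℕ) (y : V) : Prop :=
  ∀ i, m.testBit i = true → ∃ x ∈ X, q x = i ∧ s(x, y) ∈ G.edges

/-- A realization of a system. -/
structure Real (q : V → ℕ) (L : List ℕ) (ys : List V) : Prop where
  inj : ∀ x ∈ X, ∀ x' ∈ X, q x = q x' → x = x'
  lt : ∀ x ∈ X, q x < 7
  nd : ys.Nodup
  sub : ∀ y ∈ ys, y ∈ Y
  hit : List.Forall₂ (Hit G X q) L ys

/-- No realization. -/
def Dead (L : List ℕ) : Prop := ∀ q ys, ¬ Real G X Y q L ys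

variable {G X Y}

theorem Hit.mono {q : V → ℕ} {m l : ℕ} {y : V} (h : Hit G X q l y)
    (hm : ∀ i, m.testBit i = true → l.testBit i = true) : Hit G X q m y :=
  fun i hi => h i (hm i hi)

theorem takeM_some {q : V → ℕ} {m : ℕ} {L L' : List ℕ} {ys : List V}
    (h : takeM m L = some L') (hf : List.Forall₂ (Hit G X q) L ys) :
    ∃ y ys', (y :: ys').Perm ys ∧ Hit G X q m y ∧ List.Forall₂ (Hit G X q) L' ys' := by
  induction hf generalizing L' with
  | nil => simp [takeM] at h
  | @cons l y L ys hl hf ih =>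
    rw [takeM] at h
    cases hb : Nat.beq (Nat.land m l) m with
    | true =>
      rw [hb, cond_true, Option.some.injEq] at h
      subst h
      refine ⟨y, ys, List.Perm.refl _, hl.mono ?_, hf⟩
      intro i hi
      have he : m &&& l = m := Nat.eq_of_beq_eq_true hb
      rw [← he, Nat.testBit_land, Bool.and_eq_true] at hi
      exact hi.2
    | false =>
      rw [hb, cond_false] at h
      cases ht : takeM m L with
      | none => simp [ht] at h
      | some L1 =>
        rw [ht] at h
        simp only [Option.some.injEq] at h
        subst h
        obtain ⟨y', ys', hp, hy', hf'⟩ := ih ht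
        exact ⟨y', y :: ys', (List.Perm.swap _ _ _).trans (hp.cons y), hy',
          List.Forall₂.cons hl hf'⟩

theorem dom_sound {q : V → ℕ} {c L : List ℕ} {ys : List V}
    (h : dom c L = true) (hf : List.Forall₂ (Hit G X q) L ys) :
    ∃ ys', List.Subperm ys' ys ∧ List.Forall₂ (Hit G X q) c ys' := by
  induction c generalizing L ys with
  | nil => exact ⟨[], List.nil_subperm, List.Forall₂.nil⟩
  | cons m c ih =>
    rw [dom] at h
    cases ht : takeM m L with
    | none => simp [ht] at h
    | some L' =>
      rw [ht] at h
      obtain ⟨y, ys', hp, hy, hf'⟩ := takeM_some ht hf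
      obtain ⟨ys'', hs, hf''⟩ := ih h hf'
      exact ⟨y :: ys'', ((List.subperm_cons y).2 hs).trans hp.subperm, List.Forall₂.cons hy hf''⟩

theorem digits_length (k n : ℕ) : (digits k n).length = k := by
  induction k generalizing n with
  | zero => rfl
  | succ k ih => simp [digits, ih]

theorem maskMap_inj {gs : List ℕ} (hlen : gs.length = 7) (h : mapMask gs 127 = 127) :
    ∃ g : ℕ → ℕ, (∀ i < 7, gs[i]? = some (g i)) ∧ (∀ i < 7, g i < 7) ∧
      ∀ i < 7, ∀ j < 7, g i = g j → i = j := by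
  have h127 : ∀ i, (127 : ℕ).testBit i = true ↔ i < 7 := by
    intro i
    have : (127 : ℕ) = 2 ^ 7 - 1 := by norm_num
    rw [this, Nat.testBit_two_pow_sub_one]
    simp
  have hsome : ∀ i < 7, gs[i]? = some (gs.getD i 0) := by
    intro i hi
    rw [List.getD_eq_getElem?_getD, List.getElem?_eq_getElem (by omega)]
    rfl
  have hsurj : ∀ k < 7, ∃ i < 7, gs.getD i 0 = k := by
    intro k hk
    have h1 : (mapMask gs 127).testBit k = true := by rw [h]; exact (h127 k).2 hk
    obtain ⟨i, hi, hik⟩ := mapMask_testBit h1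
    have hi7 := (h127 i).1 hi
    refine ⟨i, hi7, ?_⟩
    rw [hsome i hi7] at hik
    exact Option.some.inj hik
  -- pigeonhole
  have himg : (Finset.range 7) ⊆ (Finset.range 7).image (fun i => gs.getD i 0) := by
    intro k hk
    obtain ⟨i, hi, hik⟩ := hsurj k (Finset.mem_range.1 hk)
    exact Finset.mem_image.2 ⟨i, Finset.mem_range.2 hi, hik⟩
  have hcard : ((Finset.range 7).image (fun i => gs.getD i 0)).card = (Finset.range 7).card :=
    le_antisymm Finset.card_image_le (Finset.card_le_card himg)
  have heq := Finset.eq_of_subset_of_card_le himg hcard.le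
  have hinj := Finset.card_image_iff.1 hcard
  refine ⟨fun i => gs.getD i 0, hsome, ?_, ?_⟩
  · intro i hi
    have : gs.getD i 0 ∈ (Finset.range 7).image (fun i => gs.getD i 0) :=
      Finset.mem_image_of_mem _ (Finset.mem_range.2 hi)
    rw [← heq] at this
    exact Finset.mem_range.1 this
  · intro i hi j hj hij
    exact hinj (Finset.mem_coe.2 (Finset.mem_range.2 hi)) (Finset.mem_coe.2 (Finset.mem_range.2 hj)) hij

theorem chk_sound {tg : List (List (List ℕ))} {L : List ℕ} {e : ℕ}
    (h : chk tg L e = true) (htg : ∀ c ∈ tg.flatten, Dead G X Y c) : Dead G X Y L := by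
  intro q ys hR
  unfold chk at h
  split at h
  · simp at h
  · rename_i c hc
    have hdead := htg c (look_mem hc)
    simp only [Bool.and_eq_true, Nat.beq_eq] at h
    obtain ⟨g, hg1, hg2, hg3⟩ := maskMap_inj (digits_length 7 _) h.1
    have hf : List.Forall₂ (Hit G X (g ∘ q)) (L.map (mapMask (digits 7 (e / 512)))) ys := by
      rw [List.forall₂_map_left_iff]
      refine hR.hit.imp ?_
      intro m y hm k hk
      obtain ⟨i, hi, hik⟩ := mapMask_testBit hk
      obtain ⟨x, hx, hqx, hxy⟩ := hm i hi
      refine ⟨x, hx, ?_, hxy⟩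
      have hi7 : i < 7 := hqx ▸ hR.lt x hx
      rw [hg1 i hi7] at hik
      simpa [hqx] using hik
    obtain ⟨ys', hs, hf'⟩ := dom_sound h.2 hf
    refine hdead (g ∘ q) ys' ⟨?_, ?_, ?_, ?_, hf'⟩
    · intro x hx x' hx' hxx
      exact hR.inj x hx x' hx' (hg3 _ (hR.lt x hx) _ (hR.lt x' hx') hxx)
    · intro x hx
      exact hg2 _ (hR.lt x hx)
    · obtain ⟨l, hl, hls⟩ := hs
      exact hl.nodup_iff.1 (hls.nodup hR.nd)
    · intro y hy
      exact hR.sub y (hs.subset hy)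

theorem stepGo_sound {tg : List (List (List ℕ))} {r ts : List ℕ} {n : ℕ}
    (h : stepGo tg r ts n = true) (htg : ∀ c ∈ tg.flatten, Dead G X Y c) :
    ∀ t ∈ ts, Dead G X Y (t :: r) := by
  induction ts generalizing n with
  | nil => simp
  | cons t ts ih =>
    rw [stepGo, Bool.and_eq_true] at h
    intro t' ht'
    rcases List.mem_cons.1 ht' with rfl | ht'
    · exact chk_sound h.1 htg
    · exact ih h.2 t' ht'

/-- Every vertex of `Y` has three neighbours in `X`. -/
def Three (G : Multigraph V) (X Y : Finset V) : Prop :=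
  ∀ y ∈ Y, ∃ a ∈ X, ∃ b ∈ X, ∃ c ∈ X, a ≠ b ∧ a ≠ c ∧ b ≠ c ∧
    s(a, y) ∈ G.edges ∧ s(b, y) ∈ G.edges ∧ s(c, y) ∈ G.edges

theorem extend (h3 : Three G X Y) {q : V → ℕ} {r : List ℕ} {ys : List V}
    (hR : Real G X Y q r ys) (hlt : r.length < Y.card) :
    ∃ t ∈ triples, ∃ y, Real G X Y q (t :: r) (y :: ys) := by
  have hlen : r.length = ys.length := hR.hit.length_eq
  have hcard : ys.toFinset.card < Y.card := by
    rw [List.toFinset_card_of_nodup hR.nd]; omega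
  obtain ⟨y, hy, hyn⟩ := Finset.exists_mem_notMem_of_card_lt_card hcard
  rw [List.mem_toFinset] at hyn
  obtain ⟨a, ha, b, hb, c, hc, hab, hac, hbc, ea, eb, ec⟩ := h3 y hy
  refine ⟨_, triples_spec (q a) (hR.lt a ha) (q b) (hR.lt b hb) (q c) (hR.lt c hc)
    (fun h => hab (hR.inj a ha b hb h)) (fun h => hac (hR.inj a ha c hc h))
    (fun h => hbc (hR.inj b hb c hc h)), y, hR.inj, hR.lt, ?_, ?_, ?_⟩
  · exact List.nodup_cons.2 ⟨hyn, hR.nd⟩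
  · intro z hz
    rcases List.mem_cons.1 hz with rfl | hz
    · exact hy
    · exact hR.sub z hz
  · refine List.Forall₂.cons ?_ hR.hit
    intro i hi
    rw [Nat.testBit_lor, Nat.testBit_lor, Nat.testBit_two_pow, Nat.testBit_two_pow,
      Nat.testBit_two_pow] at hi
    simp only [Bool.or_eq_true, decide_eq_true_eq] at hi
    rcases hi with (rfl | rfl) | rfl
    · exact ⟨a, ha, rfl, ea⟩
    · exact ⟨b, hb, rfl, eb⟩
    · exact ⟨c, hc, rfl, ec⟩

theorem supp_le {q : V → ℕ} {r : List ℕ} {ys : List V} (hR : Real G X Y q r ys)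
    (h : suppB r = true) : r.length < X.card := by
  unfold suppB at h
  rw [Nat.blt_eq] at h
  refine lt_of_lt_of_le h ?_
  have hnd : ((List.range 7).filter fun i => r.any fun m => Nat.testBit m i).Nodup :=
    List.nodup_range.filter _
  rw [← List.toFinset_card_of_nodup hnd]
  refine le_trans (Finset.card_le_card ?_) (Finset.card_image_le (s := X) (f := q))
  intro i hi
  rw [List.mem_toFinset, List.mem_filter, List.any_eq_true] at hi
  obtain ⟨-, m, hm, hmi⟩ := hi
  obtain ⟨k, hk, rfl⟩ := List.getElem_of_mem hm
  have hlen : r.length = ys.length := hR.hit.length_eq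
  have hh : Hit G X q r[k] (ys[k]'(by omega)) := hR.hit.get hk (by omega)
  obtain ⟨x, hx, hqx, -⟩ := hh i hmi
  exact Finset.mem_image.2 ⟨x, hx, hqx⟩

theorem levelB_sound (h3 : Three G X Y) (hXY : X.card ≤ Y.card)
    {tg : List (List (List ℕ))} {rs : List (List ℕ)} {ns : List ℕ}
    (h : levelB tg rs ns = true) (htg : ∀ c ∈ tg.flatten, Dead G X Y c) :
    ∀ r ∈ rs, Dead G X Y r := by
  induction rs generalizing ns with
  | nil => simp
  | cons r rs ih =>
    cases ns with
    | nil => simp [levelB] at h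
    | cons n ns =>
      simp only [levelB, Bool.and_eq_true] at h
      intro r' hr'
      rcases List.mem_cons.1 hr' with rfl | hr'
      · intro q ys hR
        have hlt := supp_le hR h.1
        obtain ⟨t, ht, y, hR'⟩ := extend h3 hR (by omega)
        exact stepGo_sound h.2.1 htg t ht _ _ hR'
      · exact ih h.2.2 r' hr'

/-! ### The graph of a system -/

/-- Points of a mask. -/
def pts (m : ℕ) : List ℕ := (List.range 7).filter fun i => Nat.testBit m i

/-- The edges of the graph of a system. -/
def sysE : ℕ → List ℕ → List (ℕ × ℕ)
  | _, [] => []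
  | j, m :: L => (pts m).map (fun i => (i, j)) ++ sysE (j + 1) L

theorem mem_sysE {j : ℕ} {L : List ℕ} {e : ℕ × ℕ} (h : e ∈ sysE j L) :
    ∃ k, ∃ hk : k < L.length, e.2 = j + k ∧ (L[k]).testBit e.1 = true ∧ e.1 < 7 := by
  induction L generalizing j with
  | nil => simp [sysE] at h
  | cons m L ih =>
    rw [sysE, List.mem_append] at h
    rcases h with h | h
    · obtain ⟨i, hi, rfl⟩ := List.mem_map.1 h
      rw [pts, List.mem_filter, List.mem_range] at hi
      exact ⟨0, by simp, by simp, by simpa using hi.2, hi.1⟩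
    · obtain ⟨k, hk, h1, h2, h3⟩ := ih h
      exact ⟨k + 1, by simpa using hk, by omega, by simpa using h2, h3⟩

theorem embed (hdis : Disjoint X Y) {q : V → ℕ} {L : List ℕ} {ys : List V}
    (hR : Real G X Y q L ys) [Nonempty V] :
    ∃ (φ : ℕ → V) (θ : V → ℕ), (∀ x ∈ X, φ (q x) = x ∧ θ x = q x) ∧
      (∀ k (hk : k < ys.length), φ (10 + k) = ys[k] ∧ θ ys[k] = 10 + k) ∧
      ∀ e ∈ sysE 10 L, s(φ e.1, φ e.2) ∈ G.edges ∧ θ (φ e.1) = e.1 ∧ θ (φ e.2) = e.2 := by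
  let φ : ℕ → V := fun i => if i < 10 then (if h : ∃ x ∈ X, q x = i then h.choose else
    Classical.arbitrary V) else ys.getD (i - 10) (Classical.arbitrary V)
  let θ : V → ℕ := fun v => if v ∈ X then q v else 10 + ys.idxOf v
  have hφX : ∀ x ∈ X, φ (q x) = x := by
    intro x hx
    have h7 := hR.lt x hx
    have hex : ∃ x' ∈ X, q x' = q x := ⟨x, hx, rfl⟩
    have h1 : φ (q x) = hex.choose := by
      show (if q x < 10 then _ else _) = _
      rw [if_pos (by omega), dif_pos hex]
    rw [h1]
    exact hR.inj _ hex.choose_spec.1 _ hx hex.choose_spec.2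
  have hθX : ∀ x ∈ X, θ x = q x := fun x hx => if_pos hx
  have hφY : ∀ k (hk : k < ys.length), φ (10 + k) = ys[k] := by
    intro k hk
    show (if 10 + k < 10 then _ else _) = _
    rw [if_neg (by omega), Nat.add_sub_cancel_left, List.getD_eq_getElem _ _ hk]
  have hθY : ∀ k (hk : k < ys.length), θ ys[k] = 10 + k := by
    intro k hk
    have hY : ys[k] ∈ Y := hR.sub _ (List.getElem_mem hk)
    have hnX : ys[k] ∉ X := fun hx => (Finset.disjoint_left.1 hdis) hx hY
    show (if ys[k] ∈ X then _ else _) = _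
    rw [if_neg hnX, hR.nd.idxOf_getElem k hk]
  refine ⟨φ, θ, fun x hx => ⟨hφX x hx, hθX x hx⟩, fun k hk => ⟨hφY k hk, hθY k hk⟩, ?_⟩
  intro e he
  obtain ⟨k, hk, h1, h2, h3⟩ := mem_sysE he
  have hlen : L.length = ys.length := hR.hit.length_eq
  have hk' : k < ys.length := by omega
  have hh : Hit G X q L[k] ys[k] := hR.hit.get hk hk'
  obtain ⟨x, hx, hqx, hxy⟩ := hh _ h2
  rw [h1, hφY k hk', hθY k hk', ← hqx, hφX x hx, hθX x hx]
  exact ⟨hxy, rfl, rfl⟩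

theorem dead_of_cc (hred : G.Reduced) (hdis : Disjoint X Y) [Nonempty V] {L : List ℕ}
    {tr : List (List ℕ)} (h : cc (sysE 10 L) tr = true) : Dead G X Y L := by
  intro q ys hR
  obtain ⟨φ, θ, -, -, hE⟩ := embed hdis hR
  exact cc_sound hred h φ θ hE

/-- Check the catalogue. -/
def catB : List (List ℕ) → List (List (List ℕ)) → Bool
  | [], _ => true
  | _ :: _, [] => false
  | c :: cs, t :: ts => cc (sysE 10 c) t && catB cs ts

theorem catB_sound (hred : G.Reduced) (hdis : Disjoint X Y) [Nonempty V] {cs : List (List ℕ)}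
    {ts : List (List (List ℕ))} (h : catB cs ts = true) : ∀ c ∈ cs, Dead G X Y c := by
  induction cs generalizing ts with
  | nil => simp
  | cons c cs ih =>
    cases ts with
    | nil => simp [catB] at h
    | cons t ts =>
      rw [catB, Bool.and_eq_true] at h
      intro c' hc'
      rcases List.mem_cons.1 hc' with rfl | hc'
      · exact dead_of_cc hred hdis h.1
      · exact ih h.2 c' hc'

end real

end S6

namespace S6

open Multigraph

/-! ### A version of the checker which is fast in the kernel -/

/-- Packed powers of two. -/
def pkx (p : ℕ) : ℕ :=
  Nat.add (Nat.pow 2 (Nat.mod p 8)) (Nat.mul 256 (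
  Nat.add (Nat.pow 2 (Nat.mod (Nat.div p 8) 8)) (Nat.mul 256 (
  Nat.add (Nat.pow 2 (Nat.mod (Nat.div p 64) 8)) (Nat.mul 256 (
  Nat.add (Nat.pow 2 (Nat.mod (Nat.div p 512) 8)) (Nat.mul 256 (
  Nat.add (Nat.pow 2 (Nat.mod (Nat.div p 4096) 8)) (Nat.mul 256 (
  Nat.add (Nat.pow 2 (Nat.mod (Nat.div p 32768) 8)) (Nat.mul 256 (
  Nat.pow 2 (Nat.mod (Nat.div p 262144) 8)))))))))))))

/-- The union of all the images. -/
def vx (p : ℕ) : ℕ :=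
  Nat.lor (Nat.pow 2 (Nat.mod p 8)) (
  Nat.lor (Nat.pow 2 (Nat.mod (Nat.div p 8) 8)) (
  Nat.lor (Nat.pow 2 (Nat.mod (Nat.div p 64) 8)) (
  Nat.lor (Nat.pow 2 (Nat.mod (Nat.div p 512) 8)) (
  Nat.lor (Nat.pow 2 (Nat.mod (Nat.div p 4096) 8)) (
  Nat.lor (Nat.pow 2 (Nat.mod (Nat.div p 32768) 8)) (
  Nat.pow 2 (Nat.mod (Nat.div p 262144) 8)))))))

/-- Spread the bits of a mask into bytes. -/
def spr (m : ℕ) : ℕ := Nat.mul (Nat.land (Nat.mul m 4432676798593) 282578800148737) 255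

/-- Image of a mask. -/
def img (P m : ℕ) : ℕ := Nat.mod (Nat.land P (spr m)) 255

/-- Evaluate the argument first. -/
noncomputable def force {α : Type} (n : ℕ) (f : ℕ → α) : α :=
  Nat.rec (f 0) (fun k _ => f (Nat.succ k)) n

theorem force_eq {α : Type} (n : ℕ) (f : ℕ → α) : force n f = f n := by
  cases n <;> rfl

/-- All images. -/
noncomputable def imgs (P : ℕ) (L : List ℕ) : List ℕ :=
  List.rec [] (fun l _ ih => force (img P l) fun v => v :: ih) L

theorem imgs_eq (P : ℕ) (L : List ℕ) : imgs P L = L.map (img P) := by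
  induction L with
  | nil => rfl
  | cons l L ih =>
    show force (img P l) (fun v => v :: imgs P L) = _
    rw [force_eq, ih]; rfl

/-- Take a mask and continue. -/
noncomputable def tk (m : ℕ) (L : List ℕ) (k : List ℕ → Bool) : Bool :=
  List.rec (motive := fun _ => (List ℕ → Bool) → Bool) (fun _ => false)
    (fun l L' ih k => Bool.rec (ih fun R => k (l :: R)) (k L') (Nat.beq (Nat.land m l) m)) L k

theorem tk_eq (m : ℕ) (L : List ℕ) (k : List ℕ → Bool) :
    tk m L k = match takeM m L with
      | none => false
      | some L' => k L' := by
  induction L generalizing k with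
  | nil => rfl
  | cons l L ih =>
    show (Bool.rec (tk m L fun R => k (l :: R)) (k L) (Nat.beq (Nat.land m l) m) : Bool) = _
    rw [takeM]
    cases Nat.beq (Nat.land m l) m with
    | true => rfl
    | false =>
      rw [cond_false]
      show tk m L (fun R => k (l :: R)) = _
      rw [ih]
      cases takeM m L <;> rfl

/-- Fast domination. -/
noncomputable def domF (c : List ℕ) : List ℕ → Bool :=
  List.rec (motive := fun _ => List ℕ → Bool) (fun _ => true) (fun m _ ih L => tk m L ih) c

theorem domF_eq (c L : List ℕ) : domF c L = dom c L := by
  induction c generalizing L with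
  | nil => rfl
  | cons m c ih =>
    show tk m L (domF c) = _
    rw [tk_eq, dom]
    cases takeM m L with
    | none => rfl
    | some L' => exact ih L'

/-- Fast lookup. -/
noncomputable def nth {α : Type} (L : List α) : ℕ → Option α :=
  List.rec (motive := fun _ => ℕ → Option α) (fun _ => none)
    (fun l _ ih i => Nat.rec (some l) (fun k _ => ih k) i) L

theorem nth_eq {α : Type} (L : List α) (i : ℕ) : nth L i = L[i]? := by
  induction L generalizing i with
  | nil => rfl
  | cons l L ih =>
    cases i with
    | zero => rfl
    | succ i =>
      rw [List.getElem?_cons_succ]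
      exact ih i

/-- Fast certificate check. -/
noncomputable def chkF (tg : List (List (List ℕ))) (L : List ℕ) (e : ℕ) : Bool :=
  Option.rec false (fun l => Option.rec false (fun c =>
    force (Nat.div e 512) fun p =>
      Bool.rec false (force (pkx p) fun P => domF c (imgs P L)) (Nat.beq (vx p) 127))
      (nth l (Nat.mod e 16))) (nth tg (Nat.div (Nat.mod e 512) 16))

theorem vx_eq (p : ℕ) : vx p = mapMask (digits 7 p) 127 := by
  have h : mapMask (digits 7 p) 127 = 2 ^ (p % 8) ||| (2 ^ (p / 8 % 8) ||| (2 ^ (p / 8 / 8 % 8) |||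
    (2 ^ (p / 8 / 8 / 8 % 8) ||| (2 ^ (p / 8 / 8 / 8 / 8 % 8) |||
    (2 ^ (p / 8 / 8 / 8 / 8 / 8 % 8) ||| (2 ^ (p / 8 / 8 / 8 / 8 / 8 / 8 % 8) ||| 0)))))) := rfl
  rw [h]
  simp only [Nat.div_div_eq_div_mul, Nat.or_zero]
  rfl

/-- Packed powers of two, from a list. -/
def pk : List ℕ → ℕ
  | [] => 0
  | g :: gs => 2 ^ g + 256 * pk gs

theorem pkx_eq (p : ℕ) : pkx p = pk (digits 7 p) := by
  have h : pk (digits 7 p) = 2 ^ (p % 8) + 256 * (2 ^ (p / 8 % 8) + 256 * (2 ^ (p / 8 / 8 % 8) +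
    256 * (2 ^ (p / 8 / 8 / 8 % 8) + 256 * (2 ^ (p / 8 / 8 / 8 / 8 % 8) +
    256 * (2 ^ (p / 8 / 8 / 8 / 8 / 8 % 8) + 256 * (2 ^ (p / 8 / 8 / 8 / 8 / 8 / 8 % 8) +
      256 * 0)))))) := rfl
  rw [h]
  simp only [Nat.div_div_eq_div_mul, Nat.mul_zero, Nat.add_zero]
  rfl

/-- Recursive form of `spr`. -/
def sprR : ℕ → ℕ → ℕ
  | 0, _ => 0
  | k + 1, m => 255 * (m % 2) + 256 * sprR k (m / 2)

theorem spr_eqB : ((List.range 128).all fun m => Nat.beq (spr m) (sprR 7 m)) = true := by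
  decide +kernel

theorem spr_eq {m : ℕ} (h : m < 128) : spr m = sprR 7 m :=
  Nat.eq_of_beq_eq_true ((List.all_eq_true.1 spr_eqB) m (List.mem_range.2 h))

theorem or_addB : ((List.range 7).all fun g => (List.range 128).all fun n =>
    Nat.testBit n g || Nat.beq (2 ^ g ||| n) (2 ^ g + n)) = true := by
  decide +kernel

theorem or_add {g n : ℕ} (hg : g < 7) (hn : n < 128) (h : n.testBit g = false) :
    2 ^ g ||| n = 2 ^ g + n := by
  have := (List.all_eq_true.1 ((List.all_eq_true.1 or_addB) g (List.mem_range.2 hg))) n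
    (List.mem_range.2 hn)
  rw [h, Bool.false_or] at this
  exact Nat.eq_of_beq_eq_true this

theorem mapMask_lt {gs : List ℕ} (hlt : ∀ g ∈ gs, g < 7) (m : ℕ) : mapMask gs m < 128 := by
  refine Nat.lt_pow_two_of_testBit (n := 7) _ ?_
  intro i hi
  by_contra hc
  rw [Bool.not_eq_false] at hc
  obtain ⟨j, -, hj⟩ := mapMask_testBit hc
  have := hlt i (List.mem_of_getElem? hj)
  omega

theorem land_byte (x a b c : ℕ) (hx : x < 256) (hb : b < 2) :
    (x + 256 * a) &&& (255 * b + 256 * c) = x * b + 256 * (a &&& c) := by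
  have h1 : ((x + 256 * a) &&& (255 * b + 256 * c)) % 2 ^ 8 = x * b := by
    rw [Nat.and_mod_two_pow]
    have e1 : (x + 256 * a) % 2 ^ 8 = x := by omega
    have e2 : (255 * b + 256 * c) % 2 ^ 8 = 255 * b := by omega
    rw [e1, e2]
    have hb' : b = 0 ∨ b = 1 := by omega
    rcases hb' with rfl | rfl
    · simp
    · have := Nat.and_two_pow_sub_one_eq_mod x 8
      simp only [Nat.mul_one]
      rw [show 255 = 2 ^ 8 - 1 by norm_num, this]
      exact Nat.mod_eq_of_lt hx
  have h2 : ((x + 256 * a) &&& (255 * b + 256 * c)) / 2 ^ 8 = a &&& c := by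
    rw [Nat.and_div_two_pow]
    congr 1 <;> omega
  have := Nat.mod_add_div ((x + 256 * a) &&& (255 * b + 256 * c)) (2 ^ 8)
  rw [h1, h2] at this
  omega

theorem land_mod (gs : List ℕ) (hlt : ∀ g ∈ gs, g < 7) (hnd : gs.Nodup) (m : ℕ) :
    (pk gs &&& sprR gs.length m) % 255 = mapMask gs m % 255 := by
  induction gs generalizing m with
  | nil => simp [pk, mapMask]
  | cons g gs ih =>
    have hg : g < 7 := hlt g (by simp)
    have hlt' : ∀ g ∈ gs, g < 7 := fun x hx => hlt x (by simp [hx])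
    have hnd' := (List.nodup_cons.1 hnd)
    have h256 : 2 ^ g < 256 := by
      have : 2 ^ g < 2 ^ 8 := Nat.pow_lt_pow_right (by norm_num) (by omega)
      omega
    have hih := ih hlt' hnd'.2 (m / 2)
    rw [pk, List.length_cons, sprR, land_byte _ _ _ _ h256 (Nat.mod_lt _ (by norm_num)), mapMask]
    split
    · rename_i h0
      have h0' : m % 2 = 0 := h0
      rw [h0']
      omega
    · rename_i hm
      have hm' : m % 2 = 1 := by
        have := Nat.mod_lt m (show 0 < 2 by norm_num)
        have : m % 2 ≠ 0 := hm
        omega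
      rw [hm', or_add hg (mapMask_lt hlt' _)]
      · omega
      · by_contra hc
        rw [Bool.not_eq_false] at hc
        obtain ⟨j, -, hj⟩ := mapMask_testBit hc
        exact hnd'.1 (List.mem_of_getElem? hj)

theorem img_eq {p m : ℕ} (hv : mapMask (digits 7 p) 127 = 127) (hm : m < 128) :
    img (pkx p) m = mapMask (digits 7 p) m := by
  obtain ⟨g, h1, h2, h3⟩ := maskMap_inj (digits_length 7 p) hv
  have hlen := digits_length 7 p
  have hlt : ∀ x ∈ digits 7 p, x < 7 := by
    intro x hx
    obtain ⟨i, hi, rfl⟩ := List.getElem_of_mem hx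
    have := h1 i (by omega)
    rw [List.getElem?_eq_getElem hi] at this
    rw [Option.some.inj this]
    exact h2 i (by omega)
  have hnd : (digits 7 p).Nodup := by
    rw [List.nodup_iff_injective_get]
    intro i j hij
    have hi := h1 i (by omega)
    have hj := h1 j (by omega)
    rw [List.getElem?_eq_getElem (by omega)] at hi hj
    have : g i = g j := by
      rw [← Option.some.inj hi, ← Option.some.inj hj]
      exact hij
    exact Fin.ext (h3 i (by omega) j (by omega) this)
  have := land_mod (digits 7 p) hlt hnd m
  rw [hlen, ← spr_eq hm, ← pkx_eq] at this
  have hl := mapMask_lt hlt m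
  rw [Nat.mod_eq_of_lt (show mapMask (digits 7 p) m < 255 by omega)] at this
  exact this

theorem chkF_chk {tg : List (List (List ℕ))} {L : List ℕ} {e : ℕ} (hL : ∀ m ∈ L, m < 128)
    (h : chkF tg L e = true) : chk tg L e = true := by
  unfold chkF at h
  unfold chk look
  have hd : e % 512 % 16 = e % 16 := Nat.mod_mod_of_dvd e (by norm_num)
  rw [hd]
  change Option.rec false _ (nth tg (e % 512 / 16)) = true at h
  rw [nth_eq] at h
  cases h1 : tg[e % 512 / 16]? with
  | none => rw [h1] at h; simp at h
  | some l =>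
    rw [h1] at h
    change Option.rec false _ (nth l (e % 16)) = true at h
    rw [nth_eq] at h
    cases h2 : l[e % 16]? with
    | none => rw [h2] at h; simp at h
    | some c =>
      rw [h2] at h
      simp only [force_eq, vx_eq, imgs_eq, domF_eq] at h
      change Bool.rec false (dom c (L.map (img (pkx (e / 512)))))
        (Nat.beq (mapMask (digits 7 (e / 512)) 127) 127) = true at h
      simp only [h2]
      cases hb : Nat.beq (mapMask (digits 7 (e / 512)) 127) 127 with
      | false => rw [hb] at h; simp at h
      | true =>
        rw [hb] at h
        have : L.map (mapMask (digits 7 (e / 512))) = L.map (img (pkx (e / 512))) := by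
          refine List.map_congr_left ?_
          intro m hm
          exact (img_eq (Nat.eq_of_beq_eq_true hb) (hL m hm)).symm
        rw [this, Bool.true_and]
        exact h

/-- Fast version of `stepGo`. -/
noncomputable def stepF (tg : List (List (List ℕ))) (r : List ℕ) (ts : List ℕ) : ℕ → Bool :=
  List.rec (motive := fun _ => ℕ → Bool) (fun _ => true)
   (fun t _ ih n => Bool.rec false (force (Nat.div n 1073741824) ih)
     (force (Nat.mod n 1073741824) (chkF tg (t :: r)))) ts

theorem brec {a b : Bool} (h : Bool.rec false a b = true) : b = true ∧ a = true := by
  cases b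
  · simp at h
  · exact ⟨rfl, h⟩

theorem stepF_stepGo {tg : List (List (List ℕ))} {r ts : List ℕ} {n : ℕ}
    (hr : ∀ m ∈ r, m < 128) (hts : ∀ m ∈ ts, m < 128)
    (h : stepF tg r ts n = true) : stepGo tg r ts n = true := by
  induction ts generalizing n with
  | nil => rfl
  | cons t ts ih =>
    change Bool.rec false (force (n / 1073741824) (stepF tg r ts))
      (force (n % 1073741824) (chkF tg (t :: r))) = true at h
    obtain ⟨h1, h2⟩ := brec h
    rw [force_eq] at h1 h2
    rw [stepGo, Bool.and_eq_true]
    refine ⟨chkF_chk ?_ h1, ih (fun m hm => hts m (by simp [hm])) h2⟩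
    intro m hm
    rcases List.mem_cons.1 hm with rfl | hm
    · exact hts m (by simp)
    · exact hr m hm

/-- Union of the masks. -/
noncomputable def orA (r : List ℕ) : ℕ := List.rec 0 (fun m _ ih => Nat.lor m ih) r

/-- Number of the bits of a mask. -/
def popc (o : ℕ) : ℕ :=
  Nat.add (Nat.mod o 2) (Nat.add (Nat.mod (Nat.div o 2) 2) (Nat.add (Nat.mod (Nat.div o 4) 2)
  (Nat.add (Nat.mod (Nat.div o 8) 2) (Nat.add (Nat.mod (Nat.div o 16) 2)
  (Nat.add (Nat.mod (Nat.div o 32) 2) (Nat.mod (Nat.div o 64) 2))))))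

/-- Number of triples. -/
noncomputable def len (r : List ℕ) : ℕ := List.rec 0 (fun _ _ ih => Nat.succ ih) r

/-- Fast version of `levelB`. -/
noncomputable def levelF (tg : List (List (List ℕ))) (rs : List (List ℕ)) : List ℕ → Bool :=
  List.rec (motive := fun _ => List ℕ → Bool) (fun _ => true)
   (fun r _ ih ns => List.rec false (fun n ns' _ => Bool.rec false
     (Bool.rec false (ih ns') (stepF tg r triples n))
     (Nat.ble (Nat.succ (len r)) (popc (orA r)))) ns) rs

theorem len_eq (r : List ℕ) : len r = r.length := by
  induction r with
  | nil => rfl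
  | cons m r ih => exact congrArg Nat.succ ih

theorem orA_testBit {r : List ℕ} {i : ℕ} (h : (orA r).testBit i = true) :
    ∃ m ∈ r, m.testBit i = true := by
  induction r with
  | nil => simp [orA] at h
  | cons m r ih =>
    change (m ||| orA r).testBit i = true at h
    rw [Nat.testBit_lor, Bool.or_eq_true] at h
    rcases h with h | h
    · exact ⟨m, by simp, h⟩
    · obtain ⟨m', h1, h2⟩ := ih h
      exact ⟨m', by simp [h1], h2⟩

theorem popc_eq (o : ℕ) : popc o = ((Finset.range 7).filter fun i => o.testBit i = true).card := by
  have h : ∀ i, (if o.testBit i = true then 1 else 0) = o / 2 ^ i % 2 := by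
    intro i
    rw [Nat.testBit_eq_decide_div_mod_eq]
    have := Nat.mod_lt (o / 2 ^ i) (show 0 < 2 by norm_num)
    by_cases h : o / 2 ^ i % 2 = 1
    · simp [h]
    · have h0 : o / 2 ^ i % 2 = 0 := by omega
      simp [h0]
  rw [Finset.card_filter]
  simp only [h, Finset.sum_range_succ, Finset.sum_range_zero]
  change o % 2 + (o / 2 % 2 + (o / 4 % 2 + (o / 8 % 2 + (o / 16 % 2 + (o / 32 % 2 + o / 64 % 2))))) = _
  norm_num
  omega

theorem triples_ltB : (triples.all fun t => Nat.ble t 127) = true := by decide +kernel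

theorem triples_lt : ∀ t ∈ triples, t < 128 := by
  intro t ht
  have := Nat.le_of_ble_eq_true ((List.all_eq_true.1 triples_ltB) t ht)
  omega

variable {V : Type} {G : Multigraph V} {X Y : Finset V}

theorem Real.mem_hit {q : V → ℕ} {r : List ℕ} {ys : List V} (hR : Real G X Y q r ys) {m : ℕ}
    (hm : m ∈ r) : ∃ y ∈ ys, Hit G X q m y := by
  obtain ⟨k, hk, rfl⟩ := List.getElem_of_mem hm
  have hlen : r.length = ys.length := hR.hit.length_eq
  exact ⟨ys[k]'(by omega), List.getElem_mem _, hR.hit.get hk (by omega)⟩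

theorem Real.mask_lt {q : V → ℕ} {r : List ℕ} {ys : List V} (hR : Real G X Y q r ys) :
    ∀ m ∈ r, m < 128 := by
  intro m hm
  obtain ⟨y, -, hy⟩ := hR.mem_hit hm
  refine Nat.lt_pow_two_of_testBit (n := 7) _ ?_
  intro i hi
  by_contra hc
  rw [Bool.not_eq_false] at hc
  obtain ⟨x, hx, hq, -⟩ := hy i hc
  have := hR.lt x hx
  omega

theorem Real.popc_le {q : V → ℕ} {r : List ℕ} {ys : List V} (hR : Real G X Y q r ys) :
    popc (orA r) ≤ X.card := by
  rw [popc_eq]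
  refine le_trans (Finset.card_le_card ?_) (Finset.card_image_le (s := X) (f := q))
  intro i hi
  rw [Finset.mem_filter] at hi
  obtain ⟨m, hm, hmi⟩ := orA_testBit hi.2
  obtain ⟨y, -, hy⟩ := hR.mem_hit hm
  obtain ⟨x, hx, hqx, -⟩ := hy i hmi
  exact Finset.mem_image.2 ⟨x, hx, hqx⟩

theorem stepF_sound {tg : List (List (List ℕ))} {r : List ℕ} {n : ℕ}
    (h : stepF tg r triples n = true) (htg : ∀ c ∈ tg.flatten, Dead G X Y c)
    (h3 : Three G X Y) {q : V → ℕ} {ys : List V} (hR : Real G X Y q r ys) :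
    ¬ r.length < Y.card := by
  intro hlt
  obtain ⟨t, ht, y, hR'⟩ := extend h3 hR hlt
  exact stepGo_sound (stepF_stepGo hR.mask_lt triples_lt h) htg t ht _ _ hR'

theorem levelF_sound (h3 : Three G X Y) (hXY : X.card ≤ Y.card)
    {tg : List (List (List ℕ))} {rs : List (List ℕ)} {ns : List ℕ}
    (h : levelF tg rs ns = true) (htg : ∀ c ∈ tg.flatten, Dead G X Y c) :
    ∀ r ∈ rs, Dead G X Y r := by
  induction rs generalizing ns with
  | nil => simp
  | cons r rs ih =>
    cases ns with
    | nil => exact absurd (show false = true from h) (by simp)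
    | cons n ns =>
      obtain ⟨h1, h2⟩ := brec (show Bool.rec false (Bool.rec false (levelF tg rs ns)
        (stepF tg r triples n)) (Nat.ble (Nat.succ (len r)) (popc (orA r))) = true from h)
      obtain ⟨h2, h4⟩ := brec h2
      intro r' hr'
      rcases List.mem_cons.1 hr' with rfl | hr'
      · intro q ys hR
        have hb := Nat.le_of_ble_eq_true h1
        rw [len_eq] at hb
        have := hR.popc_le
        exact stepF_sound h2 htg h3 hR (by omega)
      · exact ih h4 r' hr'

end S6

namespace S6

/-! ### Data -/

/-- Systems whose graph is collapsible. -/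
def catC : List (List (List ℕ)) :=
  [
    [
      [7, 7, 3], [7, 11, 13, 3], [11, 13, 14, 6], [7, 11, 37, 44, 3], [7, 7, 25, 26, 9],
      [7, 11, 41, 38, 5], [7, 25, 26, 28, 6], [7, 11, 21, 28, 9], [7, 11, 21, 25, 3],
      [7, 11, 19, 28, 5], [7, 7, 25, 26, 12], [7, 11, 37, 42, 3], [7, 11, 21, 25, 6],
      [7, 11, 21, 26, 20], [11, 21, 26, 28, 6], [7, 11, 52, 56, 37, 17]],
    [
      [7, 25, 42, 52, 11, 33], [7, 25, 42, 52, 56, 6], [7, 25, 42, 52, 19, 33],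
      [7, 25, 42, 52, 19, 5], [7, 11, 21, 25, 18], [7, 11, 52, 56, 21, 3],
      [7, 11, 52, 56, 35, 17], [7, 7, 25, 74, 84, 9], [7, 25, 42, 52, 19, 10],
      [7, 7, 25, 42, 56, 20], [7, 11, 52, 56, 14, 17], [7, 7, 25, 74, 82, 9],
      [7, 11, 52, 56, 38, 17], [7, 11, 52, 56, 19, 5], [7, 7, 97, 42, 76, 9],
      [7, 11, 52, 56, 13, 17]],
    [
      [7, 11, 52, 56, 19, 12], [7, 7, 25, 41, 50, 20], [7, 25, 42, 52, 14, 33],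
      [7, 25, 42, 52, 19, 6], [7, 7, 25, 81, 74, 9], [7, 11, 21, 41, 52, 18],
      [7, 11, 21, 82, 88, 9], [7, 11, 21, 50, 56, 12], [11, 49, 50, 28, 44, 6],
      [7, 7, 25, 25, 10, 18], [7, 11, 21, 41, 50, 17], [7, 11, 19, 37, 56, 12],
      [7, 11, 19, 37, 56, 24], [7, 11, 97, 44, 100, 3], [7, 11, 13, 49, 50, 20],
      [7, 7, 25, 42, 56, 33]],
    [
      [7, 11, 52, 56, 19, 17], [7, 11, 52, 56, 19, 20], [7, 11, 19, 73, 84, 5],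
      [7, 11, 97, 42, 100, 5], [7, 11, 52, 56, 19, 36], [7, 21, 97, 50, 100, 3],
      [7, 7, 25, 25, 10, 20], [7, 11, 37, 97, 76, 3], [7, 21, 97, 50, 112, 3],
      [7, 11, 21, 41, 50, 18], [7, 11, 21, 41, 50, 20], [7, 7, 25, 82, 88, 9],
      [7, 11, 52, 56, 21, 6], [7, 25, 42, 52, 19, 34], [7, 11, 21, 41, 56, 6],
      [7, 11, 21, 41, 50, 12]],
    [
      [7, 11, 21, 41, 50, 36], [7, 11, 21, 50, 56, 33], [7, 11, 42, 76, 100, 5],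
      [7, 11, 52, 56, 21, 17], [7, 25, 42, 52, 19, 3], [7, 25, 42, 52, 11, 5],
      [7, 11, 37, 76, 104, 3], [7, 11, 21, 81, 74, 9], [7, 11, 97, 38, 104, 5],
      [7, 7, 25, 74, 88, 9], [7, 7, 25, 42, 56, 12], [7, 11, 52, 56, 21, 9],
      [7, 11, 19, 74, 84, 5], [7, 11, 19, 37, 56, 40], [7, 49, 81, 98, 100, 3],
      [7, 25, 42, 52, 35, 33]],
    [
      [7, 11, 52, 56, 13, 20], [7, 11, 52, 56, 21, 10], [7, 11, 37, 97, 104, 3],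
      [7, 11, 37, 98, 104, 3], [7, 11, 21, 41, 56, 18], [7, 11, 21, 41, 49, 6],
      [7, 11, 19, 37, 56, 36], [7, 11, 21, 50, 56, 36], [7, 11, 21, 41, 49, 3],
      [7, 11, 52, 56, 21, 5], [7, 25, 42, 52, 19, 36], [7, 11, 37, 97, 74, 3],
      [7, 11, 19, 37, 56, 33], [7, 11, 37, 76, 100, 3], [7, 11, 13, 49, 50, 17],
      [7, 11, 21, 41, 56, 17]],
    [
      [7, 11, 21, 41, 52, 40], [7, 21, 97, 50, 98, 3], [7, 21, 50, 82, 100, 3],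
      [7, 11, 21, 41, 49, 18], [7, 11, 52, 56, 21, 12], [7, 11, 19, 37, 56, 34],
      [7, 11, 21, 41, 50, 6], [7, 7, 25, 26, 56, 33, 36], [7, 11, 41, 70, 98, 5],
      [7, 11, 21, 76, 84, 9], [7, 11, 41, 76, 100, 5], [7, 21, 97, 50, 82, 3],
      [7, 11, 49, 50, 28, 12], [7, 7, 25, 42, 52, 24], [7, 11, 37, 73, 100, 3],
      [7, 11, 21, 41, 52, 48]],
    [
      [7, 21, 50, 98, 100, 3], [7, 7, 25, 41, 50, 24], [7, 11, 21, 41, 52, 12],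
      [7, 7, 25, 26, 56, 36, 40], [7, 11, 13, 49, 50, 18], [7, 21, 50, 100, 112, 3],
      [7, 7, 25, 25, 42, 100, 100], [7, 7, 25, 97, 26, 56, 88], [7, 11, 37, 73, 98, 3],
      [7, 11, 21, 41, 52, 24], [7, 7, 25, 25, 98, 100, 104], [7, 7, 25, 41, 52, 10, 48],
      [7, 7, 25, 41, 56, 18, 36], [7, 11, 52, 56, 67, 112, 19], [7, 7, 25, 25, 42, 74, 98],
      [7, 7, 25, 25, 42, 74, 100]],
    [
      [7, 7, 25, 26, 100, 56, 88], [7, 7, 25, 25, 42, 42], [7, 11, 21, 41, 50, 48],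
      [7, 7, 25, 25, 97, 98, 104], [7, 7, 25, 25, 42, 98, 104], [7, 7, 25, 25, 42, 36, 48],
      [7, 25, 26, 100, 104, 112, 6], [7, 25, 42, 84, 104, 112, 6], [11, 52, 56, 69, 88, 98, 6],
      [11, 52, 56, 67, 84, 104, 6], [11, 21, 42, 100, 88, 112, 6], [11, 21, 98, 100, 56, 88, 6],
      [7, 7, 25, 25, 97, 42, 74], [11, 52, 56, 81, 98, 76, 6], [11, 49, 76, 52, 88, 98, 6],
      [11, 13, 50, 84, 104, 112, 6]],
    [
      [7, 25, 42, 76, 112, 112, 6], [11, 52, 56, 67, 112, 76, 6], [11, 21, 42, 84, 104, 112, 6]]]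

/-- Reductions of the graphs in `catC` to a point. -/
def catT : List (List (List ℕ)) :=
  [
    [
      [0, 10, 1, 12], [0, 11], [2, 10, 0]],
    [
      [0, 10, 1, 13], [0, 11], [0, 3, 12], [2, 10, 0]],
    [
      [0, 10, 3, 11], [0, 10, 1, 12], [2, 10], [0, 13, 2]],
    [
      [0, 10, 1, 14], [0, 11], [0, 10, 2, 12], [0, 3, 13], [5, 10, 0]],
    [
      [0, 10, 2, 11], [1, 10], [0, 12, 3, 14], [1, 13, 0], [4, 12, 1]],
    [
      [0, 10, 1, 11], [0, 10, 2, 14], [0, 13], [0, 12, 5], [3, 10, 0]],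
    [
      [1, 10, 2, 14], [1, 12, 3, 13], [4, 12], [1, 11, 4], [0, 10, 1]],
    [
      [0, 10, 1, 11], [0, 10, 2, 12], [0, 10, 3, 14], [0, 13], [4, 10, 0]],
    [
      [0, 10, 1, 14], [0, 11], [0, 3, 13], [0, 12, 4], [2, 10, 0]],
    [
      [0, 10, 1, 11], [0, 12], [0, 10, 2, 14], [0, 4, 13], [3, 10, 0]],
    [
      [0, 10, 2, 11], [1, 10], [0, 12, 3, 14], [1, 13, 0], [4, 12, 1]],
    [
      [0, 10, 1, 14], [0, 11], [0, 3, 13], [0, 12, 5], [2, 10, 0]],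
    [
      [0, 10, 1, 11], [0, 10, 2, 14], [0, 12], [0, 4, 13], [3, 10, 0]],
    [
      [0, 10, 1, 11], [0, 10, 2, 12], [0, 10, 3, 13], [4, 10], [0, 14, 4]],
    [
      [1, 10, 3, 12], [0, 10, 4, 11], [0, 10, 1, 13], [2, 10], [0, 14, 2]],
    [
      [0, 10, 1, 11], [0, 10, 2, 14], [0, 12, 4, 15], [0, 10, 3, 13], [5, 10], [5, 12, 0]],
    [
      [0, 10, 1, 14], [0, 10, 3, 12], [0, 11], [0, 10, 5, 15], [0, 4, 13], [2, 10, 0]],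
    [
      [1, 10, 2, 15], [1, 12, 5, 13], [1, 12, 3, 14], [4, 12], [1, 11, 4], [0, 10, 1]],
    [
      [0, 10, 1, 14], [0, 11, 3, 12], [0, 10, 4, 11], [0, 10, 2, 13], [5, 10], [0, 15, 5]],
    [
      [0, 10, 1, 14], [0, 10, 2, 15], [0, 11, 3, 12], [0, 10, 4, 11], [0, 13], [5, 10, 0]],
    [
      [0, 10, 1, 11], [0, 10, 2, 12], [0, 10, 3, 13], [4, 10], [0, 14, 4]],
    [
      [0, 10, 1, 15], [0, 11], [0, 10, 2, 14], [0, 10, 4, 12], [0, 3, 13], [5, 10, 0]],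
    [
      [0, 10, 1, 14], [0, 11], [2, 10, 5, 12], [0, 10, 4, 15], [0, 3, 13], [0, 2, 10]],
    [
      [0, 10, 2, 11], [1, 10], [0, 12, 3, 15], [1, 13, 0], [1, 6, 14], [4, 12, 1]],
    [
      [0, 10, 1, 14], [0, 11, 3, 15], [0, 12], [0, 10, 4, 11], [0, 5, 13], [2, 10, 0]],
    [
      [0, 10, 2, 11], [1, 10], [0, 12, 4, 15], [0, 12, 3, 14], [1, 13, 0], [1, 5, 12]],
    [
      [0, 10, 1, 11], [0, 10, 2, 14], [3, 10], [0, 12, 4, 15], [3, 13, 0], [5, 12, 3]],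
    [
      [0, 10, 2, 11], [1, 10], [0, 12, 3, 15], [1, 13, 0], [1, 6, 14], [4, 12, 1]],
    [
      [0, 10, 1, 11], [0, 10, 2, 14], [0, 12, 4, 15], [0, 10, 3, 13], [5, 10], [5, 12, 0]],
    [
      [0, 10, 1, 11], [0, 14], [0, 10, 2, 15], [0, 12, 4], [0, 5, 13], [3, 10, 0]],
    [
      [0, 10, 1, 11], [2, 10], [0, 13, 3, 15], [2, 14, 0], [2, 12, 6], [2, 5, 13]],
    [
      [0, 10, 1, 11], [0, 10, 2, 14], [3, 10], [0, 12, 4, 15], [3, 13, 0], [5, 12, 3]],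
    [
      [0, 10, 1, 14], [0, 11], [2, 10, 4, 12], [2, 13, 3, 15], [0, 2, 10], [0, 5, 13]],
    [
      [0, 10, 2, 11], [1, 10], [0, 12, 3, 13], [0, 12, 4, 15], [1, 14, 0], [5, 12, 1]],
    [
      [1, 10, 2, 14], [0, 10, 3, 11], [0, 10, 1, 12], [0, 10, 4, 13], [5, 10], [0, 15, 5]],
    [
      [0, 10, 1, 14], [0, 10, 2, 15], [0, 11, 3, 12], [0, 10, 4, 11], [0, 13], [5, 10, 0]],
    [
      [0, 10, 2, 11], [1, 10], [0, 12, 3, 15], [1, 14, 0], [1, 13, 6], [4, 12, 1]],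
    [
      [0, 10, 1, 11], [0, 10, 2, 12], [0, 10, 3, 13], [0, 10, 4, 15], [0, 14], [5, 10, 0]],
    [
      [0, 10, 1, 11], [0, 10, 2, 12], [0, 10, 3, 15], [0, 10, 4, 13], [0, 14], [6, 10, 0]],
    [
      [0, 10, 1, 11], [0, 10, 2, 12], [0, 10, 3, 15], [0, 10, 4, 13], [0, 14], [5, 10, 0]],
    [
      [2, 13, 3, 14], [1, 10, 2, 15], [1, 12, 4, 13], [5, 12], [1, 11, 5], [0, 10, 1]],
    [
      [0, 10, 2, 11], [1, 10], [0, 12, 3, 13], [4, 12], [1, 14, 0], [1, 15, 4]],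
    [
      [0, 10, 1, 11], [0, 10, 2, 12], [0, 10, 3, 13], [0, 10, 4, 15], [0, 14], [5, 10, 0]],
    [
      [0, 10, 1, 11], [0, 12], [0, 10, 2, 13], [0, 10, 3, 15], [0, 4, 14], [5, 10, 0]],
    [
      [0, 10, 1, 11], [0, 12], [0, 10, 2, 13], [3, 14, 4, 15], [3, 10, 0], [3, 5, 14]],
    [
      [0, 10, 1, 15], [0, 11], [2, 13, 5, 14], [0, 10, 2, 12], [0, 3, 13], [6, 10, 0]],
    [
      [0, 10, 2, 12], [0, 10, 3, 11], [1, 10], [0, 13, 4, 15], [1, 14, 0], [5, 13, 1]],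
    [
      [0, 10, 2, 11], [1, 10], [3, 12, 4, 14], [0, 12, 5, 15], [1, 13, 0], [1, 3, 12]],
    [
      [0, 10, 1, 14], [0, 11], [0, 10, 4, 15], [0, 3, 13], [0, 12, 5], [2, 10, 0]],
    [
      [0, 10, 1, 11], [0, 14], [2, 12, 4, 15], [2, 10, 0], [2, 3, 13], [5, 12, 2]],
    [
      [0, 10, 1, 11], [0, 12], [0, 10, 2, 15], [0, 4, 14], [0, 13, 6], [3, 10, 0]],
    [
      [0, 10, 1, 11], [0, 10, 2, 15], [0, 10, 3, 13], [0, 10, 5, 12], [0, 14], [6, 10, 0]],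
    [
      [0, 10, 1, 11], [0, 14], [2, 12, 5, 15], [2, 10, 3, 13], [4, 10, 0], [4, 12, 2]],
    [
      [0, 10, 1, 15], [0, 10, 2, 11], [0, 10, 4, 13], [0, 10, 5, 12], [0, 14], [6, 10, 0]],
    [
      [0, 10, 1, 11], [2, 10], [0, 12, 3, 14], [0, 13], [4, 12, 0], [2, 15, 4]],
    [
      [0, 10, 1, 15], [0, 11], [0, 10, 2, 12], [0, 3, 14], [0, 13, 6], [5, 10, 0]],
    [
      [0, 10, 1, 15], [0, 10, 2, 11], [0, 10, 4, 13], [0, 10, 5, 12], [0, 14], [6, 10, 0]],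
    [
      [0, 10, 1, 11], [0, 10, 2, 12], [0, 10, 3, 13], [0, 10, 4, 15], [0, 14], [5, 10, 0]],
    [
      [0, 10, 1, 11], [0, 10, 2, 12], [0, 10, 3, 13], [0, 10, 4, 15], [0, 14], [5, 10, 0]],
    [
      [0, 10, 2, 11], [1, 10], [0, 12, 3, 15], [0, 12, 4, 14], [1, 13, 0], [1, 6, 12]],
    [
      [0, 10, 1, 11], [0, 10, 2, 15], [0, 14], [0, 12, 4], [0, 5, 13], [3, 10, 0]],
    [
      [0, 10, 1, 14], [0, 11, 3, 12], [0, 10, 4, 11], [0, 10, 2, 13], [5, 10], [0, 15, 5]],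
    [
      [0, 10, 1, 11], [0, 10, 2, 15], [0, 12], [0, 10, 3, 13], [0, 4, 14], [5, 10, 0]],
    [
      [0, 10, 1, 11], [0, 10, 2, 12], [0, 10, 3, 15], [0, 13], [0, 5, 14], [4, 10, 0]],
    [
      [0, 10, 1, 11], [0, 10, 2, 12], [0, 10, 3, 13], [0, 10, 4, 14], [5, 10], [0, 15, 5]],
    [
      [0, 10, 1, 11], [0, 10, 2, 12], [0, 10, 4, 13], [0, 10, 3, 14], [5, 10], [0, 15, 5]],
    [
      [0, 10, 1, 11], [0, 10, 2, 15], [0, 10, 3, 12], [0, 13], [0, 6, 14], [5, 10, 0]],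
    [
      [0, 10, 1, 11], [0, 10, 2, 14], [0, 10, 4, 15], [0, 12], [0, 5, 13], [3, 10, 0]],
    [
      [0, 10, 1, 15], [0, 14], [0, 11, 4], [0, 3, 12], [0, 5, 13], [2, 10, 0]],
    [
      [0, 10, 1, 14], [0, 10, 2, 15], [0, 10, 3, 11], [0, 12], [0, 5, 13], [4, 10, 0]],
    [
      [0, 10, 1, 15], [0, 11], [0, 10, 2, 12], [0, 3, 13], [0, 6, 14], [5, 10, 0]],
    [
      [0, 10, 1, 11], [0, 10, 2, 12], [0, 10, 3, 15], [0, 14], [0, 13, 6], [4, 10, 0]],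
    [
      [0, 10, 1, 11], [0, 10, 2, 15], [0, 13], [0, 12, 5], [0, 6, 14], [3, 10, 0]],
    [
      [0, 10, 2, 11], [1, 10], [0, 12, 3, 15], [1, 13, 0], [1, 6, 14], [4, 12, 1]],
    [
      [0, 10, 2, 11], [1, 10], [0, 12, 3, 15], [1, 13, 0], [1, 5, 14], [4, 12, 1]],
    [
      [0, 10, 1, 11], [0, 10, 2, 14], [0, 10, 3, 15], [0, 10, 4, 12], [0, 13], [5, 10, 0]],
    [
      [0, 10, 1, 11], [0, 12], [0, 10, 2, 15], [0, 4, 14], [0, 13, 6], [3, 10, 0]],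
    [
      [0, 10, 1, 12], [0, 11], [0, 10, 2, 13], [3, 14, 5, 15], [0, 3, 10], [0, 4, 14]],
    [
      [0, 10, 1, 15], [0, 11, 4, 12], [0, 11, 5, 13], [6, 11], [0, 14, 6], [2, 10, 0]],
    [
      [0, 10, 1, 14], [0, 11, 3, 12], [0, 10, 5, 15], [0, 11], [0, 4, 13], [2, 10, 0]],
    [
      [0, 10, 1, 11], [0, 10, 2, 14], [3, 10], [0, 12, 4, 15], [3, 13, 0], [5, 12, 3]],
    [
      [0, 10, 1, 11], [0, 10, 2, 14], [0, 10, 3, 15], [0, 10, 4, 12], [0, 13], [5, 10, 0]],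
    [
      [0, 10, 1, 15], [0, 11], [0, 10, 2, 12], [0, 10, 5, 13], [0, 3, 14], [6, 10, 0]],
    [
      [0, 10, 1, 15], [0, 11], [0, 10, 2, 12], [0, 10, 5, 13], [0, 3, 14], [6, 10, 0]],
    [
      [0, 10, 1, 11], [0, 10, 2, 12], [0, 10, 3, 13], [0, 10, 4, 15], [0, 14], [5, 10, 0]],
    [
      [0, 10, 1, 11], [0, 10, 2, 15], [0, 12], [0, 4, 14], [0, 13, 5], [3, 10, 0]],
    [
      [0, 10, 1, 11], [0, 12], [0, 10, 2, 13], [0, 10, 5, 15], [0, 4, 14], [3, 10, 0]],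
    [
      [0, 10, 1, 11], [0, 10, 2, 12], [0, 10, 4, 13], [0, 10, 3, 14], [5, 10], [0, 15, 5]],
    [
      [0, 10, 1, 15], [0, 11], [0, 3, 13], [0, 5, 14], [0, 12, 4], [2, 10, 0]],
    [
      [0, 10, 1, 11], [0, 10, 2, 15], [0, 14], [0, 12, 4], [0, 5, 13], [3, 10, 0]],
    [
      [0, 10, 1, 14], [0, 11, 3, 12], [0, 10, 4, 11], [0, 10, 2, 13], [5, 10], [0, 15, 5]],
    [
      [0, 10, 1, 15], [0, 11], [0, 3, 14], [0, 13, 6], [0, 12, 5], [2, 10, 0]],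
    [
      [0, 10, 1, 11], [0, 12], [0, 10, 2, 13], [0, 10, 5, 15], [0, 4, 14], [3, 10, 0]],
    [
      [0, 10, 1, 15], [0, 11], [0, 10, 2, 12], [0, 3, 13], [0, 6, 14], [5, 10, 0]],
    [
      [0, 10, 2, 12], [0, 10, 3, 11], [1, 10], [0, 13, 4, 15], [1, 14, 0], [5, 13, 1]],
    [
      [0, 10, 1, 11], [0, 10, 2, 12], [0, 10, 3, 13], [0, 10, 4, 15], [0, 14], [5, 10, 0]],
    [
      [0, 10, 1, 11], [0, 10, 2, 12], [0, 10, 3, 13], [0, 10, 4, 14], [5, 10], [0, 15, 5]],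
    [
      [0, 10, 1, 15], [0, 10, 2, 11], [0, 10, 4, 13], [0, 10, 5, 12], [0, 14], [6, 10, 0]],
    [
      [0, 10, 1, 15], [0, 10, 2, 11], [0, 10, 4, 12], [0, 13], [0, 6, 14], [5, 10, 0]],
    [
      [0, 10, 1, 11], [0, 10, 2, 12], [0, 10, 3, 13], [0, 10, 4, 15], [0, 14], [5, 10, 0]],
    [
      [0, 10, 1, 11], [0, 10, 2, 14], [0, 10, 3, 15], [0, 10, 4, 12], [0, 13], [5, 10, 0]],
    [
      [0, 10, 1, 11], [0, 12], [0, 10, 2, 13], [0, 10, 5, 15], [0, 4, 14], [3, 10, 0]],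
    [
      [0, 10, 1, 11], [0, 10, 2, 15], [0, 12], [0, 4, 14], [0, 13, 5], [3, 10, 0]],
    [
      [0, 10, 1, 11], [2, 10], [0, 12, 3, 13], [4, 12], [0, 14, 4], [0, 5, 15], [2, 16, 0]],
    [
      [0, 10, 1, 11], [0, 10, 2, 15], [0, 13], [0, 6, 14], [0, 12, 5], [3, 10, 0]],
    [
      [0, 10, 1, 11], [0, 10, 2, 12], [0, 10, 3, 15], [0, 13], [0, 6, 14], [4, 10, 0]],
    [
      [0, 10, 1, 11], [0, 10, 2, 15], [0, 10, 3, 12], [0, 13], [0, 6, 14], [5, 10, 0]],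
    [
      [0, 10, 1, 15], [0, 10, 2, 11], [0, 10, 4, 13], [0, 14], [0, 12, 6], [0, 5, 10]],
    [
      [2, 14, 3, 15], [0, 10, 2, 11], [1, 10], [0, 12, 4, 14], [1, 13, 0], [5, 12, 1]],
    [
      [0, 10, 1, 11], [2, 10], [0, 12, 3, 13], [0, 12, 4, 15], [2, 14, 0], [5, 12, 2]],
    [
      [0, 10, 1, 15], [0, 11], [0, 3, 13], [0, 10, 2, 12], [0, 6, 14], [5, 10, 0]],
    [
      [0, 10, 1, 11], [0, 10, 2, 12], [0, 10, 3, 13], [0, 10, 4, 14], [5, 10], [0, 15, 5]],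
    [
      [0, 10, 1, 15], [0, 10, 2, 11], [0, 10, 4, 12], [0, 10, 5, 13], [0, 14], [6, 10, 0]],
    [
      [0, 10, 2, 11], [1, 10], [0, 12, 3, 13], [0, 12, 4, 15], [1, 14, 0], [5, 12, 1]],
    [
      [0, 10, 1, 11], [0, 10, 2, 12], [0, 10, 3, 15], [0, 13], [0, 5, 14], [4, 10, 0]],
    [
      [0, 10, 1, 11], [2, 10], [0, 12, 3, 13], [4, 12], [0, 14, 4], [0, 5, 16], [2, 15, 0]],
    [
      [0, 10, 2, 12], [0, 10, 3, 11], [1, 10], [1, 14, 4, 15], [0, 13, 1], [0, 5, 14]],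
    [
      [0, 10, 1, 15], [0, 10, 2, 11], [0, 10, 4, 12], [0, 10, 5, 13], [0, 14], [6, 10, 0]],
    [
      [0, 10, 1, 11], [2, 10], [0, 12, 3, 14], [0, 13], [4, 12, 0], [2, 4, 5, 15], [2, 16],
      [4, 6, 2]],
    [
      [0, 10, 2, 11], [1, 10], [3, 12, 4, 15], [3, 14], [3, 16], [0, 1, 3, 12], [0, 13, 6],
      [0, 5, 1]],
    [
      [0, 10, 1, 15], [0, 11], [0, 3, 13], [0, 6, 14], [0, 12, 5], [2, 10, 0]],
    [
      [0, 10, 1, 11], [0, 10, 2, 12], [0, 10, 3, 13], [0, 10, 4, 15], [0, 14], [5, 10, 0]],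
    [
      [0, 10, 1, 11], [2, 10], [0, 12, 4, 13], [3, 12], [5, 14, 6, 15], [5, 16], [0, 14, 2],
      [3, 5, 0]],
    [
      [0, 10, 1, 11], [2, 10], [0, 12, 3, 15], [0, 13], [0, 2, 14, 5], [4, 12, 0], [4, 16, 2]],
    [
      [0, 10, 1, 11], [2, 10], [0, 12, 3, 13], [0, 12, 4, 15], [0, 14], [5, 12, 0], [2, 16, 5]],
    [
      [0, 10, 1, 11], [0, 14], [0, 16], [0, 4, 15, 6], [0, 4, 12, 5], [4, 13], [2, 10, 0],
      [2, 3, 4]],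
    [
      [0, 10, 2, 11], [1, 10], [0, 12, 4, 13], [3, 12], [0, 1, 14, 3], [1, 15], [1, 6, 16],
      [0, 5, 1]],
    [
      [0, 10, 2, 11], [1, 10], [0, 12, 4, 13], [3, 12], [0, 1, 14, 3], [1, 15], [0, 5, 16],
      [1, 6, 0]],
    [
      [0, 10, 2, 11], [1, 10], [3, 12, 4, 15], [3, 13], [3, 16], [0, 1, 3, 12], [0, 14, 6],
      [0, 5, 1]],
    [
      [0, 10, 2, 11], [1, 10], [0, 12, 4, 13], [3, 12], [0, 1, 14, 3], [1, 15], [0, 5, 1]],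
    [
      [0, 10, 1, 11], [0, 10, 2, 12], [0, 10, 3, 13], [0, 10, 4, 14], [5, 10], [0, 15, 5]],
    [
      [0, 10, 2, 11], [1, 10], [0, 12, 4, 13], [3, 12], [5, 14, 6, 15], [5, 16], [0, 14, 1],
      [3, 5, 0]],
    [
      [0, 10, 2, 11], [1, 10], [0, 12, 4, 13], [3, 12], [0, 1, 14, 3], [0, 1, 15, 5], [1, 16],
      [0, 6, 1]],
    [
      [0, 10, 1, 11], [2, 10], [0, 12, 3, 14], [0, 13], [4, 12, 0], [4, 5, 16], [2, 15, 4]],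
    [
      [1, 10, 2, 16], [3, 11, 4, 12], [0, 10, 1, 11], [3, 14, 5, 15], [6, 14], [3, 13, 6],
      [0, 3, 10]],
    [
      [1, 10, 2, 16], [3, 12, 5, 14], [1, 12, 6, 13], [1, 12, 3, 15], [4, 12], [1, 11, 4],
      [0, 10, 1]],
    [
      [3, 12, 4, 14], [3, 11, 5, 12], [1, 10, 3, 15], [0, 10, 6, 13], [0, 10, 1, 11], [2, 10],
      [0, 16, 2]],
    [
      [0, 10, 1, 13], [2, 11, 4, 14], [2, 11, 5, 12], [2, 11, 3, 15], [6, 11], [2, 10, 6],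
      [0, 16, 2]],
    [
      [1, 10, 3, 12], [4, 14, 6, 15], [1, 10, 5, 14], [0, 10, 4, 11], [0, 10, 1, 13], [2, 10],
      [0, 16, 2]],
    [
      [3, 14, 4, 15], [0, 10, 3, 11], [1, 10, 2, 16], [1, 12, 5, 13], [6, 12], [1, 14, 6],
      [0, 1, 10]],
    [
      [0, 10, 2, 11], [1, 10], [0, 12, 4, 13], [3, 12], [0, 1, 15, 3], [1, 16], [0, 14, 5],
      [0, 6, 1]],
    [
      [4, 11, 5, 12], [2, 11, 3, 15], [1, 10, 2, 16], [1, 11, 4, 14], [6, 11], [1, 13, 6],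
      [0, 10, 1]],
    [
      [3, 12, 6, 14], [1, 10, 3, 15], [0, 10, 5, 11], [0, 10, 4, 13], [0, 10, 1, 12], [2, 10],
      [0, 16, 2]],
    [
      [0, 10, 3, 11], [1, 10, 2, 16], [1, 12, 4, 13], [1, 12, 5, 15], [6, 12], [1, 14, 6],
      [0, 1, 10]],
    [
      [1, 10, 2, 16], [1, 12, 3, 13], [0, 10, 1, 11], [4, 14, 5, 15], [6, 14], [4, 12, 6],
      [4, 10, 0]],
    [
      [0, 10, 1, 13], [3, 10, 6, 15], [0, 10, 2, 16], [3, 12, 4, 14], [5, 12], [3, 11, 5],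
      [0, 3, 10]],
    [
      [1, 10, 3, 12], [1, 10, 5, 14], [1, 10, 6, 15], [0, 10, 4, 11], [0, 10, 1, 13], [2, 10],
      [0, 16, 2]]]

theorem catT_ok : catB catC.flatten catT = true := by decide +kernel

/-- Systems with 1 triple which are not excluded directly. -/
def lvl1 : List (List (List ℕ)) :=
  [
    [
      [7]]]

/-- Systems with 2 triples which are not excluded directly. -/
def lvl2 : List (List (List ℕ)) :=
  [
    [
      [7, 7], [7, 11], [7, 25], [7, 56]]]

/-- Systems with 3 triples which are not excluded directly. -/
def lvl3 : List (List (List ℕ)) :=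
  [
    [
      [7, 7, 25], [7, 7, 56], [7, 11, 19], [7, 11, 13], [7, 11, 21], [7, 11, 49], [7, 11, 28],
      [7, 11, 52], [7, 11, 112], [7, 25, 97], [7, 25, 42], [7, 25, 98]]]

/-- Systems with 4 triples which are not excluded directly. -/
def lvl4 : List (List (List ℕ)) :=
  [
    [
      [7, 7, 25, 25], [7, 11, 21, 25], [7, 7, 25, 41], [7, 7, 25, 97], [7, 7, 25, 26],
      [7, 7, 25, 42], [7, 7, 25, 98], [7, 7, 25, 56], [7, 7, 25, 104], [7, 7, 56, 56],
      [7, 11, 52, 56], [7, 25, 42, 52], [7, 7, 56, 88], [7, 11, 19, 35], [7, 11, 19, 37],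
      [7, 11, 19, 97]],
    [
      [7, 11, 19, 28], [7, 11, 19, 44], [7, 11, 19, 100], [7, 11, 13, 49], [7, 11, 13, 50],
      [7, 11, 13, 112], [7, 11, 21, 41], [7, 11, 21, 97], [7, 11, 21, 38], [7, 11, 21, 26],
      [7, 11, 21, 42], [7, 11, 21, 50], [7, 11, 21, 98], [7, 11, 21, 56], [7, 11, 21, 104],
      [7, 11, 49, 81]],
    [
      [7, 11, 49, 50], [7, 11, 49, 82], [7, 11, 49, 28], [7, 11, 49, 76], [7, 11, 49, 52],
      [7, 11, 49, 84], [7, 11, 49, 112], [7, 11, 28, 100], [7, 11, 28, 112], [7, 11, 52, 88],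
      [7, 11, 52, 112], [7, 25, 42, 84], [7, 25, 97, 42]]]

/-- Systems with 5 triples which are not excluded directly. -/
def lvl5 : List (List (List ℕ)) :=
  [
    [
      [7, 7, 25, 25, 97], [7, 11, 21, 25, 97], [7, 7, 25, 25, 42], [7, 7, 25, 25, 98],
      [7, 11, 21, 25, 98], [7, 7, 25, 41, 73], [7, 7, 25, 41, 49], [7, 11, 21, 41, 49],
      [7, 7, 25, 41, 81], [7, 7, 25, 41, 74], [7, 7, 25, 41, 50], [7, 7, 25, 41, 82],
      [7, 7, 25, 41, 56], [7, 7, 25, 41, 88], [7, 7, 25, 41, 112], [7, 7, 25, 97, 26]],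
    [
      [7, 7, 25, 97, 42], [7, 7, 25, 97, 56], [7, 7, 25, 26, 100], [7, 7, 25, 26, 56],
      [7, 7, 25, 26, 104], [7, 7, 25, 42, 76], [7, 7, 25, 42, 52], [7, 7, 25, 42, 84],
      [7, 7, 25, 42, 56], [7, 7, 25, 42, 88], [7, 7, 25, 42, 112], [7, 7, 25, 98, 56],
      [7, 7, 25, 56, 88], [7, 7, 25, 56, 104], [7, 7, 25, 104, 104], [7, 11, 52, 56, 81]],
    [
      [7, 11, 52, 56, 76], [7, 25, 42, 52, 97], [7, 7, 25, 104, 112], [7, 11, 52, 56, 19],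
      [7, 11, 52, 56, 67], [7, 11, 52, 56, 13], [7, 11, 52, 56, 21], [7, 25, 42, 52, 19],
      [7, 11, 52, 56, 69], [7, 25, 42, 52, 11], [7, 25, 42, 52, 67], [7, 7, 56, 88, 104],
      [7, 11, 19, 35, 67], [7, 11, 19, 35, 69], [7, 11, 19, 35, 28], [7, 11, 19, 35, 76]],
    [
      [7, 11, 19, 37, 69], [7, 11, 19, 37, 73], [7, 11, 19, 37, 97], [7, 11, 19, 37, 70],
      [7, 11, 19, 37, 74], [7, 11, 19, 37, 98], [7, 11, 19, 37, 76], [7, 11, 19, 37, 100],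
      [7, 11, 19, 37, 56], [7, 11, 19, 37, 88], [7, 11, 19, 37, 104], [7, 11, 19, 97, 98],
      [7, 11, 19, 97, 28], [7, 11, 19, 97, 44], [7, 11, 19, 97, 100], [7, 11, 19, 28, 100]],
    [
      [7, 11, 19, 44, 76], [7, 11, 19, 44, 84], [7, 11, 19, 44, 100], [7, 11, 19, 44, 112],
      [7, 11, 13, 49, 81], [7, 11, 13, 49, 50], [7, 11, 13, 49, 82], [7, 11, 13, 49, 112],
      [7, 11, 13, 50, 82], [7, 11, 13, 50, 84], [7, 11, 13, 50, 112], [7, 11, 21, 41, 81],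
      [7, 11, 21, 41, 70], [7, 11, 21, 41, 50], [7, 11, 21, 41, 82], [7, 11, 21, 41, 76]],
    [
      [7, 11, 21, 41, 52], [7, 11, 21, 41, 84], [7, 11, 21, 41, 100], [7, 11, 21, 41, 112],
      [7, 11, 21, 97, 38], [7, 11, 21, 97, 26], [7, 11, 21, 97, 42], [7, 11, 21, 97, 50],
      [7, 11, 21, 97, 98], [7, 11, 21, 97, 56], [7, 11, 21, 97, 104], [7, 11, 21, 38, 88],
      [7, 11, 21, 26, 100], [7, 11, 21, 26, 112], [7, 11, 21, 42, 76], [7, 11, 21, 42, 84]],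
    [
      [7, 11, 21, 50, 76], [7, 11, 21, 42, 100], [7, 11, 21, 42, 112], [7, 11, 21, 50, 82],
      [7, 11, 21, 50, 98], [7, 11, 21, 50, 100], [7, 11, 21, 50, 56], [7, 11, 21, 50, 88],
      [7, 11, 21, 50, 104], [7, 11, 21, 50, 112], [7, 11, 21, 98, 100], [7, 11, 21, 98, 56],
      [7, 11, 21, 98, 104], [7, 11, 21, 56, 88], [7, 11, 21, 56, 104], [7, 11, 21, 104, 112]],
    [
      [7, 11, 49, 81, 98], [7, 11, 49, 81, 44], [7, 11, 49, 50, 28], [7, 11, 49, 50, 76],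
      [7, 11, 49, 50, 84], [7, 11, 49, 82, 28], [7, 11, 49, 82, 44], [7, 11, 49, 82, 52],
      [7, 11, 49, 28, 100], [7, 11, 49, 28, 112], [7, 11, 49, 76, 52], [7, 11, 49, 76, 84],
      [7, 11, 49, 76, 112], [7, 11, 49, 84, 104], [7, 11, 28, 100, 112], [7, 25, 42, 84, 97]]]

/-- Systems with 6 triples which are not excluded directly. -/
def lvl6 : List (List (List ℕ)) :=
  [
    [
      [7, 7, 25, 25, 97, 97], [7, 11, 21, 25, 97, 97], [7, 11, 13, 49, 81, 97],
      [7, 11, 21, 41, 81, 97], [7, 7, 25, 25, 97, 42], [7, 7, 25, 25, 97, 98],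
      [7, 11, 21, 25, 97, 98], [7, 7, 25, 25, 42, 74], [7, 7, 25, 25, 42, 98],
      [7, 7, 25, 25, 42, 100], [7, 7, 25, 25, 98, 98], [7, 7, 25, 41, 82, 98],
      [7, 7, 25, 97, 26, 98], [7, 7, 25, 97, 42, 82], [7, 7, 25, 25, 98, 100],
      [7, 7, 25, 25, 98, 104]],
    [
      [7, 11, 21, 25, 98, 112], [7, 11, 21, 25, 98, 98], [7, 11, 21, 25, 98, 100],
      [7, 7, 25, 41, 73, 50], [7, 7, 25, 41, 73, 112], [7, 7, 25, 41, 49, 74],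
      [7, 7, 25, 41, 81, 98], [7, 7, 25, 41, 81, 104], [7, 7, 25, 41, 74, 50],
      [7, 7, 25, 41, 74, 52], [7, 7, 25, 41, 74, 56], [7, 7, 25, 41, 74, 112],
      [7, 7, 25, 41, 50, 112], [7, 7, 25, 41, 82, 100], [7, 7, 25, 41, 82, 56],
      [7, 7, 25, 41, 82, 104]],
    [
      [7, 7, 25, 41, 82, 112], [7, 7, 25, 41, 88, 112], [7, 7, 25, 41, 112, 112],
      [7, 7, 25, 97, 26, 100], [7, 7, 25, 97, 42, 84], [7, 7, 25, 97, 26, 56],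
      [7, 7, 25, 97, 26, 104], [7, 7, 25, 97, 42, 88], [7, 7, 25, 97, 56, 88],
      [7, 7, 25, 97, 56, 104], [7, 7, 25, 26, 100, 56], [7, 7, 25, 26, 100, 104],
      [7, 7, 25, 26, 56, 88], [7, 7, 25, 26, 56, 104], [7, 7, 25, 26, 104, 112],
      [7, 7, 25, 42, 76, 112]],
    [
      [7, 7, 25, 42, 84, 104], [7, 7, 25, 42, 56, 88], [7, 7, 25, 42, 56, 112],
      [7, 7, 25, 42, 88, 104], [7, 7, 25, 42, 88, 112], [7, 7, 25, 42, 112, 112],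
      [7, 7, 25, 98, 56, 104], [7, 11, 52, 56, 81, 98], [7, 11, 52, 56, 81, 76],
      [7, 25, 42, 52, 97, 82], [7, 11, 52, 56, 67, 112], [7, 11, 52, 56, 69, 88],
      [7, 11, 49, 76, 52, 88], [7, 7, 25, 98, 56, 88], [7, 11, 52, 56, 81, 67],
      [7, 11, 52, 56, 81, 69]],
    [
      [7, 11, 52, 56, 81, 97], [7, 11, 52, 56, 81, 70], [7, 11, 52, 56, 76, 67],
      [7, 11, 52, 56, 76, 69], [7, 25, 42, 52, 97, 67], [7, 25, 42, 52, 97, 70],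
      [7, 11, 52, 56, 19, 67], [7, 11, 52, 56, 19, 112], [7, 11, 52, 56, 67, 28],
      [7, 11, 52, 56, 67, 84], [7, 11, 52, 56, 69, 74], [7, 11, 52, 56, 69, 84],
      [7, 25, 42, 52, 67, 81], [7, 25, 42, 52, 11, 67], [7, 25, 42, 52, 67, 69],
      [7, 25, 42, 52, 67, 73]],
    [
      [7, 25, 42, 52, 67, 84], [7, 11, 19, 35, 67, 28], [7, 11, 19, 35, 69, 56],
      [7, 11, 19, 35, 69, 88], [7, 11, 19, 35, 28, 100], [7, 11, 19, 35, 76, 112],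
      [7, 11, 19, 37, 69, 56], [7, 11, 19, 37, 73, 112], [7, 11, 19, 37, 97, 88],
      [7, 11, 19, 37, 70, 56], [7, 11, 19, 37, 74, 112], [7, 11, 19, 37, 98, 88],
      [7, 11, 19, 37, 76, 112], [7, 11, 19, 37, 100, 88], [7, 11, 19, 37, 88, 104],
      [7, 11, 19, 97, 98, 28]],
    [
      [7, 11, 19, 97, 98, 44], [7, 11, 19, 97, 28, 100], [7, 11, 19, 97, 44, 76],
      [7, 11, 19, 97, 44, 84], [7, 11, 19, 97, 44, 112], [7, 11, 19, 44, 76, 100],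
      [7, 11, 19, 44, 76, 112], [7, 11, 19, 44, 84, 100], [7, 11, 19, 44, 84, 104],
      [7, 11, 13, 49, 81, 98], [7, 11, 13, 49, 81, 112], [7, 11, 13, 49, 82, 98],
      [7, 11, 13, 49, 82, 112], [7, 11, 13, 50, 82, 100], [7, 11, 13, 50, 82, 112],
      [7, 11, 21, 50, 98, 104]],
    [
      [7, 11, 49, 81, 98, 28], [7, 11, 13, 50, 84, 104], [7, 11, 13, 50, 84, 112],
      [7, 11, 21, 41, 81, 98], [7, 11, 21, 41, 81, 104], [7, 11, 21, 41, 70, 112],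
      [7, 11, 21, 41, 82, 98], [7, 11, 21, 41, 82, 100], [7, 11, 21, 41, 82, 104],
      [7, 11, 21, 41, 84, 100], [7, 11, 21, 97, 42, 82], [7, 11, 21, 41, 84, 112],
      [7, 11, 21, 41, 100, 112], [7, 11, 21, 97, 38, 88], [7, 11, 21, 97, 26, 98],
      [7, 11, 21, 97, 26, 100]],
    [
      [7, 11, 21, 97, 26, 104], [7, 11, 21, 97, 42, 84], [7, 11, 21, 97, 50, 76],
      [7, 11, 21, 97, 42, 88], [7, 11, 21, 97, 42, 112], [7, 11, 21, 97, 50, 104],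
      [7, 11, 21, 97, 98, 56], [7, 11, 21, 97, 56, 88], [7, 11, 21, 97, 56, 104],
      [7, 11, 21, 38, 88, 104], [7, 11, 21, 26, 100, 112], [7, 11, 21, 42, 76, 112],
      [7, 11, 21, 42, 84, 104], [7, 11, 21, 42, 100, 88], [7, 11, 21, 50, 76, 98],
      [7, 11, 21, 50, 76, 104]],
    [
      [7, 11, 21, 42, 100, 112], [7, 11, 21, 50, 82, 104], [7, 11, 21, 50, 98, 88],
      [7, 11, 21, 50, 100, 88], [7, 11, 21, 50, 88, 104], [7, 11, 21, 50, 104, 112],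
      [7, 11, 21, 98, 100, 56], [7, 11, 21, 98, 56, 88], [7, 11, 49, 81, 98, 44],
      [7, 11, 49, 81, 44, 100], [7, 11, 49, 50, 76, 84], [7, 11, 49, 50, 84, 104],
      [7, 11, 49, 82, 44, 84]]]

/-- Systems with 7 triples which are not excluded directly. -/
def lvl7 : List (List (List ℕ)) :=
  [
    [
      [7, 7, 25, 25, 97, 97, 42], [7, 25, 42, 52, 97, 82, 76], [7, 11, 19, 35, 67, 28, 100]]]

/-- Certificates for `lvl1`. -/
def crt1 : List ℕ :=
  [
    3224246446700416551198049115133995016454787618387693987468171164831089462464723203056229736301550186819101724836135949291938918144845186779577469054961005859133510570635532706926411919566194644777054963963917510219539667079298671861958749153534041986256361680185636423359918276044172213996772476560188595179178758304]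

theorem lvl1_ok : levelF (catC ++ lvl2) lvl1.flatten crt1 = true := by decide +kernel

/-- Certificates for `lvl2`. -/
def crt2 : List ℕ :=
  [
    8383223042768956924518906125581711657264819229555868223237165968941527219002801325334812494496958520138908421345342731500372089693553167485721958430655874592867906459048343230429263851728931356152274365892583479622061138611995269245711639116488232611084090488286315296034344709293993556161377494210181138151035965440,
    10094465912499672538899568015469420383052375376140448614926831101004527424516993804685358587739064526207951795939103336116881517072703356402849667529588790078488912412282633973686873545637727082997469715354824803457889968510739540788779752525893306921066578752930401241580334488643725062912302183750524806442217443328,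
    10021660813888914240452205583395845228759875997156193955103536229921464842070212802512441528365399408145738373632868911920885092940086203429757086905619926202750551579834208761565470528809816583195862768376578943994111095301231158510559962304062879386681167616568980255785277204682251116233036204964435812928596021408,
    3215830422632713261137517225245425685533272597816553876772773278704862044795718521519600429001373280762154700127059778673751990368809671796992590408161861233235515092803880584245350370985204818523492622687504816384206614420761259868485295710368487303068143477780151117614329847105612655490008421670844150326712144033]

theorem lvl2_ok : levelF (catC ++ lvl3) lvl2.flatten crt2 = true := by decide +kernel

/-- Certificates for `lvl3`. -/
def crt3 : List ℕ :=
  [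
    10073848531013078539225518813410038355868279164721259333952027687570525394959097089847562324895529915858731812033341401389599734452014361604905243142148157731986397114165955863125655456472371437762161330298501183650512951522814675875706247847993223574259760036886112564659466690494986349270835685602917046598587191296,
    8383223166360360061406588551237174541991228466138986272248580685561178112392494456871893622870854451266957732191558311588773228673519028725413269959925942404133838892378726082071674205921941237155180375014078034038433325349002697234382299568453548815714229465482708490793482314612288431137681896626274239685575118848,
    10050654087463251848689438326898503162870334002089460203694478529935727386442791196630532905752515573949426332319243482509232257274649011755441737210812647198967063647187439643049693764405283467779897506506935876836252125643448504192675847803249667674392535854553093364854043663866032788738804766345369031303985172480,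
    10094466058559539680801477639417497050912136006781403324648918050016474022001582708227409488756770516636003194871800145715843961356090295503611967639355048033607891573839964723765486912083256997869303755845091160030946290300247864366016424953700207040424626425926495801395338432632902112855329144293713667767426420736,
    10073526631586117485990218574270840881597259570115041567572932136711361016664382263094728574090251387852091126813367373178379951565898235035463279650501188170543398524104003455909923834788593984833170327158190329550667457144795864439403450142862358119756149848027347773110439353090928970401475367262480408726916108288,
    10094466250949638905982842483955404110520468165526168712291625449404345901546048940632647294977606701341481400548746201127001705711003523117982403701944435394501327350401442697789445119269012919706194332103424513208252017175282693578835948729502533565613430638916088186887133339598576683221674916879411663290791432192,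
    10094466273574414582788873335761903145136904435008550463817514062907838946598215427249374467266636208366726073539205721493873182691366422128151835555010627587564572425163757774746893495286131133103179769756040430466300714905160195653305350163797755041115345450283787666525713542526675361250420364463124633847650390016,
    10094466295894367498678877763643410165699064506412603193322586346423494392065982824336306452949961454656666114875129239432228732173050379002959641788668533127999487446362734885471539838033615379173343750899639521121785508049915585231463828536537134524493370907683174439388607179652790416011079734091814926238958292992,
    3224246546180695797556272380066197770195465507234134055569148278650514415325992060815122867130775437727070941231673303592783562300548773580463927089261407853950509160537745934471705470315898429023306534987783238019817050443321066233733808471375706211609581689751498255934552675877852793770422944149211220209763684352,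
    1592936686030566054066842745092042366709418669323491464503394886259998008061681783492890749440339507310407284850121485437750728951956116301253269035720249907284444937149284207654118074377337203026913300324434619322571977377163121602683072104781773145224601404142185492705474290412703796506574164522739164633849729187,
    9851205343682592176785211121797316026706799195212690191286235251875706738066880671809070007486947402790772866842018654938543064558958599567258191924641055048130239047072325890525888990195333221167123588209060418294934933559449629261976198100841039381813281916112800487079939303643835947269896056477937969844328403109,
    1572238788843305927832207245500884381859716356207291925836430597767956806589607565867538190972731412014201287640738516192475828828465704114843625575272804039408829646112766321215304664094766162503803157488072825850436658771262300646230393714321261638448094039831746804295331121089289818506840586753677504612037103782]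

theorem lvl3_ok : levelF (catC ++ lvl4) lvl3.flatten crt3 = true := by decide +kernel

/-- Certificates for `lvl4`. -/
def crt4 : List ℕ :=
  [
    10021660724004257417384921859697437735532135174919675324295823308334259112448348396714010993563835833242936285375576020981556397329334208784819036453261338706568645981462439584599846032340599502633350318543991333775553314044377463532796404623517019995609797223312483411515301870591169371414765361392197502262519336960,
    10023915761530112445766872687659962838683614583785262770373921790278036787893940644339287656143881892891688554682821365716623520111235477905648729996339976600208771274075460023963970524505725481466499403512158284277101899581540063453077351554117355676001764569459366219040591984173629886630669995586989727275450961920,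
    10094465981298068604782958861338370835425492729948944547929481047522275715791995047743867503151577893854445321262726215278136067248643239912159856840513726582179037387004760585507225851797393056199318616278775230924762957494592574949542543155778335325985272111515202384672295024118998120122060454260174738507166453760,
    6733832578955038675824659845427376908691302129107444642273933674148434585569352989397366049927398252164962328181853841328422289709556481206437435373500965584965767351208284681747275367594981263442328070114686360302179433602427234105772043005783273703651070213992688304171167399318413993003124495147032045578510733312,
    10073848665840063779466626914692397584401297271959247701893792482558497204813404002248903553138977650988499354911164880699483419408111801156922061977843535607405747536972123211704250139363813022896609056725713968567712607068138281191458219204268758191398351288084926348423117668479674907696968964861917149204558188544,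
    10094466116125016342222815443264496869081763441677455708285264731593095444411869306637782999125672796733126154434249632000849844882191807892834501279878301973913714211642785459047054212470333113397699472974331781319850917592402568391415297731249555437433761715061916351851059102754823322210146653636295193088714674176,
    6733792422984601290681331940703502730104471128876543777019382164553772319755165466802756124324566953936057989722519695346606375624029886977119337049692162265614828181501472069286322455678506441533331034105446574929234757071913723377627767790140342445822236073943841927319967873230992471538281723823924841201821093888,
    10073848766960302709647457990134132251972945144777646227973601369319717634499701897407569235910366189300636037128743173514404237626780522922060861979595832944701093400171355399116986618925305893692051693832432557999453028446399340154154543659434738700322891724953523778192365323487125677165090742683034064055505326080,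
    10094466199836637044911283337182038701624485852880945639394213801038616427980327345592420256180184664967852278552016030188085870602323467501869811704974330907166768023711763992147981048346178206090046709542464912703595875300344723864561570097354238389517774797844381643338922641444291141401241962881562759116618534912,
    9244520464162353945820910702495005545708116325656814056688253343981676886477940503998997487332452629715592798015970109499319329773814104947217571001403257244079290084123491943770419908786214354036094316438445860928930533469558368312501071199308185978894703773184564168479221625861277908279526679835432879467753443328,
    9246415277476177400927329455777025006932999441936969019732867912110756389918593795803115037094826602429269765892051812533882891737758985612515019669663407604299710801181675351210625708290007906604414052882987333802385334226347711127999056757743433577240785614558030253492872442287502452987600987294156637405038055424,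
    9246415345104186002693684519978777478552267708219234392633055105675514916908865117193285323468403737242820728132423040993964331613636791159352081712645111214161412037466851450924413501017645066189910570688589963458346149522446474762955419180262649621423829720979703808481945704001170763661276835431768850003301044406,
    8383223514663405261370917266953118168066241719450015658946210207266227328207160314568537805120478758876747978848727584028611904394771336527034351414364068658634810973975447465933498403681037409195625551914400642070195985338163052602867613271095227216107481024060248812500575727660243730045569914973380616428463132672,
    9676964345636208953338449737618119748561822436945006098217922112376526122060925552213099846507156277922245575170251375661370235240734238328137187006447332972700176455992505112633843115084360169898186597236398220749551391439792455822568080327681702210116872379905422175884631563491571201770925725027174840436096045056,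
    10073849092792183708041297235852791527808619905315290472027057381241320211799533491115155391378224398672735825787194822910122630015202292185371448411323839409068218364487499364474735191902300946850839002027420365684466932724023394195431350276432846548570664885036200601698803574627346393000867347313641819070419243008,
    10050654581828864396240168031600487000823845085937963843352471807247163281422143524092217162644589807701853077833875325427399333621434608824487102829159991037670778513744905970588123562774509512989646603022192699646973150112946675440500106264889954165250808338311900509220805285569568617096997352603283506477115707392,
    10050654593064446500713951569853585786562325826405903654436374109631158941296541405197753406743359005523158536881202493515587739523062059751726586925473019310929339507450128716370628945665795984905803232787213081589662908642568415649910651647934247592811039626226970036360977769491283644332243618613175464537726193664,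
    10094466576935131377158410335425718078581328361338753958251679473356721564265995490886321193227122803403191440966130300451652588779821920406115506353786131403521537295212926910686835442255750667638059544179909021084256994159765441498582244517098134324258768444505201033270628953025740085460234248002459962564479356928,
    8383223436014330541866451644939053607413882797487973217312058188897924867159400404240194652023250878486688714302203743463781256440532071663907702459322138644191832458923470909377704332947926882538940494189656385204331730774752765226428897860910755009904794700035448130142353567263351789514865313792588158942204203008,
    10094466621721148114953265610040746159268188379734625076403709340944748242661336221031864328056867813225296559404120393568169713979521625340570295551613898091040169552026468642210244447836567493151859067904180405891866325849721990556273803710463986808660178476824240883531343042995096717047343293576618692689930293248,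
    10094466655430594626706166787804303074170597956532563196558706041136023249113884670489679332106294491760021316417976703017728435404758011996820924333987868408085667922838526099456910337838078046014883214806881625183136507412406694757382085276229377387261795753919199175322053666982074992651124069600653894558468083712,
    3224246900865667712350542020239254327773234742881362589391307027469950443863261769827414267825078773941437199314379412373713650051609227780002923009732439085176849250590049429331337212115489903991914775021200248988466488643398963148918499335080844807019482919397513489357956105598359505374448959562485760435344445440,
    10094466756550833546279984788190173971330331125242681304119370895760181949550074245364782661646228469783817111928420321357808303294411809796485050003297219797468639952163317571229686286869758736986163887833754875619347482380292085598112788950982698593826288967283898249281874657329325877630390511018206836011112927232,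
    10073527305721043687195759080682637024261138320817546530742922969408773600727135436906116197124871113744885418190290857072608834347923258193649026777453093937963731803980734016891875360276452520585722717695681555744725976504900137379847621023683245735016027336225036177661020199213819694892708239392148917768581615616,
    9887608454641008213936113703869368784627589367934780291397961954046033998311466934953655324287446734941762272560561980960412471611428215497558070174665986467948587958859931611202151327385320957948201167437702610708458862253431626865121561777748761133385132618769625721003916010295699815325622727724929182777366876160,
    10094466869060228561546189122272316657456248340861041489265230118956339804976138803116609682992530250182718975430094286664387539535572309237367637984267290512244723250129552992181633310975839488836240620049417124108302746312924894430296221790695916758464053487412711720216844283894178986203376002238157082346797207552,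
    10094466925084527583316132226296484352389696507580573606658951906885797589882254293850801252995320593402713446175014732857632924154038265771858844671973603983945434504604087132804326378226562894831254051370183276508679303744646967594169032322715778123104347745165084547336946098968679424707891955813769242575773700096,
    10094467003889651483870918569448780513147249386084252732364220078821200882406254613312698457437646822111927546073899836838936822315408211216772150374614037273491171202018395866869661586014756807107261726170500437509495703011237801318214968015201771456748701397924362860294916944164630244505504714676131624322178289664,
    8382901335883007079102760307137534098817279250777003478856601619498786886606841613208175359161195527602491622329250135802672093999354151618873916833536297331982165910682947799689699931737243191910833387929628589726525914619409883677601322822438700293801571317616031750831129793949029991480985090559191472125434990592,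
    10073527530432685754264272582299868586152592672106010065570639209070841825629265805139061329920162064208224367068150354052748315704853560140278550463946069361685593462138774397835342850128023465702129383510928109294475319510754796420331084769115446875045633779944173530947096743863837011757456339561906110508955406336,
    10094467065019961436388625932457711679528343208470895226227415983621865586931233485879618120654893455467629407126390939356023197712166289747270189928240914435792099964934283915555327567165031651446250320452638935082113780435533914674178819667289363524709823715713689372619816063056021828946094346726520612472981622784,
    4920751807127091351754977406663343033730211438684601720157531171510797396845421410607346695880713109095844526047703244181513633574477587630322066410045960349129788027583162477401656523724252729128720068399827648161089530499455375671930584262115559104363690384397807666609155563214093656446327857497405374986913124352,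
    6240223967166031960411505520391381322742668899632249551002922386616162142067829929508069895492284398538300754523707480270497363378053146239355338792910917442720151272167791898701595837873851367157781381483872928251510116058683043800257770566715803353978138939092046278487121303987318914266393987875385564677475733504,
    3224247642351980869339378429073006878391487790947315374479140140295905014134163557704183763977173604184043741587495133529600182899044420662400193046727610333548448746122416901991524490872296405075014362457766999447069932951722821724503600124186652425593080571070920846938389854852499580028364735055335712011724853248,
    10094467183656564954416353038739828106971294276842238330940406865664476491727918772804556532989291372926970618118859393366070688829666884806881833556610564369545707074665919620559886747167931001347554156732124629891709754542272165794662230175579082840462880123428692715304217583820551016298390266782193004741646946304,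
    10094467217209699794377450543145645248338694374866425826168612306063132324095895597793640759642154639852125114330282637522633884654048076416066043152178983356814915915765601547933992295855044578869428450338669411693021891489658516075348736983149812062920636910310855592130811031672665485187286719434617329005001248768,
    6239579694228923076737188715088273472276129614883719927027043207445449301028518124691460901415508912134575528565433282263258646155637295733207200505819344107952283095362616815033426767276754113229339239437932137293764599491366825726390782114621108864179078058811075893429631273553259786771509608346933805265028190208,
    3223925508581116257517584822243936349028977122489175457566231956459895258474369370166122605880635289865174541137213985237616824074912601135967117133775212709638842815017117167935850346349612363783404225247188766378065732525139296232527324615937344943611580096263156500201404360025197385376130216810526021687073116160,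
    3224244615026616068688049035923911580218574401166652510325464907699360829244900507074752758246868791211865926166788998752324063742035463958185725889430578105906893466238113044281403926577657309440666871396705578617951408484915088054169077386142131173661247890876618451842543560415779690468625342714845750233523884032,
    10094467231978537703072747217681976311960463864810591736882706333973618881807069410225243430715666595415858373107023684723687632204762186322124663234936068138406510330260019220290746436658851872115996951398178604343772954101129664742248139052250397849220044535914413655526834004293237868438125471769570405991897174016,
    3217723324515076801977396109032145859817617086767298088243301775318652202960037966095672113243218853751557892794334921117840600792111752738044988199935196661130612118964701228577873031180759163483408293493314311717195195697521847660650110484244894994151540225061907974610994742977075436962311706540164031577458544640,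
    3217724190001161297839731710243255079728269749461182318294042750941817830653609665255021045075723935764171523088851800302474403155600145365549977790714493433108897560343992871203614012123036588248006267884857530351654304511729895355483153612706243597624429915569853667016660265338763935988789345684971618520905093120,
    3224244615025641006318552679552782120707313501655621345022918639314536222267936564540411651404256512043047833909713990563543908023375932528025265789439686067835033554173703245639802858380693989470051195603135300355435599267483968616621067381148680036843144008480400648733897032721990155005818136594298618535444549632,
    1898211834943095097593370817503833180919715671491622170314991422048438113174076041012427961721816006579416592571903343692909250588555531024451382742939099956050274919485485889382212958449185205385817357118600706057355627058671973861369756257575915352768848740161581705650030290545601076808343706453700758290545053879,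
    1592937597533547376022213645023719347996324429092826455715011606241161844725377113229660902094017211550843337835125384527390058061908142768072280985888672397128554439185924174377582161337993192224123812338121833533548449238004370582480950525926930344836711075265212017029335252307671020261119905894997956444298219696]

theorem lvl4_ok : levelF (catC ++ lvl5) lvl4.flatten crt4 = true := by decide +kernel

/-- Certificates for `lvl5`. -/
def crt5 : List ℕ :=
  [
    10021660746475421624091773190420536232668871101502972935687785026636149161478961065234380970290333486633841184730682541550561140974346182663593246654804158153203902709795163142693104300409092536683580452044880316853852150460376933138556020336489822719133773520366253577827870300844424185875823071759597305037633425408,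
    10023915784001276652473724018383061335820350510368560366021479561355373320324806301488441448172238919763958608624434809027783063282723877558143469968929259672942325053512497368524436318584330273454039635094398280408131209397514743181304443639243167347491629412594081282045569014321297235320733967230361326944896487424,
    10042278174442858955724090465185462587670539796431014848963030294680502528677533293146581873767675315718582802621505593706469027788752387118472416197237751866807317898414626686940720657163031596955978289492408376986574064261728515473263504452978491630249004590515890595207993602983828497132756605558224268575978098688,
    10073848609662153263775743751124930982204978083156048062807103287741852022628184184635451802736940727697488525269507627543409424496012832194079900307801770017696471896498106359031032477300338141880381730833530164613063533391732559275369461450195818358924763570776336445872622408441265804004590850187773844598991687680,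
    10094466003920444137482522735295924831772281674878952062944269477113297920863965298668154519853942347136122500945846222721969038493822026559909046002091624874463359844604075982955250255945306973881526784934539181226568450534483418407324262757430061678008686451745016990170798187748709118083906891774206221651125538816,
    10094466044161982030286683858170705767171707992871577404639916791555857800129286882296412593375840784384977816653489033923089127007883802429369806912818703557888115320990650536932605060224831702520767995476428798878840358285005295917814861774309999951993190456802859231430468006436515904075524668248064746767801716736,
    9450694317019017478734859583373651555638302598591051361068680325904369734659734319805259900647325786904684688992909669944454266886742190114664760316791448657083830046431339644615317853416105897000914826750579890708401202883977789224516382408485676148429281753387647430711499119857190058203612414552977487491834384384,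
    9461769039370802975555925448127328852593702370641509657029492154482393796740487669700579286914020141941001371361403151392789180344865089838125137084070899695332346876728883073662812077118544563778544627227242715705162895367829293208964970790079355277263966310932135901425474245710113716152522597704611756564523323392,
    8754336185939838647278258891946550080209381058384454281964269376321638639167771749688892516075060735971058501136946644103854489958274588046034843508158565747877379161250019133963624853630510201904741690494717659908378421012403907575776809398362925750853672064152779981317578561455463008052903185556941737106885906432,
    10094466127360634765951001184473835960402181531051653987314689820121266850840616155749810943141768649045415038077485448217468013183235594425980631164870333135837569550651576974143265081713790888672815609173032694637303532611293478570449646823342432491920078077941996828261451940845154417695425454462580193177371480064,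
    10094466138596217277398525679217315127165692742818740621086854187792926144749868835845344127133511690253661278753757528171059822081993342353035646712363592487847489077470601311696022956475818670017928571904544508443797290654244579111655040974531465693155915147944390778703438231767679957387128414495886843088212922368,
    10094466183692157939070843010011626388582348322701252083949186792836107508580295777944073662349326465798129651683928216698944856468494330755227094707856968455002102676660767491820506297677769133497606350024334561184025786353795205661966785973079444452299953712379686339427916705720804928313993592098007645325896781824,
    9459513080348927144702059306127901971930102377669684815409241955155771608786145894031747413737511242686681361425473019076582042265363131007335444000692237374873129801030506832349995269739356111780090589179973323376979025946731403238566773364688779367807617061745502001718606595996265488823441357814500063412973539328,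
    10094466191717162567987318999913495594902495440722793370400499166253472000654272845240381306746714353192452484159512565835192330250847130459103770972437496745206880276967271552273308798040199707116330181802474718686835812128220079705589925875032355849690697863498881465468360743131804710112777816427560753102257459200,
    10094466206009710671851472362962725184710875247698198063005140769260691157274356569471063486149162396073931465449805027185895784281362537507689532092962756794105695603658769867031821453190012271535981671613475265867230996135055984778595084509829109220105073776452044365306942398309127883818167501683595551099572785152,
    10073848868080541639828289066615936427200460888717286550974510265709302771970241147749816854585215840718862798644052040449995412841850736519883985626971783930170623028227847455054689155048742746573912484675219793635475392017309993398578751235275650161138690302881332821473095373344635023575588222920923816622998491136,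
    6754450209162952288906496428134523810954069914745125511445805899219469321599445884101399016872258871777850577109180044267501596768219755530619053540553896338137388120249528091439987126063677912728437010206743600438492634673742010484138573678037603265748995129800275248310473071998269051158057224507581370639152123904,
    10073848901787287949888566091416491369080600861018723114716281180255521010384771571185305697010869780658753350324203041619859897241941460578263906695602713414792109960566108754081956327547333279507846125731986785886382505039702764403189990542005763988340949895944755603316380761390421632765516121726382318212417916928,
    10073848924258452156595417442150252769909186758924963478095071937486133579351619698097201169983762113342486103480386756174118320059076877129548746165858542790514588577483712728339051067817974478159848288831010312162178389954744955287893044731156509022415589801906381407182387580846344142042161169901561331903043014656,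
    10073848946729616363302268791843944411467060191742920013316583417202437686574840187030267411127721257220373269465988037303836049911542239439899165533510858936492932089226299598872510834433242603870820790088280332607918988696283624459044258948257356622645688823159859432048278739326341050965472395365240049648496611328,
    10094466334641683062708642717622100562599435012333728675143057739821901046850208425896874988023673741923782701360874410793874663954104902240273155891946987427929390356769469153397795683118103390060321156905404382529345945440879906227986143537824665995039361201550869899298593613457907992095012620192808185129339785216,
    10094466350689398339711142075949937133173259519655741323446255431714446328342650348948949068666558495574482920248431844560771699013804865879382939329334680862017610085836417574261696821369912073325734259044549749675724900818003189057013297728148337976929373180849127441588048148182364139846554787803540075579953713152,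
    9887606859188349537749667838696866022801645328350404559177757421546390368061550377881053716397983688453816597884259095595795346237570083180854653868038874629970818307179273764988360293912840121024999470968872443042295842868315876445293560636933364065027319054590168237903646892975764157904159598606999294889962573824,
    8754014320219623910649502061914707364736518514563957186619866440836173958176922329299662266264093381978570201005946461741153151409897544430668368962890460832305710202565681281411973268580908682423821301235923976556662313531065033553283282189095942712400635813703959284691252050951677946027219447026898869489431810048,
    10094466385778986822705031645309180390799003110208413975572969765463222094287021569363981226165688925757363354931076209458724021984532148711259843674059707274337103702325790213388543687838130328923375675469228398601481452072949096826996987440835954557824506123145856092371749521558721895679497610578611879883605610496,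
    10094466408403800001002995840871423545978678951338254382621989775429522763904875481083061074936416247799180453959642361088078590581638467001095430406584005619023609683746196485299653615957296370524920610570864062286726844599219850034289799971562320205298690102532713826273031545153340612517176463959008885609981612032,
    3215830934428883137538942626880786131023479538936478160261086603979282066967863869572123271403300537035990069988357410091201896764285917825473792424967513745207309796874221889240030505922393202691279115621820245793352062941376346955956949018338925489867837347674461702665470126005648515930543300521872938932806422528,
    10073849047849855293483099945768225839869304413511521492486229695394057691489140798345930892084283343805630445974823044039070277388725354294831977277763455170776469895947536212092073789326379261080246895941787625402225508690750001474786907274540780693581581817837548569485328271322428257176528159505130368234374893568,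
    4906453955885548892838195918094306291043301219871712083149712039763017864424896027016161324561165091162468242705292761799581985761419248866704885762877718921591326614588019680092882344100847894857551506977656001360931980599712829981963863982443316003436158662475271460781031724933808395448517670795082276926852501504,
    597420913402692529038990308021562318961788036861739727560722682268135203396648821625370688337937941373608619778512464050943426391674267827413432465522181475721520100970654459767210289332886990449032109618362748727299514716372275355239378176438827113776393242407280734930006616945347658935128995365707830195097767936,
    1657323505392255122854855225467481714923159891189643074980843193844465440508627307206378998074452270576646369996536994995541748171604441183439883819250164699798778462264683856894695689599216349031239017629379469920192930323015650229475482001552770702346127576672597963300450198621759173349751526189932977291795435520,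
    9246415569754923551578669020397302140930910177477168115697287636216827248914722134713830575420212911070956880054507947717304302837969861202500733062980876536833050762467327505826004018635795286199291922933188405440866590913166881816592317102893299241316934312426266209496373872844020449619428988674910397182220505088,
    9246415614543640470138245953586805353373123375689879601322683540119595629983149526361724742287562132358994603598337646869407674893496712562602615903016540771549294263449139255811259537304184391200161225429366269461832402609054736756602484609904191128133466812401205904595778612086136337054826106055059773680058699776,
    9081436304529077911517248561166652810233635840066988752352165473792095624414192519042254563115866053482072205376627337244517000107087230771479121987404066821814948356625785053238818387072024395031946819392668612023176338330473040767034998773096080408481984085650417362665132488947128461926659859345469536457664565278,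
    1574853971717301802590961800743298997068518365265092354515331620772623085560508423053915712749599700710822943441021821835802137681773805782049037892719837534373303547909994073907928860922483812022621534965900598381208281139185334275626032561534427510235531426684854117044170664869141301809356462563860058486600437760,
    10094466621877457927988790195522981452341012092243008799089227339596208067382033932128165309375336925042336854094384055779643651089107345418626749008983300466428190106086215433463948434371191461779099939853899598080843420924719103031072248538796416421528505648681352640438934984772473097953247963719346876790403305472,
    3223562509238846993504172165682989939615619359677406481383556600329817335936076836271339534533733949154396468880787744309027939418241145028583404873932938515602743757597748972129757729389413954889976271397799337541048462582279585246004337719395164529365869098147425297323866228810425274909563150515450286117932044288,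
    9246415682746940484366823067376099920914155605367426808171375444131894929781241928966769699485501992646165981491629008002801034876609454220466800143609645562512872057865511802288372101945336444799672163084544476348509578674233211484113793746111794098468981154628857394360975269542261598112424002128116411502768754688,
    9246413311405321553267662217408365799594947583762144365000069326173911110921287414271350993489971334290735860893687388194516737555843606001491378251239735698025254535208305838226811876911327772698375455490548489139684795327684206584940984440961896197251511660429180551054442714093235769338555678748533972087822159872,
    10021337431345614395133455150596455637244836254172233239025194076559726836380692774141091642690845965841837833811370456130683527289549340599389405825990776917774327827120703180834965392511776708171631802710108886590193135181071253899437259276013895822839331228266795478491194807384126221014644344358620047722253455360,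
    9246415693984924211027854070649969359282291603259277279482220542872435487450095397409704380253956292491911101294340101393443439193366840094573941066898709089055031153985434812701196260675115822018768582603551724841811388006589933996686982910721939466711765403401244006845395968030135778527481993698782915757171609600,
    9463580350028348996273145666500960281822985105483588602264774746653615600352020345401052716406913608336240856089468095237029182865840572931414973058171810210681899869781173890018233014494875574973965453053923703557438235952953884606489378913738704703500176189084546492696731001907383960091770201749742562912792023040,
    3223562474956807816492449090955416041507142492668956291697286801239139980199062963875680545523195777131960896977174871703400527840644692042311262351102874094475822346835825388060712860961347828601588554901182443940017051769801857306610812468811709709041939516178848870401207237024576613797933087951864095762969071616,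
    4720897518424478266042294846315244329917733083272640876382401058331267492803657766837244981378996041919129352782037028954481936604667025544725031586868502083611424433303929867883230995561352485726292591273907154471031310305315035614825565599529375489011828943124216727493443290187690420880331892058903827449880842240,
    6664249630315350116969923591542215125781309029996150417114162480449162545958943913364944058662473530439947417765207852001302559517270201930066574983460438659039712826663196389655876881373049018063950749202752500163183743935089951151547022180733291677539321360414822371178939792500847513816706137484108161406265528320,
    9888292926302144459807623141789430556196634087527052325921812748911169501004155013834201512063662818236340611388017966408987075279734174604332676167380498170985161663890758203610221397723272110006590319051340328701019162995120804824467906398149348631988175309618633695706414816130403272564186262843711831859637587968,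
    10050654829011670671135890541686254366265905910440718471575725362641307541761045069818912530184474123432591899657256321554763011571599537950178528492258264367985404356485503872822553220800765117254837371192701705428910834814669304694711470873452386678760336098364217514969045115874669089685937701060250031852067033088,
    10094466777469081621715476130594911389590932353502160947035819824107680213100154212247670793255817373909975898309939173478559897317842652230554842219859486603612792265828666340142360132423467688359868635717372437606353291802590883179835760362764677298010567300133066142636427983320828253585069917714422418714101878784,
    6733511207600136457790354181460887519232239237961510618323338955855547484773575230665273894074783429867631024265434812616553023586314298285898646081649698852175528642654096396713067463442559939768352411875893170585431700147285501246436553761123335410788542624739305883758793907094669832539066615444136289680751398912,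
    10094466800417880228555153556415355189439932596596019922509678990304647152668434472425767886677955308347305519297868131675330405440877656157245502882522252296550481775412210360017741206986200577465167782042923309109530915081630187910486562744290053449373900631045560021060530657428590934121561263070574750048589778944,
    10073847564753017651975407048786826943431783008824780820603463505086970646766620673508801895892652110747860685812644920304676924064756303572791987741268438255131646691755209395128419799045904996573186146665347836898715295120673611808902922231238415138225950448210733427720283901086170344789200346737047607434439102464,
    8360029340767549055331238797349110707921792968649224337407069948198290153751359650625822886500878275987565818063333962738919803221583387226680845029781580532501113794067133530309707804271485053470952254413195833019289391844294952661078233143402245699742933715530333100557597834326217159024622135126455644012648665088,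
    10094466833646690588331203140177314925488457567945265484253626509758397979358588801684047009265041713879242793538816692168853895900761093200288096760219060692399624065805906154404222560360947135591749034007280196064518888568887882819553020069717041044462653712275999728108267234764858535295583062869000354130075389952,
    10073847575988599755328832743384318311004035371777641456382314392580725415414746362136264502521392530333934778471289903405986978404440738513605128106396431626828928828984166389723155106572052156239108031941983106582668792903559236918069734379320160780712815298840772447783897432878588944603644970855591094543941701632,
    10094466857827082245138830431408221897408863480041535770295957427886861336925898234128937813651285018095459431633355794312452806568935441806198571683786680060020498119082692047506449058709706744058583136721012316272396782112219601713044484689537916623130606397282108161036995405404787257356872084238754322453015367680,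
    8383221469787462456183808538633294952034573997304169393496976922506669456962382146000747875949221577041240060617936814085362025324253546815140895421818028639957741799341814800227737298071571428196447136646431716671037127390409555975712811231290245804358160097763475551440380942532021170432281408705047629364957351936,
    10073847508575107135208276733414988590272647859200525668482174486277223380654852590612826782330642848794606212033138024521146533811885373411649738977536737224526964345058223312630076939728200578457564578091941488377003407307602715852858596431015436590649013596762153142144389475637505724172566305570314444289986072576,
    10073849497273139423628261170527133464701002714720785522722228829487451432349917756707860830163149854790795182145345287189329999434726654463963185357175830752114474211316199825035549827679301418612124785657625762397726718446179984146626143033113482554991267421790105376426292281195340034975204883353544778733287444480,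
    8372915031879843550233649619028279484630418104956799478214388369098906671080114007522253348444394767961991592717360591687229320066080416760789485711810288728359104948147834033036064982110464106062270369858341672181280045158276964639345294610607851519017200185235945378261694874448834094659757666078123204058467340288,
    6617173316595867264607660148059235224809851312378321896235942763568316556143439034425462199122161998318927175443199004432714106309387900236301026519677786885299831720872824359143421250921933879387414167504690637587775785264903064617669498435858799520116121096456131259711585940877802891560645885069867049746579656704,
    10050654975074238014730424192146260237886836578321962780444856217945879992621257576733367871225448235965112674513096972295923613264322108929633236587275968258185188830891179387613707068697902198441354501046632907104500202421561791405065993159732639561362078394970395943785102260804829547772727152405561668625599631360,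
    10094466947709338548535891824121780281099364571610994820296530333405444524430273080716282146739785944185685156707765381526953467082461655542006649372515914374388031241989354950296819981047685803881612105712606156053309745924202712097108450720835006107839284129419892735414930518456900434517817841122406639198112911360,
    1574172005590374563332510898008537611016004997362006515273944785926517422238034415689472076842784101930764315910294808672668464894451074196216443621065953248728710968460742643556126092568462780353468483696661884837959647305270015847268814934734515931419055472543930132456046282305945367326302008383389186823868452864,
    8383223773081793643589579420205196478778854225944545496711833426003987288510762796332361706028057374664613404732604080746897519368264220021883239601500319380060862466020055561495873707502687115893709104556323572855429099231836708660512927104747118753979865203433890886767514002089395245449023970624207164487785844736,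
    10094466970180504993368164852778332514854236014906326521733693437503914599438344193405972792707673971583496866618174534356817853806395962415648483801354474207217060305861547028287397087849839010806118130149503961993230298641844677622573375110222035641989275544575819236749199774881706810065957399147834535737176166400,
    8754337096021989025470166628668964185438100007062729565849017921486780069359385490591659280677414546494978084907614411099365971580224018513518822028559923548528928127030579395248599630926629374579027934221221628493683899763009239055579018268437802226094544035563009844666477222636546195019030377562783403499582197760,
    8383223851730868356643863119263464183642548821458106106965133546494168210902094348687931115700863955919048901797057241700962578997031130668879127955435601549977567867409927397327222992355803901746038517852704483731460933369795284334559633074026459106632030041380344528468199891855181877103276269469929456492694278144,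
    3224247103044040735007011324608881103816229266696468853696720256747162372089464927767446807891563432728686322940030296960077304758512058607547635964756513541576895055195968892929352758923731453446142500278864846349462095445441361677874442071745177740238597394987935346748631100942551732850333199633298190222840631296,
    10094467015120133205104891188363839569858113720401369936543671931331795735518595028648672804611334831967293777162060869015918691836213470754179351745925053135625031941114936789957050708037314702998178089398568614634922126864288969703236668844150820034678073567869096665468987175423387015020506642251100859750744395776,
    6240224382882566990613271269095552762464978102921972536477700824694566382767416636643117739272728081419451110670141868045176536403226474450767229001437895488838145299155863756489422962030896995710681324359468460259014934346500533055815386483834260129303588995354002436727827261430729563466502008480745725184178982912,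
    10094467035993077730226877682643317440088505052771973224297725790139121074397569366281825957225178658324882299630808409292446489863499189397691958615364003905871920607749853473677773123878670160541812759699780559285633479389261371429084465133994005209743239086457222086673069325295264768467908086215868622653786755072,
    3224244621425006478042080862003602810819314354238911805891957998350620285638912703789619509581770155204232511935065390005887098341234870284035042362440813555173623318099815261150333766839314502945752807873905005434059957480632380622730436398059249617071958801120446041327331167201545245032160054517586497950530211840,
    10094467060065161820213173789321951728312886979338585133110298816544315042852164401546555922894162725143130503569778650597160155416978384009607310930305592861423142510762985771715998456504122779133669952913616800709674170326143014243424424716583426193622953807166751183083939180463809979088533993922094680484264873984,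
    10094467105009890412907217653757741333479906839557734547699537476193071969918697167261583947991123392479554279640151222331343721965549878405497590047253468112214420764787534120180343144130880563511665377114766220801324742668780924575073821275556143020565817376371118461488109206321865839560046284039556746090289893376,
    3224244621427706742518412527668228046347746422888315560081170381278419097718745846747615972147848129268855187527962521669266972160596107169888507280894607227555554170247775924402322060591551066172215300204125980351728061300734720425798950787384438651682297393648178722650359289866201329987965882257441752794755043328,
    8754015084239206938682447988672037703096576367683889719805686080316091169200364028534608853257939379951153417588769870257737322731649110140056984010069224541978605488537855685965978877511530739250116428814098380237303846971361048228758088552537192825555011625735267752061022984688748582145595517436320819739387301888,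
    10094467134549548204490504622922337195661905035557832412814167630241959358907512897113872997923552062688851891004911625353883479849567888578336467770691743809761243299268378247605411471830509840310409840812422599645231472447532577178579509936292519298546483008593856841634379970113269317894439316769610741613826215936,
    10094465486930055134866295923877626429171022854571308467646211191882549578704755614577221311439766061011377992532020449106317593439655565840297919727574472906786808765235258021915477996877863178037951656097082252714260365646711639591150897250023322991566299389279008113520706644836685648635262191840114217987804565504,
    8205076665709830832385448880703991341456008523864638155344171617851577131029803406323833071464009670119994534277232219122936042484350229121647709159046058818702798731231924282493098020547571906526057146414311326239516236556610555646014034241719705563173052289583748389379442811848157307876223978092313546140402126848,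
    8350687112937962642894576613938366306751040144995081351458250985879023922002246458593591533158252644510573220435808279129751183630930404433856055739904977772393099297438166701302698718588624506451846640192069345233640671796266998263252420442384329284866819164799155014057838523111793306263189275605974708754834067456,
    10094465273610007420948047330367750426808582889868482458523431117518520023803505620479061597406439591854584362925771563336152325645024106262028240041438413070299904563765044530548899536476423792389870668751264088721612744874281804222117345327130131908302527567652520472583083107564471387008627322749372758975167926272,
    10094467201853234390956605246547298051080397902838208871008377634583543878533060961256887973032522346403983480033343972600456464805502824868636520764698767522124586222259592263244306956781159213175763789374536636391539896595471254741485864810073967095760126014684270518630744571437102704277250058493720834601156153344,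
    10094467215827194350868385264910854632460997032227923854588299177723161379541721626449292941309274388065205250738851428519704569971836575434167488996918791768392493243832685405225787014182349836409154400264787163884372988567622077830010708129250131940280636255543429018335019512491661513297593547735899836332934762496,
    3221025526037855166123364373885063953215728145535112946129399443568251021039580334268261643660006624190333308163229216357610341375477002189146118862237221403328486948425846526968538875041662501283443759744035950944946396911871768881581097456781214065103224979359180069330695279421261664021397529181299718074145771520,
    10073525305787429291430485664255680977261411103065879613661225916336191610074785863690193770205744496836433962642854910016029050933874576108884515689519741999228834064323144274812300099639882311276684767961372988339186234284657194769850872960773201804322400291297709862343514929667966043558701501003342982689088933888,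
    8369935238200588885360546568481116521537936239016529411793669880258253531400488658469710205402308504916816023327861763510282526282107049244303676999579360435125238685550577976551123906313796212604017526278685167455012689942315181881036559010961969404414103672261578304702518033739057422276102512351611522566115364864,
    10094467302371550945022310424980884172248222022820798749663208561648732845589716471144662340099284539655332581229004639174361629034583903081771260195909798319195853502534815196243532932611971764329936304236283602312715971478187676189955478150735407030259606744155643523937894755602981470880185806268559978350175391744,
    10094464655652994370501523556650262100693445177156001960492033507590010124931303293459550600280567004096800040770675564963305710461714269280696119992850313319266076483867037149181253713955427038508912402449173480418688887076441787471164731563987679517524182065157497873251101627903066594459237562786725936914334814208,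
    1598330961182047012096954397150166938150839164257060647501040420628640552234747948127591029542311084521176577500586045511496875444734113402808079479059886224424910989198682830346251898400154628663734459409297991152369042894850806394888955784162619861252209040695129983810714703103884561814520713121885690520975249408,
    10073527822557820441453340135078312346966732907732962150763114385479074947779715667904519428089848834622035414938847842755466706519319251999237070197470008339833119960180971891627213520787352542245238005790179418002181641233099640294708616494559598884215765504397844646630035813347571832322210938824537247098847694848,
    1592615258538816137627161608724287462375666182356000141807762908498855508629655231859078415897911927889841865158499260758434035333647493632079136448566845197158128798024413658892239050065838685336851443931381928035290320795238653093933476667013890727607245584340639468276382649509943871408168390229172057837975441408,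
    10073527833793402540814899737506645218586918012459164596298553447362787227312047454055261676803899819065910961811637504791505004449295111775755079263007885236815085831371133868192579250900386766187379924337024434030476852041107378304404630491541214016567816287164901277459784693698352584928094302379121005990471602176,
    10094467373127745496040531741021844567976976024236896980013955380407934273961707373637117513489439915854326280889081152840911476989373658562738308180913476993723719287932391483490168733721510209967727344994545918891419795600584088075308782159391284404730082137085246357815169159927341998459166561876034123758650068992,
    3223924733323514308551870624126142246359815553854460712009160842156366083203445391216080067897484905742902584672526131912865776441220770945986174735573519705427921093082351749373017792801805850739649135383909632208891270158644133211994614195913094971027977460947856717396985850616716588446510419971104291645706539008,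
    10094467381020626620570518814467393961037467889780818923916286559420919614983368156641890832438131166546696111024656139266898977679914483981874547342912832027288064321195597263452414392071314077931746033148198639611919120115122995234969103072335947977374671148665815027646149595489546749951585128393726420106338963456,
    8754015353893177419182825967714674512583083954807618444435985379192136754125472698730703785046558672776480595635347064202578197433772243459096387702913227017509561919673729898464414180403981095306149286352437568183204939815411898453198428573299989864586433866748988848814908075401516609323612404072922576352365580288,
    8754015387599923729224940407696282267784830490038226846147716605107531364591034550239746840731633305662904616655546170645123131610164574143046841719374656276672303309750685491233253241216372507048105476203547288922511690839322199437518080167630977138491308900164027380561829807354982744886641508068583734094341148672,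
    10094467440538798770313762563384231853753743594666171580926070057428289100968008475924117171417340270630238443701829955505791258384866568735067697187498300736266147652371465853041119324661216080698376193251267597553516229634406402157915694144000966262854204701248074691824245939940505697606410591876463695867027460096,
    3223924877672016005699189436467538690501438266334322130741242384296103919200501813186608716208317240370824377701522809970897306451691931027715189789367373274051120510794447181611220346163286234306596830535045071678951980029040963286808842193764290557866538013163328728975171322630230201117870412759369432854092910592,
    4920629703619764611937660165608430032243478689812261713359656178293030759612514589729450211972508961434503359581995588741406332346852395749578164991440669486089544343013470904172886382434627910870907478360355230961883031750657126107705390018522791096620540798345428128497163261022849860452823865064672583417114464256,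
    1598331312608365456790018949901614054914739528081464379912584494388845493916333750595611916784715460099576504475603638315858687141143495259398066717174016040383279721852560091691682128298848785837271462614009830222135148677489883298750742037576208400878478144607472114838255760989488801528297922664212878927485276160,
    10094465339487349086071121557885118156961877836982699036990366831577853124417645126034713492305107966929878780326906762841680962127186479683851842438635277030517242781807301246035007299981968791374821123504515705329144823887334248168354003138265951420476866629098574778661543219224502232398398617517795894422217232384,
    6231725334181262715535235962716629823262686017185618301918624339707378838480084287663417530463086782365203004454952781552902452553713264310976408307906512137843268126089750080464996000035344186310113681731408136090012668790887912574410065677189861755474793403762238910441873406489106250188441079297701552156207550464,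
    3218690918297531850697242827664183281572920808608239433096432339668578219948283998573766634227792193357602931456173504866934804920567328270801142213513790136158718932760217852618303063523794957430774518705603553880762611650633465498625932821836510236536398386027615395284810816781516461981869433043310723428013379584,
    10094467491950442091681900949813326238623868702121057993929884692036306075016752469136354374765481764637687717292282248695112803940692742337367525848283577373307959992694855091971288680965413053193275464692018740992878728984259135778342695220977604565905765929209360336190710089392199188627662543670578826512001994752,
    3224244621583718756001476676853915207661328176477624177630743136803502386096435342520562221990032989799600517639014492151333899076794396324775401715514574925745686438717639641043610064740206801434796849776634416236997639208465684915060453428636697899886433075195573977450260067790076001825981198898846756036449996800,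
    1597968575220102022483400050324962941955587739761045921190942200606546431097139890044596103505241992796516696773872893234524984780679152211385425135801805205795906221532510422461726431581784705217768851055123475965478317338954676003249960254920298200266017527090549389299577867174183331217408424058271160267271114752,
    1574816165319787275103609281078872243270920459122949117207116912131819571189097106676900745239521062519810432785199064601345947797313803598080556049861682115215823179425751772366419996033822026747001408179335839837641287014129492692314934508812277572990995163817933617936797481726640435363258492320395856497626386432,
    1598333023794723398164143205809822834109865933874301696233575376988780593566903110666279660845388581444212161586659360976570630159040113982896035710765041105670645936496456352810169296946865797527501508344408540760705284729321223288569406472038369685893703616802095644820459889546832442919275280360575145143807315968,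
    4906134809176203161192183478137766265549770781803781592453907147739875514693868101336785834515159294696815710993157931341006817495137247878978304812157857874001655085741972290251898992074114631293299749201310307752117812271603410000549869509981197342863228790212875252571954573929992600541743604456340986499819180032,
    4576578893327045030711246136525376192792504966832650643598586790688201640970971844667607817861159481115164905844771660854680978413609813054189725210734161140060746443356732271225154579275045685481079732961488987416127470426077057663781372672683147629089697112007370370820068450052167526055770897803603153868792074240,
    1574853971717301799157480453367624536317904978617667725172738356585918460051438507494393546704761531454049482834110767228807638863780143934111575912422695438502447906028260324987662790449690202405507489602321489482768671317529592875622679144120163196245043144158609093982111531002698514487549081807576139007641063424,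
    3294915556570187711069235772153393838052120683110600514026955661124416859240914255411027856899169152253113863624689338433678864807642175440460017642195264841992004039577186880016350199943100492819571287737809989359405371180236952662768027768015990253299781415543890540519031556701266944213796027684212708843065249792,
    4920752227640087476087900785349234281217616083789328029388080924184988537109518938987293769570360602152421584335724067831748819698939115113627649065650105875338513160016490701294457693374072388689738798140473905403087050014382617246210913417838759235722314123875965292932907272834048963247900089438648171419533119488,
    6240224348777240873288113089633143071504392104645851717129659349852640235875779648361529388394174553710785914221717811772202463150689616016085478104816401800040896102416701829880302391185858730890484907876656789010708257274620841878682042341861078071313738218086667806747798687723675604653511758161517764104042647552,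
    6240224394118151887841681174452185201540616558143434906707350565508598023857810740837388307794569891985043245432607666172559245880996834248587670645224646934083484363295149544725073021004637173209579022763577007451704095409153797938446862075732841103570742823221622539103744642091063609572496305631428009682291986432,
    3224245115949330905425567831012741471953395134144672613295520187213773312641750020701982645951915947631166225232529776743239926551777147543104410161279412521942981919755616578332470556505183627562962069774718364161360071665772000045922411394678961076128244953872697424165265136084670990036925202814944975412077072384,
    3224247932935562917540585361711934191725342570055459970967920817304870026794104477776393679699833117169962818726676304913335470403146910379502921982453906273297542521318417648299379131572571841383738553677952284817205317144559364875331926620115108624114145529264727455716784894587306536434644012469778869245623209984,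
    3224248114246429169471981360124499131661032566297232069356981505184275157014972700431258035118178021234602411107889831148935690817397761303988153700219425219709748292232671480614061723705952399120694225484603051384619599760643875143906734012313513127852661186177261613486510182102661945675536476005573187003392790528,
    3223923335117423662552992916154903057210373621854800543461050401462859329356539300055955639102385682051014476994767130172644432690794786565255813547505269755111869898414019565169672411002738920747255116456363039681473555229290838993764828936796829147615613986729345539239029564760216849616003312112481848989051588608,
    3056087543986120720954754333423880854365516109316879326350237943893640963190597188325507016812545048538476536460336321549987384138654716723403959077423364405006534177913017887000000642895362774108799280331229595621429486429324454547766343918280127602106036722872339023859163698595504559140015848880914585189295656960,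
    3224244615026316442921490662508467483174097614994768942707375397126628475917136588149735902080273533171779635910822301086012081387971226537222784639279042019258948002122472448738376420383039412956430995691184663456721154033215535066877118966580407796813373733069834556088819402321526281158120333802838194084981313536,
    6239217708436192372383216520519291044182300765308502113503168651898489500504550783482689737000588003388754446972469536580442365789474453713207058025109103549412018367763236077710180346221039112575960068939588318738309918107797041364091783917449971113200410356631077180177483482338216013486272662931222318399330521088,
    601894088415159414306890596737428791121813093971129030234885871171977087078109697573388242600268676636210371506683236632321486632911372895189529809801302559645134548461973973571970832498702074420376059716747889862183864234441070876889588107562467442978538221508275135940252517935588516681508163662006550679641722880,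
    3224244612431047547570486898664852169768190429941580610110999888836432261512903221590394341228298370708430726869003664272596218031784217136820722981145919548348550406146322465540188707226491226039099588022148903373912372456420345027725072676463542557983023277854431012739899568780861315135020759685024664608138137600,
    3221026485954428040216098049322207609545289889794043958122082138509364139296669198023726590145147879524938397907530419531499488743608544843288443620518340033018556494126606434975528826039414922849419160887839755292311485028596585373313990691847652901049797940188699925244672615694264759850074301229817779391600332800,
    1574853971716666617658265571203294819247715264529564003238281425055810931904681205673028077981970926666734115895079271357148110248872627511519271959547242297250430365274214848494879487048993526928624640851126027694998568209265332223844419217157325492792798712761007405503942082710545685887151437440760239492715843584,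
    416700091981311594292237950988337780377268240975172448659719513254289304496452159522812280526658394313981354688982511739490185363430431677725307444190083038408610551936130144405877297899227951167854049549094638382676698267065934765199537005119866236587347850435217755535573487491930497601531636351747906724298559684]

theorem lvl5_ok : levelF (catC ++ lvl6) lvl5.flatten crt5 = true := by decide +kernel

/-- Certificates for `lvl6`. -/
def crt6 : List ℕ :=
  [
    1665739584005747025654175615443149340829055785486126146714854985592641502239976417205618102820010451502067991430205755083227909760848001584715327428801963819822799762907518915122885558143278820809357384996436802931894550435707774503219847142428621880576629818582908568242424886336784407172388927650127874544089501696,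
    1665739584005747025677157833572613634799041198785647583995535744532752968327807659965881925113957128034472226324825282682798106608832180470532710792642990945943429128630829590277949178969804085086420460428574053953310402111285164922875650313096037438557965960739823487616713712597948115373628078078302776612801548288,
    4732253186303567957685806979933468453412006085489281377020611309437075488421944438754662154869654748956603004870332247366407270161566624136130779483856626672158174738139937424523964557631492445549788121141562888976910511919122466089280593408025978322844647602823202233861318478947910327158583943667478125205863075840,
    4732253185365435383579741220600378615196440436103226437994619883172526479899495788833763299126668418708497099176212471331924694732017480459719150393877561496702287884390605683450470261308360010733398849228525235148755874071952352519096981439543625844403215545116463134208283411633967269286637643852496964725408337920,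
    6629455200948268437304322733276381488844934404128660837135631332051145498783168260188808999461449685504925533399840649362328848366700172157556573500491538849221322271748239842493312126456455553934058764435602268867180449049007782853940866590755155204829410367364594229975192153541821409332336379406689524227532197888,
    10073848115296540716225014475216764042684037848815056562340463043220300804402078548503388967657570802007076513383165533505126670997403282464741495133379757397064352945318684956822993520860796193871961615764038844301817154502446871213539200556474195615015075930463303694147370486399871824332391463774154028473811537920,
    1574814258674432544797847766322552874314858852187630629180016616231158018383347782078880001939614647119841658185621430862769908595904799550773611393779175502110112526318539506652499291979567077599876905255434023505557500083598256868711406061865197321116661575394719326859016513714478960358582297752534411101587968000,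
    10042277702548410614880212520000394147799085338181765340364317100383890943321136819009745517974431731411256706442246853955782918433079661731901629216149123020548233344799004137255115106053778928715346564294741091458888694162130076765986433917717043965320980766908491543071337485509112693086130480138237925750402256896,
    8131544477385182501352173979381067805462031401883632199904137292592251693357144287290064070498947374524618747714892754598289539540081212169314478644701755488929915487192737431952668427074174688972807526579297120749899669317922236681644348807164823255027049044982978238421146660735075002991313149685386155202259521536,
    10094465519083510046065948301149112555394410743151573520740463283470340611508633626015122271176911166055777390216926245227998029843180525555437220099171835670377293275667696863327369905422000508538937803583544626496324495450381134135357049274198890728417437976403979314625368584832975289753853980417514378392450699264,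
    1665699315679488606976590959650642471798275348216834415658846323289951537534031567126482910176055556801451442482553667592294325350931111671159574737850099368778393347065508837925392586225818873104501314430237608865439947196377740696771516947094014364363144315309841592344782531558916328302273121952099562801345662976,
    2137604130483824164327874243181456426118368709612567038750744322200551233224596078861643497933081101946936926122532648442566427836880189256884669481526580360345775915039666143725961192566048872483178265845224840936387981621045008144854600800543193355911879210103316593044222312618841643716665919764350413314741571584,
    1619350831713877448011702513302119790248855820595975420381502166197258454750398521045599001490980650203711406942917863622788823712773833938829072296246306691777765886749080865687721299743817264259039800374035898613058451225459638050801527424582738012771457780988757058851579212742645390444666694434071736253951053824,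
    5414318604722393804177224608545966164052380759440368614178596179761382883578936184808576143627208344281800778019299062724190122355172841836487957049879747554461805429663804269474872814446212976026163900830181154828095400459521922363561707752723194477786378861599078146204214756415276984234016790038155046619567689728,
    10073848014176301786044183486962820801739892503917292235458848572898500523559834071810980611324579750588218378618505716090674577640315765547505491143914560954339942104358909592511232703962953632120104615049841823631652538750063826589352165018846046712042900931057903788572132291929447037800918329759093645105670459392,
    10042277638561403035774862914362769768213082888596195954932514969556857269458520831390538049602364098056690403582298052648151609712641775436513213301799835722205655998580582591808592859890189956651694625067280017069445141150885980052869030181122544588206321905752434806987815416312990693722616283637820924374991835136,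
    1574853971657222863852231929540989066482905630975676307242500419187180995388291323130044662594765735678964120583747919130148898042859024906173215377799755075672876015740789492743207766729258669090309440312300841656121655717976914557108560011992868232558901654964193410708498753987186881734872883445270799335180537856,
    1665699315679488606999573177780106765768260761516356183572009973945686852216550048682286611130955389612487304650838643778375692793695054636076464818702469241827748933130119639999545060750670942152741835279131657250725079692685338218936068188290789943613832505075318892980756171018502710946793601141517347102344941568,
    1574451872704686972523977237475820016145970363786062782126770294498468953136624164697131550859164375925778178405776613611796056370297047825516565660479233454701225159837946031286142851389868386041586246110472079541188031259419419783222415183903654585051182312757922584477469824888204413761684231067809705747830083584,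
    414804100513160430435130787521791312915561134189511295417276122239655161873586947339703372990482385467191698623155270754154711790436737308303898991214548628783300835224001304894783252497764254158593594397182842236285716278382760944979420569239973653769986124447484830906552567510976091634484950574393142507364749312,
    3218768191927974731264087118130270001495776778113010265986849657283756708677553366056779141294872349637531632813275706690224662551537920815553578951673533577663395944442857879759721275113377166327293540795123745772723265308777190265363521374672052385360239126692158178490206039582551476201510158383871699327426301952,
    9450694317019017478734859583373651555778140774752482273345145611682528586810822780003987556444534071749502885227474839537780901945113066634853810812626531049513613367401034235237879705623708585236334381083854978605295598537019094898988830803638521404110101023751099748460578489309735605632241097767604995912738082816,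
    3781316789222244311415001459094494404547884322741571182717634917332065717221095077358593168081331263910865779694591731071490990094992355738789413180525363273071641903782056172506566416520084521258579164532015545269168315116074169529658793625300625914451819134893584130386757935351252116693526688096189612211710005248,
    2087751801665774224719633062456325740975559612051909291857200747117776487921971410648745345148855253281126472641358857670064668004205206933743039176123608987855732826513919057516402487031003819728252615554559354344962636451011961449326427400490916295841996949470462440116160309132692994906617529911784463286431191040,
    1047862843591548165948495457290692849084012682635463369080055161463536456876396454977912754742987299583194659102505295252655686791371460047439771563976173274225494421199698364004826597172699557179075274349813916664662809082859853772804176844767155267137843370714475136610071893227146066356901980672956267380911968256,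
    10094465408283380821024638092238848666357985658899287286574148201764781220168580603795868295285833979133505607173777874519867152218387818427394329917350405656151227645324569692051124966988718342994836975979614134345568085129409497575379906252882791087329283422078562478388132547473508120274940522122921880546469285888,
    9459513080348927144702059306127901971930343322239669566731847160428825900810997325531371457301345053583419174513661462293391583439469473972920560502413443786650578921134785784633645634186349220571832168437470714392341919193764705892809888095675286416477894153689138018710257023416653596878555384606750980174053707776,
    3215828647454581653966483996718432598704766226736896682795750272493185898753910963766913378084462055169309630899333385245554919049562433106759361758134418980622920767574980072720791215872520966369571028193323345779694989679470453309635344157656174236290600039761324985947456747655575291451532314629737781746075504640,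
    3224244613660573780096177474143304606017873046164673690898348725167008243697293478146143892737875904685319942624647438330229147706526211441237301711091599604818446254153821362998816345730529541815892244477912813135803761303783192147852744299935478212975322700084915072203507538936744919337708080326083681120104026112,
    5578854741434971008705561237663310429370436116061158133118802249556129367238745712668854040702786302320378007273649421409956326677321972157085770440846190568360919579940998216927022814971589541581971722649581061297557619421109069282927870781547111302341427323725309603329080944839155469584594900693416749074857398272,
    9459513080348927144702059306127901972054430534416608181062001210399366044950575041404199258536685378134150586541585786433828228879769166871080877888884002304472811843966302745013722805302618803918024859938582665466219955985595641239734647630020006715968203546754740512721085347625730701778445944904110161465875173376,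
    3115681353871511709232056635279582585995313519979307012228422424504437424695499623392275107827236909515488738306408263622709481700717649743688853689027905768437341423748729323113196988970749851285717138819265328120966694181392712966262048167632917870942162222671272486523661530875169303698529539297067072757395427328,
    1904732101477246245504561498429538572072965010479112701226724278833662370184127419406527869437958048146458451985304339407246009013010106343482146568828024427245681667830040760266509767532293941056279252925551282163068354512993884854226296513958409408740987572187211240190445607068725778926738562235240138154156298240,
    1904732102837810258818458891037319988040484551890555758150624710028880052179781602814532278333727530921372273770744936451925397583922943948990840832962245239002737307499292180875538130860842473124431621794608687586325261724344310382447264171917364603764876863022506337986647691588504320538130879805602520552786694144,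
    3224244613649210357915663564948139511663170029585151762908048001615590795384736070166353160661535532626430086667954451395996838772888742470566124619185634209627722886475709042325734560436235215619902181791003403423836941457971942120780991676683318310674030192748541440279872085628312970277461936198893813061062037504,
    6733509600911895678250482641179440043331258327418346530868347910742932144600260487663094155307524610869598284132586401284246501609755144225543042048985105337218603427589885881909029803116188963060623099553298510114470053081313027074581425217476001837957027237885160242317401885240331973154499877879493889289450491904,
    5413996458112626477166280099412441909053520940801144273548777273222694226100171060630552703406785012822702345713133313390807245278764386935193712867847034035971563495079118386596770419086075531645259956360114854613542614433016016597645620438296155753885190507491529144660769755810441696444219975573298175615798415360,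
    7922430810133496798594878534194813525768934066163007337416813097089549595781588487525027839034110527177315614435813619806321337434505372492648779152450734233651185939976089970729355831839244874123632270481959522372870862335361740568207995524414615516698932321109575783208844007235526586819925225460310126992617705472,
    6650072534383926833061124400763118291213311852239245219958037991410802518046279443091221693338146618537423541761651319622787216953240873220799170953150915522752049237424272004802966312065095887533674477137871080720258593594320033639560847133345819499231198804339764000216635043704346474139071896496427997719790686208,
    6485133560347858124548178618833822891561684697796728219918906921934054943775034526957392566835649422966111095029613431893791411447861808598903015319628123635153540372635682881942532490928335415583001409131644046178770719749913422808686221892164521908219753848838690348703249440827374740671668344740977391808994414592,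
    4906453955885548892838195918094306285939520757159660851841035715978250891478671154987044163531482299814176714483602000181017295112175902760080110604232158135015767906085158494366870263279423553840647219212462902935177629804508446016976180984550887031181935527787335277354798659762434767055876135945233105640800194560,
    1566437904347230084230111087203099712816914484347673818453287012500485706946690554612266395962421836486695747533965715834205126284940568487276227945304998711559509164543931680681619530173305624576446379286622433661693694117026229223094109114227137992856887913576911871386568568931878037336521181672654796136811139072,
    10073847935527227061493958168660647171400749667250918217689426294856865545421062242504658323309849744938656218247308677452086331501629087862324061724356285056970544483686151201242894067323713208485579060146648734313914828382566126685666417912869069809149725123119220512584070773586564824533735526973570957040730050560,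
    10094465524170695125100055028530963823563736061973078341610835479553003150892349228288519518569686883218673548622857307317190497635790013457455600299045100345240385419905582297969020785482948187691947486289324184512666256282371303736123540814505720911111871358023195574068998949294313979614538344910431851997307932672,
    4906453955885548892838195918094306291043542790866936876677128940337050936093989622670944765451790779422458934702851581029753639707716940839357566974185702684702512505208837598129264026674288133395857638973183180803894236269243349003750224528023912244971710201523920886732069312344416125904180375030168364709919395840,
    597420913402692529038990308021562318962029557140689508447670026843837461361311931067640165292384379391813522833790430093305880568995276218344096132687099958824004018852465441912449331411455665310869199818575135341752076314410760619676179233806520960038727229344004117012126967637774661523576792180036961227108061184,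
    1574853971717301802590961800743298999581781437772297397053120705652306945778501143411864470205288106605283279325991620134230514485381352014940744978593385547597046197118409803949009364276646113132465483978366672495354714305391978288834586441397463014376754201803916674508743359973914465624683688809210057889560727552,
    3215830157790876492447887363266999268070419320615790148812841289789989137204808271787152024075070250694196558025026005975578872331131334142870371888936889455617135560092180242196708831818114246782604122605999632304037716516851227224969962315076624884319575181484900572791594192918795705903669310231608695049862057984,
    10094465536980794825715155080038547179777182501299249034193880027009116126112268042993791987662699743070976197750842096221440266463004084376265068713658906155740976847937953490110919112597459383713749120796582187449108699476001547008960172360990339439596162332227588659717744194141674356564496457176399814067359649792,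
    4906453954349434153575963086782644140587006669662826919149637172268808706874463990964864338975943896780032256173194085454018146448348743797318707634506696089174555150835665883131777969167934241063409512764482371442802412447088120340125873409130398290132364933538573370003938264323932721374755465275971920411568705536,
    3224244615062278418194696651576307188853361965636842725591297740702437868387048631131036233808347002447280383641308329135581445117843524562313418061684594170321031724201927384772176607272649920348554580822318864121703066201263162344853354863176105929671270653217476931174063410703091954491211244515659234053989404672,
    4720897518424478266042294842661090814245157529749005062278931441129185825280485819478489229294355559127960394209967788831243814675855444892546676292012435289481577651308517530792020054630595142712025399719596522495006485761707640501642826173624560735894740888869642816213972327041520127795278294602187337556472696832,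
    1904732102837810258818458887366511874752571813661292225623308951341747326332234991536769744698716449869969211775699726369158495050281172828595498465256911328963421440874147836220458288185914137475801905061170305060775390436951560934212863906359923882293315161344091721347565124716085684244198568792393498030624280576,
    3224244613649210357915663564948139511663170029585151762908048005795850862134615455871358651424709598853596380780196057615201806873235746093956213076550975356184288799009677981667924188898324147526144127737913137139604584856351176331630626866816287506344711651539933481155890167504106480762439267459051627973238919168,
    1566437904347230084230111087203099716668712381462690209834728974241863701101693844719793638360545321317174743278151570974430071709383708997630161403074650134611835139827438447295640370678803743665392015757547221617560839097824196281231353105299690716462130167845809439286314737522195963707391114918014773684400361472,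
    8382536861100926778443134057610688664033050639746177122557964532094531635212021149207306294714714799341046562195244299444211073411971149710277096352787170911413184264012890448506621795438481221932387292729683956133812402013006898700592348142838296917275492730952484747976089179610731640427502212036715378006154874880,
    3217721247823728043783646012463485721397691053747485306109790507375973995320810946429384969867480928514588619682933054782281875019796635092010883262120175680385828970030726902440794327575840208852213584277775111898747185071392193782694674979365405653225051424091647713034075722032155340893290782477133328990172155904,
    4731166101523356586591806729345166248179391896042651995559313796372379678678853987123521951089827974022208842384473954485332015860148182582752817042137299353184499435110642719759286161184418760039382721016036069049440753626541221888357762801470559248501909762047389388586677766843158682442854637824074572848216477726,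
    3224244616425580250273478393737571372673295585112666573346599040194910361550110671803727182466338258019595122403715790789920645723753951374863883385307817050477419947998998057928055343209648236434665846374095508685850098585717848710679704393460294567648408204300009448469600969515113038822882403520074734293264175104,
    3215828543467891178675161360786921059657945591088886726755372415092364007939952418114791369439513986165366922384648246227615274182070257959720520889933764430855592125856951780694049098265698760501344763810558394554877304661250596660050516373835741254890233298832678136240227087933393659147107062031623582362192646144,
    3220660770854958751914821289655846331934964113135578549708544149767154348528257732829516879068235916153523942670810829777067140163802956109719195064715294484107370206594791072031081494001709551912262340823509911291644929466994485834319012271267112844116703148088379529778332802427891213755542527839687577126747049984,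
    4906453955885548892838195918094306288530491095341172115330619317337635791092118808145597238071998442551646059597820940797239916631495812896480547109743676892861546309666123433914051566583069475106846112964708985097927905208810206064531051643262868288008614840611458498601523364079187037942119497316422453720265854976,
    3223560290565579822355246423755273288356326976302105051013114790551345445213194441103746287783339429633140657253275151325547699328315494689064208639258626971159109925097761277105347778413007469586424760294875605751194782833336815777776018912307554055736447921405150618146442512391556942822942109290581969468467777536,
    3223519821663818273319491721364924389026615075175717847936387838208763616237137539669447476237735198909850359475546032659360824685532137613901085062927565577780555691221528894548096528562831067019092412309553496190635056003711064429069582335629867735801321308621970535184245589537994980830686421362220736510327328768,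
    4944306192059864324327275884248302569575688190643469981271303764146741411000424143238863075170306636498051359853112953210798239299750336835867401716099823132683978003228865805377148326008534509066614801779645284465905671379234690878969499933030775363971572908189451753890127064337337458318340372059261895417443192832,
    3217721939073026102839375796618479973913486901881425528773060188220406127889439758396004975094889353969498246772818713148623106677712338265652093628584577675138121170745817865789054587630898873117007537794629357282281014952409660125679906657893042659823625842320887934862853399482764451402932739204926935288989421568,
    4720899125969581615098266763650602942097820824878867764204157208355219970092685893804142777556890838295949368794587347980081676505970586854204467978544078179274026418644457504286798574609953334125112680578346483127968206994962284572199702191437983641808646465180418082170231229748404355258987784372117564777806237696,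
    3841397050309703182343621566321448028266440341352269292577490885287737581834095851855275229641017747746261976197343296527848658860137318010989015548057020018324999162376343283304808257741311138606337961387699200404748045928349704937750810471756626382624792841492343442733327422226698736889830980229293406900896731136,
    3058580892923991055719139358293987965871916786406877388594535277456034800530552501554986587517136470790386002267113802981055293860702563346818587593062888653038625166447806722600511888717364585042247622601207665794193508278011497859188685010464664805196694575812012982206486786604783833386334197942290115757616205824,
    1574532555420371194510600438126855819844342912610810725511964046283499112780170198924595629999225309093278282555828295263872163952477915053943763538559344891862346085092708441790955341615718376236906284288995235864792536564858724077855511811761590085864756643115456333631237244240939322918507393814117559417749406720,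
    10094465430905756073977380615411299657605707308448979100794923282621313631113203923654570589185314448081353933227009878035996481391724880826331605428840401581129350373430826386720620501734947969371194718480091922429935920913261630981071061066452943229477637454351748836668479592315064316152153045007965158765184749568,
    3224244616425580250273478393737571372673295585112666573346599043855095755624042507715395722868536156702841570259112867619489678497949278407334876237591380568950082662613265309367632131622517055546510301543130626153550388271871279268914266032814868468577471396946103210668419464329118848109777393292833083493777739776,
    9246413086756083530267262338226810510623030588628079034227157577503801354362045050955025179350885087886469238383931158227794139895586740361711422500332811013468947766077318082615910723994797012615702717016005453352069187625699898379312633143502210010976091091591457569653104281285267890948036567582419565095808733184,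
    3223560071117531829519085480345426184671009242065215088208713569331036734351476961656308475468254868469501928184996773395826682241101163784244416261121395972060192609206236434457862275250266841251664099935891157700881710640723609635120521723101296943189711103078311716884767905332774290415449115536481614245424599040,
    9243797171704460338767454969983126626259425381633165564409383648683297203824275424257976356278425537046393751085160237277393915794008343813610202444349801522242313052889865364347220330757865032037918497425806220359606154058778137392899038372683769870587804761552764933101728396105487184562247162788331877527867691008,
    3223560067674885882297196056122414866345315390092253043175043816932427616953929206468697108208910413011399076228904036433895307947320821982114042078715076061693508392300067272628694017418792276653868368317308007518486554695256738038930515825080495715023059733455786954046719518240828125806185511532146401605046833152,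
    3223560805935246174109109247638647421862307254303346151632280340800668438396707591911675288829435881818298986976668014319553515281154570747581931471935064706975930087350785560136248522759827007331683254236530496342836578011846196997400308360386536983354724647284669718867104958476099162410187061058267133142757085184,
    417703544124109126850753655743558971805965356037758725674780043618363757632799997690527026103972536500752238850865307900580944306804016381377878626459832763902821131468193420223243779739949871218997730279918172846505761465451585409823407840527446042103980548764495917875561983646882593620127821781162315406522519552,
    5579257488097572669139402009251222113711923681608403380594931250658410238749976278621421825499422451356440269234957829740247710613273062541291210805898183330739870385769663175042157947029610442774822260985053517074567571087067923585319168675250992804025729195800872948829434169509930593721020876678001893088896552960,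
    2535294034409302591143594471264423762910883655687814863301890148472589966785544224759006869943533104457272022387321120808697833139666111365655277506415004809184792658237688160824918870621045840497955472960304227424588665121385529808150342056297817073266479563450173354169604617957369349843452613071327467734792212480,
    3223560402597339797463767034201874385055000287930091959244202754829180773402475238693301947483687748294620905449194728437256692206801526114900523596781885083539811784209587576532693116285239791706318992507631726949404831699392947874981246178860716531981609756036333259429384180977059044308146608289122495859495079936,
    10050653907693938188472118460903884151877225537855846711980343980390152020311962954731036845993601530391793284823878085185590405041654583851374623906634488765025960758081702113162184009554098578868015113124628426924948817660220159437247244133616506450215235099285365708829165896180581936501720522287359652644705341440,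
    9450694361961345892148562283648838746199072095580178643422298939673275174306292903341858977924844110273333702176181512906624479875713213364956582640780430857865351127527906546406162179983291774974022333465476805497882222063892762899064878613558990801351708046124744682324387947618981560759951539092058809172086296576,
    6723522145840851733627031327371227694733634963919682868984249391343049475886577298140901697480630013129459924592220919369264137288013585356399037919445588794401456465294344162034386390112460188220364300020960728665570858566506743723053076158668108117793352510839894550037523687228594184773772970356417067411405869056,
    8383221593378865593025000339304776616283323157431381075236745215746278146923008391576810481360818723160422717151368332914224645276266406721806134609838425343073815885197455560296692987660568397381025057348948823781681270396789237033661594044851782621543067391281279832853506851814900285327900831381955922877337112576,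
    3224246058134904201841291437992543067794320003336394454368093374394606039904560128600949571266109709074003744402756914777910907489166913342856602548770232572445713805497642900128115225825238424127790678200419990505260269737944957869051551077491382248801878119855544930373439310986083863956545120545270152096943771648,
    10073847508575107135208276733414988586483135726112797249067138238544474062036019838043781307140433267834596706810506829562567687308363143046896095978031786091866897261206833078467017350628146943093344129476597321010387929101718822728346559235115082607001180112807745855198577330032117953337315943625022222610553704448,
    3224245451413470799112897786110781792750253527352849531888515472398728522215122751144351546724930132334543251627239078536482618902567961783838278919423507104710063396391064518977530745697372206574515042102245579128230890335648409953139558810896953703474002468321421621980730244893866637150250789801491728838230347776,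
    10073847564753017646839044828004430916540447873656144765422983328362801074866160982627606746366020602483405610882950898043678270022076011947785105993137090923586925033093176316376864536802032744593206882256118046679047654235097885556574008696681741732297922905906754215257116691735486804249408381918877959168820318208,
    419878028997434488142884101898328480103954590450577135627356139302564655227713072038727829845607371230661243707573973228873798283023935081754980370116469857223597244586478286381375359172105590787478570743507586195829165539048470477437459430899362418369744337378937949745269670284317809901352970722712113087079321600,
    3224244894550126327858946428506643593313203984856036670043009448504493347145613198151569521339828257393811921045902968915206940285727726707284906661293234960942699393510709658507384747399384532573227651523688983327042287234352118190775837926845743659048777625953406159865327299595569795432706023320816579985898541056,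
    10073847575988599750192435566160563392315999010358954094875483489208842273333553345326025816715983238473230152187450506284191983150894170976045336101606715351976371800800538001245180376267861602695416524423680764572867990656682728807265557685097257078054578472459987825964793508034187237953039171836180362699578609664,
    3058983691662629825684203876901502642309573468886144236815353135874905509048138632451227950293420615704406313589176137691306547790750701528023593766433019491417406421481752865225253118643153764862026553920136519519191673940842798237385074442232230214882903030239706301169857041718346135263489129186048841254741807104,
    8383221469787462451047447292382300065143146898513851739970407833373771579734574923606459755529969849298846143369592770007301915828097528177252194957842208036734253583992010685389037280047801802275645578316190259716634286669399866416256956038639115217141655950357075955718931270257733249767124498465623212685750243328,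
    1566438184007890614259762368760149703590600969920540526532491345293884045106587204744467868966864325402066782441627559285800227585886449195607160852369499685410140247194861036897217641079260417395820086318452895822324499391798103136757136491854282904993581031624258430939513049170257700596507782505142386832997945344,
    6617173316595867265728017679864794045318913533519192938145832521860209259972613735676636794266158916544210470360334900904366395608075698787293640801260895163939282643971382599934355316229840292305756657204550590821679481956241372941094861116344096713853992734051935933682511543081337302259280727017942720782436995072,
    6617173316595867261274624684405792243319962431359668369363277186390001538796546901070428335902079636685551020418053387886013077310881220728887126325331493973816504690495368251648657474596485824614989295891242559049009038759763752577702448147028605999370299635892885153845670201429865639457883803238463844532450299904,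
    1574169769709535997121160983884539884515724142007650479150521187820982250448636211726352073592147529662380124989369503149259594564164476659684616275018727723146731590529609277754042739700773812067735797684996154254152553406011666718820478278249915744317204295897733709991114636617988544651750554676874631154966007808,
    5045622492048208752892457800753000886799082509359004444781856662197926642540057586285407847456957912384893459491641549184398763106651173863529000927610944689521349771138926432191216827650994727223962221771308194220294596314731398023232449541921392176856936736311261075030254531544531233952614726726277615128259923968,
    8731140079523860665734405490307048010101969208183958339508607139493892614028165093424885806705341330589153007480361055044451310297601595435123141153869663688578149342453038880714824886065809800356179927786702829798796515058032217221541056886938789623947404788311711363922097054154746237473022936709255117921630097408,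
    1574853971651859721462921266323041925657004349507127338340554302562346339510885605177758185442648247843875815518635715665734837923533444683321594321128183924787726030895997867010191783576444635469277584324720335873268203635791506065041535140354144610254554495111667324993790711087597450220688983060400349898563457024,
    3347264375780063243853008604857734963241415469209751320633304725006293340800492228171054031042841005652766447655713099242310391465496420549648850246823410714307618941436974582368642487406895563982715134425045948003001692962153334381015947132118951905096588857230174374204996195390031979108157464644382919309275238400,
    1568332010018594500328901618158349558435838029349032402030829768121812956307652866628942149508507262125962998300983512389170839157616718716067071963758991586670166415840125568774330657247706923272250721693253768089667158998700063734064127358807759210658834096497996389883238187114922721943664250778435647069741715456,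
    4731206208882716503719382142975779654872583904552745787331311683068670719649783520648342852710802590310903039254540269310106499226354293229240794840126347803131870974017995441843236199638901349445987558222750555068884670246647151526920443614214566292697699125936651421300381081177171455834376070472927857670653546496,
    7032784180223283102151236618912178288171560676185013571918926120955189973614784811708228363345201935377825380882024050726713614780089648409628035960403117696020041314785575860162332567385159356725857601564257595067297068837507875138938140421788583777378951770617230120065928042957728850828834390161469102673445588992,
    3294915555036172636871379287704756953520486669398684767043011045999129869773366557281708306843638048389848305414549443294853849256780771293351928197817254659908423064520938739905027381594683934549400716002516293864177696757606698130350385431862047174572416090402487075861356285105211433403030085549485212046006751232,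
    3224244615251142534465709610075626319346608302353336872853895767498806012048265239995166262760546391429178091458416404753380793507207861878235389220738692563674330248068430155826796735818243901967466553990193803082859797211129621393047826891323695362250199314028287604852959808577483176177240539105370231779315486720,
    4944145123740003270013334309738429242263025647463385590663538854850329223754199638314904639658282394495175769666171005486310245879352274721695711253900269517242389973040104265488065142831302703109704779321247237288012721067312941026560096512965642606628756854928983127558614414633554564377887646724165037002553364480,
    3224244618751466652030729423212056065289434629520266688306574757699101170314921842800806002587165497298511935889956900900699365041669330964278305259168015244131182051844782547424543965163271463858435045699354382663683580466369702803561888915450999108230231794336234403583509578176734250477202068507739724179082907648,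
    3294754481731551441409199411003682995495500455679774137646260818063892722220275341582484206741585647688508521833216710758845522152804672966545135116613003236788809329673180286822791128030719841998446195994590710619760172734448273175005713362346000683636653424994065528337855237885766968753866724983402470801671000064,
    3224244615250992523260633678239794767656464847959474369300856406759883342379051963736316307962249743262483050332159322680227361309792593748830379644436177019183305241066223746216585809267619438805745066366191868323057089249373616928428592862844247015295753693419667376083887913036737157569802299154293794786337689600,
    1574813714626662980217110590027867372929111759103677941353488983476497332252764247525045039995961469039291177177915174587327492952353903099119350079489725877922592723257674279257282153578310997435532917282934806808239465921200571961151729131705905263796741856696703320727945314071467650370021955294775681875985633280,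
    3294915556570187707306213179202371737638633522025672831554235623810454808155905666399825319514527377978036678900980274203403383690681336083932904266032075392283132847569763419162158620122085637240594220658432259430519706510122603547340224683859598227768069096810098440226853668713859562169026879138357561226722873344,
    9926949389786442820833184135582016330467579908101200126376241111839719262234120543060606510611694422663382419131871079426431736442633702938761045046866370638141173418138425712819994595116489675554842290492222066044603107618391517930560729838538883585760224796106005159837315820741120133128368319005977886051714011136,
    3224244621427705370598503149363755526829057907917512552162889916007519925742427991792532880445794668174669350142054833989589325282826718923172820181859729475226706526902188817987445590498880639356136111806539471046412168821473094251371072918460895215330819694439218774241068252371064038302831465612953792724058574848,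
    8359382549038835486275522567596566024773503666413594765986653440950663081495360444754245693608791166977709886788460211354183652384035096960543966337868418298876645122986850731962740196262659680881183843643157412615112046326574634845260022299052252863209677317793705822326067105179198524070185605002305010787567865856,
    246925525567243762953898222973135068341526056858178010009916267667769486479789325296187578269854795510951956056055382179337943262405711118322041140770548405816015927846267479524461984561071932163388289527979633570161745750721707712471399025623763845980954000827872172296668774340391470487704982850087288625464938496,
    1904047823153455209698700957038712177736979081970584362377741380914833071623519588487327759037179371305226860459638227980587877931286084800182070656269928958011671055700144084361754067058093328528255429670753652933530390042620873562812574367325276321388058077161180583832034369021732748949680276746087378531442823168,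
    1902114952441524385070855691829672250442528332247489594076401210009851991705258199988893367127071611393955837313346485643395258267495760137445931396797423529196136111910443559777864245982275869774985922329880731767459696055691668158844862877787296636847703916696133575722789808688878579017850832460521745708661673984,
    419878815315068174932543989732381415074843089497696233279098156488783191648643626001964010774640529896287345561041221012563292150915194637892976132761722629380903535630205539004142943051851566832536396568279800650829165927640980149260035787907414326623323818446783911139891784301200433553002239422000136188133707776,
    1902114975085501342985439582339540175178522227430321112515338012638986169435940221360202531134800480265176641797338758041758678221883799357572377117942856658135624505364099453804519859740641305101809457290360029598663643975299549160129550558890467045111737919273220964903628037852497167105795525458144577967774044160,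
    4566267150480828987776648137339995063130311121773688063037322812172360227214929462078659930424042462533252942907263800237819630566069153346451165604423174925279406777138809607390646070372871084535748839741489451969984270470058727338980562056011164893496983364269370028487717061257536838215046839026133739222757871616,
    8774952136297590642320517749543134888017777147612663614037534047481026713274291124637925478115753759371402309970246422807993201353858494490722959565926401344467417574870830349318889715642063414004138581861612211200998636291629842161396145030549738226651924228354761425898931988266145492040363509646192777681326379008,
    1904732101476946935135043958478331475649347433000951607974269062435547973156274695659054863913467621217655570523467601075782957863635416110898321841099116476578161055399798508735579992997927388087791580474873314177601512011878743507353176144423993134447701884824156339081252535972590218709764932249141612984736223232,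
    1574853971716664471423882326320234300082504298571905364677715883192749714546872482141555415090390108455608573647179325423642554559342502049724428512321228961914398793829806831658596885105638499429336383303049127234882954316974201848521941240779475501070967978883095331518984882846864555567249638073515667811495383040,
    10073525305787429286294123705795358739061175857822266963061050289440682115663157139311850946355478106171670208883699504695375866522523917403001186433855359565584605816992398649386639119478507796962913682554164029729582621776192917154318427693474587461683202536199124283907020297518843084910952946684084560080143192064,
    1572277163117656768312041893608376375360857043354642564054394878472369894393865910114290907641281571066338979666061563583262991513696663648436025707285086897569601607940105473505785692453722824012428050408563618115612512402182151533006876569588832320863392073587395777812895859440639513216896779950180400983448555520,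
    6616206872033899730754658564158166993637397814922639402495129074501830203376410655866230671869874512472929982531809955769897564812117534565196151004712362027739768220993732510635122636382258442455941780304997967374909222805806861520482934574643058539508745578991404808619268277497455094638472095186032257224932134912,
    1569377838889884220656571741631520111971376294350300679065004518149971418950692691687901663448957580776373019627319380812282576191189991298654536859543565801465225788557972320901535318138401944614893064103844282821985701469800961706789027225935012185667267898320304990443664144602956348118993580991541862451687264256,
    2092181307718860418000687302662039823005468968563454901239233875101547015134520225306220058981578820315575273801302048176183096857890793215117283562294789540514736368404898853741894773820516666752177717795003115423577889672350107392999426284799695265264510196047005695150799586451762793788316284471585250880271486976,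
    10094464654404598644245670677159256587067822290354982648434852664611171623260744189746794591596581256802347357866684787566561941227592092589598584046533685020591673956572599106125711991961931912205042497802868604271567772051427783671349488482530826249462976969570343632327369697190762022140417048809780387735935979520,
    249865405506130060664846860067957234401822780356666874973102161582972531869634749219340231333460965439367162555267175517492586278469431323401441828116654598968644669631738238369897513924951326985177017170412580523143174404109979475707048398854096118700841008526426769438760197607294531530663731649559685740144431104,
    1574853971717001807819980299693318836830240163148552746497622436797317436727966038454983783194173848804981887505999598083682988634881212701628687834102324830779923134344391556618586686954239197143138584795088937970943277878100984161850466344089808919658355430153422376673450561563846192326341827845569880482781138944,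
    1569377962481287235493210605517968203245241636875283650558501807965166912135029507737303433710323489357820162605198722786042460857302174865696512187581080910648676007650234458510380845823494697196907082838904840158390491318097329866577001030190856984474339931286766549613711434236871520643124737706154880755349393408,
    1574814033957390282162280897175362331071064665498332999031460063925052392142520610852668454170039132221621877380956839704538497517055428732015392139943333804087538004624143439620833337262876848601447946155041954550820300910346437186362238507504456437868837208601530249288381916489652300018316448483215965660535132160,
    3277680706543806588284352446572433875016879392528045052534289317973952846102191130731319564061326787433902324320532949837068522883158138089850058794263978046214013946652172169442665369653145382997474985477919316863385758424657388502543143219516342744503591350987090631257524822490260612036467442886904782355425988608,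
    1566437904347230082745844575420396579701627798846740568346886730761275883356807993383751974163490351889486000176533514593481691134573868669064174363195661224010344867046051017717694640679074283749819586719515117346607828029251553484251232580770386976381490331056507636131387642775339255662285625875929250940658192384,
    597100349781108507237009601297738122260858221888926798284729423078130704521376909437698592830563175590294253869944456545723115658629718278942201534321560512637160699161203376671213954848111077320893055902609021614588746062876833335270233186691807758114675342890231519660267340475114434678878679754055367534075252736,
    1574853971719065872594838322161339239089001018934474231223980507243113501182794134341902734918733402616472320308565610245049381733505756743121591678347563460248850335817093963347330732369142711192568016989316203842716601426274478454983346553589130388145503301736337327101016400171976343763269862321460491491239333888,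
    413758571841139197617277042513959404069867214109616161345667472505947618857208377802411003039478743528682259652967160725721920833439475800097763893744934929817676533699613610192603676245117339106646817819260932039999773514141976912011050008068687601121288561484357217282240217310979472903873729627323174306928463872,
    2089283481159005295995345442886996826007886092078510446636476938828200130572566526176709895262091130272751119214184382965109796586843396615480838443622468474114740092748041415445458263110825515927767823053526335944496390642043678634859566810751125135008552329838699212530354544705567526964782351765621331924179816448,
    9926909063707118108495238574104414859584966337291348791461165662416847789194467411121464897387074606303309422298205450332626605392287196396377029142950317811993908126589177605396877317986642503349067348750413735484806112025325636168758152966150416292391582231424679370559081568598211638088549495675694998829715492864,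
    254939066932040738938461559776900705202574811638109467855120840779002611259480268258610232970499960236864135275230169372695039070969325302838588762003812658794250224542617898202048990945489702610453946266049062181437295977890076929138367230012115562164165268784812377853284116589865678424443189886213870474194915328,
    266819481939246024797823611437173504971667620617722614051259755229825510640849068533717490925034431617533031346692103120762356087280768435131504182498848711302082098944011689140472495793831285417050466357945600652210605054361222986410842526641536697731437931054370003818097219316927503817395455130980431584813715456,
    1574853971716626976552084870424550379259848876817177207724014801971141929224301549511913440331059412451790938446830082684871386604501212047954772652673106175500235722153189801131596403750292067390578723833000163548010569024536893396291008718569279923090264964097065050983585756771015543176986481118644114426073780224,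
    3294754475366425833350579330751289065045794745603789910215071878452534891399192586318485878603139904977398217402121935644909769792282083171279416025541643040621544078871318823933643504127278953156545619586343825628357516945481751619605634632527139624258131668054243791863747253794394147932496095304392038638355812352,
    3624632608420316220444693903981450117338553876955415033854148686588799515585538762792815365084015724948859469105607740670181543584447114884465047519174159032182814631345010292246832102022706954843075451032779494757533765867942922285044147867181335178872436892984233100834468874032494874769895778507194102387638603776,
    3218325983826146470096341049166070578296918576148547084939744686525496916380838661444302732799410650896014122785477248059836008439031308920084183479893317333240770405979040045029278452890533310838493263491782459867798780015204955241547425711927171692727513393972124916367618157037577217176870466772135340747170582528,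
    4927071347446675760170610627198579247734526372376532525281694760708123771487923144658693001266220246473406296784891959275810251332646066168145354340951461351676283517862918467015478064081214735208165492846525384828427181792281990182785320950334926166774973442480290667426896331008229772972140173523857026097322201088,
    3224244613726016097500236629642347425611970290149846314096886158245389658131091917126046797989731174341247674083793635216734422456916279417169559926694450162365770472289974618776865494053867341245974741293640232020449683601002151905262924222749929661896837486931920664725860059271090150359447877363888495397249552384,
    1574451614286298594295959162457848463215398376909885932724558942241516713169888239674696957368522136322407141386089225311022167789019436099568113500866004282895595963512625661380885848960840700332862385503095036812410596956828066645725646517271339487690090296729491597579844270389587451457988408343860031603723800576,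
    3277680706543806588284352446572433876313516043775285299334924802608279420892221372328913599448886265144777721852565176521336644146885710948497749006311651111013815187376257160148156125687518990021516635615257118674318695043246557209241815720051752847557497594982278170096050674442606023155233702616103668128959762432,
    3294915550115917849169975075699320003996272825932899035360839497248898343409377189813323880954870941368395619939399300451109251731946283468168595139272331043035515185753004613771986821425558599411441065807265520941327937881253222720832941497011819106499308866229228416454251893183375783319703706914952659079443320832,
    3294915548714250420703000850521804736772907342686199700268963312068234650997639035228918495067979637274302916145328404165201527434894079011168272167419859413249708206168921860398429792879270231659384695583115512157886409635185320075452317160977988720261274517412177328252496718379743815978827932103114088127669276672,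
    3224245579060733420425994407240681374252333185404369472273647412667355237821286539416622361852574911349365057720202660837104808184941997562408390299732897406817820919744260480645492699818683706517727374531905233634975872321515968626570700031281583969542552940599330169356265626803436837056783322369910496699018448896,
    3224245108026187079926426705783091629737773313711809812133996874874440012305075829623728895590184422065161000566531046336783927648268950618867077104893043822870798263319289248701194190080050289973972660876867213975845172644462838853213049113050529248487882320334713592828215200433862229401455436775559927505449979904,
    1904007756355047090370371288624866916350479991139870622863791077328278636952211127487403305924973390868334367784347230493971219254266100304818427206256293080215418828847462729850958507355909688555206311960292692004452412613901466157836004456975047474867439019714354453540563148739294738891777739879625606453202325504]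

theorem lvl6_ok : levelF (catC ++ lvl7) lvl6.flatten crt6 = true := by decide +kernel

theorem lvl0_ok : stepF lvl1 [] triples
    3224244615300533704589664072715282162217917020765268010232541984586165259391716290855792008573567792498874003659494269624985412061714109737633552783837692495389759444419095105851034228254419543881981640585346863766582002136237504524791689709091875835174748086385544856027711545253238255066093326630256675422030598144 = true := by
  decide +kernel

/-- An exceptional system. -/
def sysA : List ℕ := [7, 11, 19, 35, 67, 28, 100]

theorem sysA_ok : stepF catC sysA triples
    3224244682714026322117222392925825777806175571885055494067873717318291531890774068266643139561001439127298515079556086745403661118749035222363173091009293179284233370307742403666545093793216630628338095527282175473561977369589615584172074951349427877772803910643005335928951879353600585917443665615579481922018807808 = true := by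
  decide +kernel

/-- An exceptional system. -/
def sysB : List ℕ := [7, 7, 25, 25, 97, 97, 42]

theorem sysB_ok : stepF catC sysB triples
    1665739584005747025654175615443149340829055786425312002730063169930082653969217224396093954485931532165575582712220463474631444117533911603750860796487302274443163037929818783764371873566714028182548216402801990799485933854090666478886247358017083458366681214123042763113141583384874994750972796124808193665865158656 = true := by
  decide +kernel

/-- An exceptional system. -/
def sysF : List ℕ := [7, 25, 42, 52, 97, 82, 76]

theorem sysF_ok : stepF catC sysF triples
    4731166100312991156945197749481709617443305021766141200018889552825039345518847395670091763543908401428067344042546023330645461787143617987112993647814517585472626246396412103447494058926830001086511750638412623251692088438185688754723909072055071334319255324751392020218992561546666898145996310976383760465027993630 = true := by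
  decide +kernel

theorem sysA_inc : incB catC sysA 3
    [898207744, 0, 898207744, 898207744, 898207744, 0, 889767430] = true := by
  decide +kernel

theorem sysB_inc : incB catC sysB 2
    [0, 0, 898408448, 898408448, 898408448, 898408448, 898401280] = true := by
  decide +kernel

theorem lvl7_eq : lvl7.flatten = [sysB, sysF, sysA] := rfl

end S6

namespace S6

open Multigraph

variable {V : Type} {G : Multigraph V} {X Y : Finset V}

/-! ### Preliminaries -/

theorem three_of [Fintype V] (hnd : G.edges.Nodup) {EH : Multiset (Sym2 V)} (hsub : EH ≤ G.edges)
    (hbip : IsBipartition X Y EH) (hdeg : ∀ y ∈ Y, 3 ≤ degIn EH y) : Three G X Y := by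
  intro y hy
  have hd := hdeg y hy
  have hndH : (EH.filter fun e => y ∈ e).Nodup :=
    Multiset.Nodup.filter _ (Multiset.nodup_of_le hsub hnd)
  have hcard : 2 < (EH.filter fun e => y ∈ e).toFinset.card := by
    rw [Multiset.toFinset_card_of_nodup hndH]
    exact hd
  have hend : ∀ e ∈ (EH.filter fun e => y ∈ e).toFinset, ∃ a ∈ X, e = s(a, y) ∧ s(a, y) ∈ G.edges := by
    intro e he
    rw [Multiset.mem_toFinset, Multiset.mem_filter] at he
    obtain ⟨⟨a, hae, haX⟩, -⟩ := hbip.2.2 e he.1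
    have hay : a ≠ y := by
      rintro rfl
      exact (Finset.disjoint_left.1 hbip.1) haX hy
    have := (Sym2.mem_and_mem_iff hay).1 ⟨hae, he.2⟩
    exact ⟨a, haX, this, this ▸ Multiset.mem_of_le hsub he.1⟩
  obtain ⟨e1, e2, e3, h1, h2, h3, h12, h13, h23⟩ := Finset.two_lt_card_iff.1 hcard
  obtain ⟨a, ha, ea, ga⟩ := hend e1 h1
  obtain ⟨b, hb, eb, gb⟩ := hend e2 h2
  obtain ⟨c, hc, ec, gc⟩ := hend e3 h3
  refine ⟨a, ha, b, hb, c, hc, ?_, ?_, ?_, ga, gb, gc⟩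
  · rintro rfl; exact h12 (ea.trans eb.symm)
  · rintro rfl; exact h13 (ea.trans ec.symm)
  · rintro rfl; exact h23 (eb.trans ec.symm)

theorem real_nil (hX : X.card ≤ 7) : ∃ q, Real G X Y q [] [] := by
  refine ⟨fun v => if h : v ∈ X then (X.equivFin ⟨v, h⟩ : ℕ) else 0, ?_, ?_, List.nodup_nil, ?_,
    List.Forall₂.nil⟩
  · intro x hx x' hx' h
    simp only [dif_pos hx, dif_pos hx'] at h
    have := X.equivFin.injective (Fin.ext h)
    exact congrArg Subtype.val this
  · intro x hx
    simp only [dif_pos hx]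
    exact lt_of_lt_of_le (Fin.is_lt _) hX
  · simp

theorem map_le (E : List (ℕ × ℕ)) (hlt : ∀ e ∈ E, e.1 < e.2) (hnd : E.Nodup)
    (φ : ℕ → V) (θ : V → ℕ)
    (hE : ∀ e ∈ E, s(φ e.1, φ e.2) ∈ G.edges ∧ θ (φ e.1) = e.1 ∧ θ (φ e.2) = e.2) :
    (toM E).map (Sym2.map φ) ≤ G.edges := by
  have hmap : (toM E).map (Sym2.map φ) = ↑(E.map fun e => s(φ e.1, φ e.2)) := by
    simp [toM, Function.comp_def]
  rw [hmap]
  refine (Multiset.le_iff_subset ?_).2 ?_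
  · rw [Multiset.coe_nodup]
    refine (List.nodup_map_iff_inj_on hnd).2 ?_
    intro c hc d hd hcd
    obtain ⟨-, c1, c2⟩ := hE c hc
    obtain ⟨-, d1, d2⟩ := hE d hd
    rcases Sym2.eq_iff.1 hcd with ⟨h1, h2⟩ | ⟨h1, h2⟩
    · rw [h1, d1] at c1
      rw [h2, d2] at c2
      exact Prod.ext c1.symm c2.symm
    · rw [h1, d2] at c1
      rw [h2, d1] at c2
      have := hlt c hc
      have := hlt d hd
      omega
  · intro d hd
    have hd' : d ∈ E.map fun e => s(φ e.1, φ e.2) := hd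
    obtain ⟨c, hc, rfl⟩ := List.mem_map.1 hd'
    exact (hE c hc).1

theorem super_of (E : List (ℕ × ℕ)) (hne : E ≠ []) (hlt : ∀ e ∈ E, e.1 < e.2) (hnd : E.Nodup)
    (φ : ℕ → V) (θ : V → ℕ)
    (hE : ∀ e ∈ E, s(φ e.1, φ e.2) ∈ G.edges ∧ θ (φ e.1) = e.1 ∧ θ (φ e.2) = e.2)
    (hconn : Conn (verts E) (toM E)) (hbd : bd (toM E) = 0)
    (hcov : ∀ v, ∃ i ∈ verts E, φ i = v) : G.Supereulerian := by
  have hle := map_le E hlt hnd φ θ hE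
  refine ⟨_, hle, ?_, ?_⟩
  · have := conn_transport φ (S := verts E) (E := toM E) ?_ ?_ hconn
    · have hu : {x | ∃ i ∈ verts E, φ i = x} = Set.univ := Set.eq_univ_of_forall hcov
      rw [hu] at this
      exact this
    · obtain ⟨e, he⟩ := List.exists_mem_of_ne_nil E hne
      exact List.ne_nil_of_mem (List.mem_append_left _ (List.mem_map_of_mem (f := Prod.fst) he))
    · intro d hd i hi
      have hd' : d ∈ E.map fun e => s(e.1, e.2) := hd
      obtain ⟨c, hc, rfl⟩ := List.mem_map.1 hd'
      rcases Sym2.mem_iff.1 hi with rfl | rfl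
      · exact List.mem_append_left _ (List.mem_map_of_mem hc)
      · exact List.mem_append_right _ (List.mem_map_of_mem hc)
  · intro x
    have h := deg_parity ((toM E).map (Sym2.map φ))
      (fun e he => G.loopless e (Multiset.mem_of_le hle he)) x
    rw [bd_map, hbd, LinearMap.zero_apply] at h
    rw [← Nat.not_odd_iff_even, odd_iff_cast, h]
    decide

/-! ### The Heawood graph -/

/-- A Hamiltonian cycle. -/
def ham : List (ℕ × ℕ) :=
  [(0, 10), (1, 10), (1, 12), (3, 12), (3, 11), (4, 11), (4, 15), (6, 15), (6, 16), (2, 16),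
    (2, 13), (5, 13), (5, 14), (0, 14)]

theorem ham_conn : Conn (verts ham) (toM ham) := by
  intro w hw
  have h : ∀ e ∈ ham, w e.1 = w e.2 := by
    intro e he
    exact hw _ _ (Multiset.mem_coe.2 (List.mem_map.2 ⟨e, he, rfl⟩))
  simp only [ham, List.forall_mem_cons] at h
  have key : ∀ u ∈ verts ham, w u = w 0 := by
    intro u hu
    simp only [verts, ham, List.map_cons, List.map_nil, List.cons_append, List.nil_append,
      List.mem_cons, List.not_mem_nil, or_false] at hu
    obtain ⟨a1, a2, a3, a4, a5, a6, a7, a8, a9, b1, b2, b3, b4, b5, -⟩ := h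
    have e10 : w 10 = w 0 := a1.symm
    have e1 : w 1 = w 0 := a2.trans e10
    have e12 : w 12 = w 0 := a3.symm.trans e1
    have e3 : w 3 = w 0 := a4.trans e12
    have e11 : w 11 = w 0 := a5.symm.trans e3
    have e4 : w 4 = w 0 := a6.trans e11
    have e15 : w 15 = w 0 := a7.symm.trans e4
    have e6 : w 6 = w 0 := a8.trans e15
    have e16 : w 16 = w 0 := a9.symm.trans e6
    have e2 : w 2 = w 0 := b1.trans e16
    have e13 : w 13 = w 0 := b2.symm.trans e2
    have e5 : w 5 = w 0 := b3.trans e13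
    have e14 : w 14 = w 0 := b4.symm.trans e5
    rcases hu with h | h | h | h | h | h | h | h | h | h | h | h | h | h | h | h | h | h | h | h |
      h | h | h | h | h | h | h | h <;> subst h <;> first | rfl | assumption
  intro u hu v hv
  rw [key u hu, key v hv]

theorem ham_bd : bd (toM ham) = 0 := by
  refine LinearMap.ext fun w => ?_
  simp only [ham, toM_cons, bd_cons, LinearMap.add_apply, edgeL_mk, LinearMap.zero_apply]
  have h0 : bd (toM []) w = 0 := by
    show bd 0 w = 0
    rw [bd_zero]; rfl
  rw [h0]
  have hz : (2 : ZMod 2) = 0 := by decide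
  ring_nf
  simp [hz]

theorem ham_subB : (ham.all fun e => (Nat.blt e.1 e.2) &&
    (sysE 10 sysF).any fun f => Nat.beq e.1 f.1 && Nat.beq e.2 f.2) = true := by decide +kernel

theorem ham_ndB : ndB ham = true := by decide +kernel

theorem ham_covB : (((List.range 7).all fun i => memB i (verts ham)) &&
    (List.range 7).all fun i => memB (10 + i) (verts ham)) = true := by decide +kernel

theorem popc_F : popc (orA sysF) = 7 := by decide +kernel

theorem univ_of (hR : ∃ q ys, Real G X Y q sysF ys) : 7 ≤ X.card := by
  obtain ⟨q, ys, hR⟩ := hR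
  have := hR.popc_le
  rw [popc_F] at this
  exact this

theorem mem_any {E : List (ℕ × ℕ)} {e : ℕ × ℕ}
    (h : (E.any fun f => Nat.beq e.1 f.1 && Nat.beq e.2 f.2) = true) : e ∈ E := by
  rw [List.any_eq_true] at h
  obtain ⟨f, hf, hef⟩ := h
  rw [Bool.and_eq_true, Nat.beq_eq, Nat.beq_eq] at hef
  have : e = f := Prod.ext hef.1 hef.2
  exact this ▸ hf

theorem mem_ys {q : V → ℕ} {L : List ℕ} {ys : List V} (hR : Real G X Y q L ys)
    (hY : ¬ L.length < Y.card) {y : V} (hy : y ∈ Y) : y ∈ ys := by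
  have hlen : L.length = ys.length := hR.hit.length_eq
  have hsub : ys.toFinset ⊆ Y := fun z hz => hR.sub z (List.mem_toFinset.1 hz)
  have hc : Y.card ≤ ys.toFinset.card := by
    rw [List.toFinset_card_of_nodup hR.nd]; omega
  have := Finset.eq_of_subset_of_card_le hsub hc
  rw [← this] at hy
  exact List.mem_toFinset.1 hy

theorem dead_F [Nonempty V] (hns : ¬ G.Supereulerian) (hdis : Disjoint X Y)
    (hcov : ∀ v, v ∈ X ∨ v ∈ Y) (h3 : Three G X Y) (htg : ∀ c ∈ catC.flatten, Dead G X Y c) :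
    Dead G X Y sysF := by
  intro q ys hR
  have hY := stepF_sound sysF_ok htg h3 hR
  have hlen : sysF.length = ys.length := hR.hit.length_eq
  have hl7 : sysF.length = 7 := rfl
  obtain ⟨φ, θ, hφX, hφY, hE⟩ := embed hdis hR
  have hsub := ham_subB
  rw [List.all_eq_true] at hsub
  have hc := ham_covB
  rw [Bool.and_eq_true, List.all_eq_true, List.all_eq_true] at hc
  refine hns (super_of ham (by simp [ham]) ?_ (ndB_sound ham_ndB) φ θ ?_ ham_conn ham_bd ?_)
  · intro e he
    have := hsub e he
    rw [Bool.and_eq_true, Nat.blt_eq] at this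
    exact this.1
  · intro e he
    have := hsub e he
    rw [Bool.and_eq_true] at this
    exact hE e (mem_any this.2)
  · intro v
    rcases hcov v with hv | hv
    · exact ⟨q v, memB_iff (hc.1 _ (List.mem_range.2 (hR.lt v hv))), (hφX v hv).1⟩
    · obtain ⟨k, hk, rfl⟩ := List.getElem_of_mem (mem_ys hR hY hv)
      exact ⟨10 + k, memB_iff (hc.2 _ (List.mem_range.2 (by omega))), (hφY k hk).1⟩

/-! ### The two other exceptional systems -/

/-- Check a collapsible graph containing an additional edge `xk`. -/
def xxB (L : List ℕ) (x k : ℕ) (E : List (ℕ × ℕ)) (tr : List (List ℕ)) : Bool :=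
  cc E tr && E.all fun e => ((bif Nat.blt x k then (x, k) else (k, x)) :: sysE 10 L).any
    fun f => Nat.beq e.1 f.1 && Nat.beq e.2 f.2

theorem incB_sound {tg : List (List (List ℕ))} {L : List ℕ} {x : ℕ} {es : List ℕ}
    (h : incB tg L x es = true) (htg : ∀ c ∈ tg.flatten, Dead G X Y c)
    {j : ℕ} (hj : j < L.length) (hx : (L[j]).testBit x = false) :
    Dead G X Y (L.set j (L[j] ||| 2 ^ x)) := by
  unfold incB at h
  rw [List.all_eq_true] at h
  have h := h j (List.mem_range.2 hj)
  rw [List.getD_eq_getElem _ _ hj, hx, Bool.false_or] at h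
  exact chk_sound h htg

theorem dead_exc [Nonempty V] (hred : G.Reduced) (hnd : G.edges.Nodup)
    (hconn : G.ThreeEdgeConnected) (hdis : Disjoint X Y)
    (hcov : ∀ v, v ∈ X ∨ v ∈ Y) (h3 : Three G X Y) (htg : ∀ c ∈ catC.flatten, Dead G X Y c)
    {L : List ℕ} {x a b n : ℕ} {es : List ℕ} (hs : stepF catC L triples n = true)
    (hi : incB catC L x es = true) (ha : a < L.length) (hb : b < L.length) (hab : a ≠ b)
    (hxa : (L[a]).testBit x = true) (hxb : (L[b]).testBit x = true)
    (hxj : ∀ j (hj : j < L.length), j ≠ a → j ≠ b → (L[j]).testBit x = false)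
    (hxx : ∀ k < 7, k ≠ x → ∃ E tr, xxB L x k E tr = true) : Dead G X Y L := by
  intro q ys hR
  have hY := stepF_sound hs htg h3 hR
  have hlen : L.length = ys.length := hR.hit.length_eq
  have hya : Hit G X q L[a] (ys[a]'(by omega)) := hR.hit.get ha (by omega)
  have hyb : Hit G X q L[b] (ys[b]'(by omega)) := hR.hit.get hb (by omega)
  obtain ⟨x0, hx0, hq0, hea⟩ := hya x hxa
  obtain ⟨x1, hx1, hq1, heb⟩ := hyb x hxb
  have h01 : x1 = x0 := hR.inj _ hx1 _ hx0 (hq1.trans hq0.symm)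
  subst h01
  set ya := ys[a]'(by omega) with hyad
  set yb := ys[b]'(by omega) with hybd
  have hyab : ya ≠ yb := by
    intro h
    exact hab ((hR.nd.getElem_inj_iff).1 h)
  have hnX : ∀ y ∈ ys, y ∉ X := fun y hy hyX =>
    (Finset.disjoint_left.1 hdis) hyX (hR.sub y hy)
  have hFn : ({s(x1, ya), s(x1, yb)} : Multiset (Sym2 V)).Nodup := by
    rw [Multiset.insert_eq_cons, Multiset.nodup_cons]
    refine ⟨?_, Multiset.nodup_singleton _⟩
    rw [Multiset.mem_singleton]
    intro h
    exact hyab (Sym2.congr_right.1 h)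
  have hF : ({s(x1, ya), s(x1, yb)} : Multiset (Sym2 V)) ≤ G.edges := by
    refine (Multiset.le_iff_subset hFn).2 ?_
    intro e he
    rw [Multiset.insert_eq_cons, Multiset.mem_cons, Multiset.mem_singleton] at he
    rcases he with rfl | rfl
    · exact hea
    · exact heb
  have hC := hconn _ hF (by simp)
  have hne : x1 ≠ ya := by
    intro h
    exact hnX ya (List.getElem_mem _) (h ▸ hx1)
  obtain ⟨w, hw⟩ : ∃ w, s(x1, w) ∈ G.edges - {s(x1, ya), s(x1, yb)} := by
    rcases Relation.ReflTransGen.cases_head (hC.2.2 x1 trivial ya trivial) with h | ⟨w, hw, -⟩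
    · exact absurd h hne
    · exact ⟨w, hw⟩
  rw [Multiset.mem_sub_of_nodup hnd, Multiset.insert_eq_cons, Multiset.mem_cons,
    Multiset.mem_singleton, not_or] at hw
  obtain ⟨hwG, hwa, hwb⟩ := hw
  have hwx : w ≠ x1 := by
    rintro rfl
    exact G.loopless _ hwG (by simp)
  rcases hcov w with hwX | hwY
  · -- an edge inside `X`
    have hk : q w ≠ x := fun h => hwx (hR.inj _ hwX _ hx0 (h.trans hq0.symm))
    obtain ⟨E, tr, hE⟩ := hxx (q w) (hR.lt w hwX) hk
    rw [xxB, Bool.and_eq_true, List.all_eq_true] at hE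
    obtain ⟨φ, θ, hφX, hφY, hφ⟩ := embed hdis hR
    refine cc_sound hred hE.1 φ θ ?_
    intro e he
    have h := mem_any (hE.2 e he)
    rcases List.mem_cons.1 h with rfl | h
    · have p1 := hφX w hwX
      have p2 := hφX x1 hx0
      rw [hq0] at p2
      cases Nat.blt x (q w) with
      | true =>
        rw [cond_true]
        refine ⟨?_, ?_, ?_⟩
        · rw [p1.1, p2.1]; exact hwG
        · rw [p2.1]; exact p2.2
        · rw [p1.1]; exact p1.2
      | false =>
        rw [cond_false]
        refine ⟨?_, ?_, ?_⟩
        · rw [p1.1, p2.1, Sym2.eq_swap]; exact hwG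
        · rw [p1.1]; exact p1.2
        · rw [p2.1]; exact p2.2
    · exact hφ e h
  · -- an additional incidence
    obtain ⟨j, hj, hjw⟩ := List.getElem_of_mem (mem_ys hR hY hwY)
    have hja : j ≠ a := by
      rintro rfl
      exact hwa (by rw [← hjw])
    have hjb : j ≠ b := by
      rintro rfl
      exact hwb (by rw [← hjw])
    have hjL : j < L.length := by omega
    refine incB_sound hi htg hjL (hxj j hjL hja hjb) q ys ⟨hR.inj, hR.lt, hR.nd, hR.sub, ?_⟩
    rw [List.forall₂_iff_get]
    refine ⟨by simpa using hlen, ?_⟩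
    intro i h1 h2
    have hiL : i < L.length := by simpa using h1
    have hh : Hit G X q L[i] (ys[i]'(by omega)) := hR.hit.get hiL (by omega)
    rw [List.get_eq_getElem, List.get_eq_getElem, List.getElem_set]
    split
    · rename_i hji
      subst hji
      intro k hk
      rw [Nat.testBit_lor, Bool.or_eq_true, Nat.testBit_two_pow, decide_eq_true_eq] at hk
      rcases hk with hk | rfl
      · exact hh k hk
      · exact ⟨x1, hx0, hq0, by rw [hjw]; exact hwG⟩
    · exact hh

theorem xxA : ∀ k < 7, k ≠ 3 → ∃ E tr, xxB sysA 3 k E tr = true := by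
  intro k hk h3
  have : k = 0 ∨ k = 1 ∨ k = 2 ∨ k = 4 ∨ k = 5 ∨ k = 6 := by omega
  rcases this with rfl | rfl | rfl | rfl | rfl | rfl
  · exact ⟨[(0, 3), (0, 11), (3, 11)], [[0, 3, 11]], by decide +kernel⟩
  · exact ⟨[(1, 3), (1, 11), (3, 11)], [[1, 3, 11]], by decide +kernel⟩
  · exact ⟨[(2, 3), (2, 15), (3, 15)], [[2, 3, 15]], by decide +kernel⟩
  · exact ⟨[(3, 4), (3, 15), (4, 15)], [[3, 4, 15]], by decide +kernel⟩
  · exact ⟨(3, 5) :: sysE 10 sysA, [[0, 10, 1, 11], [0, 12], [0, 13], [0, 14], [0, 5, 3, 10],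
      [2, 5, 16], [0, 4, 15], [0, 2], [0, 6]], by decide +kernel⟩
  · exact ⟨(3, 6) :: sysE 10 sysA, [[0, 10, 1, 11], [0, 12], [0, 13], [0, 14], [0, 6, 3, 10],
      [2, 6, 16], [0, 4, 15], [0, 2], [0, 5]], by decide +kernel⟩

theorem xxC : ∀ k < 7, k ≠ 2 → ∃ E tr, xxB sysB 2 k E tr = true := by
  intro k hk h3
  have : k = 0 ∨ k = 1 ∨ k = 3 ∨ k = 4 ∨ k = 5 ∨ k = 6 := by omega
  rcases this with rfl | rfl | rfl | rfl | rfl | rfl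
  · exact ⟨[(0, 2), (0, 10), (2, 10)], [[0, 2, 10]], by decide +kernel⟩
  · exact ⟨[(1, 2), (1, 10), (2, 10)], [[1, 2, 10]], by decide +kernel⟩
  · exact ⟨(2, 3) :: sysE 10 sysB, [[0, 10, 1, 11], [2, 10], [0, 2, 3, 12], [0, 13], [0, 16],
      [2, 4, 0], [2, 14, 5], [2, 15], [2, 6]], by decide +kernel⟩
  · exact ⟨(2, 4) :: sysE 10 sysB, [[0, 10, 1, 11], [2, 10], [0, 12, 3, 13], [4, 12], [0, 16],
      [0, 14, 5], [0, 15], [0, 6], [2, 4, 0]], by decide +kernel⟩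
  · exact ⟨(2, 5) :: sysE 10 sysB, [[0, 10, 1, 11], [2, 10], [0, 12, 3, 16], [0, 13],
      [4, 12, 0], [4, 14, 5], [4, 15], [4, 6], [2, 4]], by decide +kernel⟩
  · exact ⟨(2, 6) :: sysE 10 sysB, [[0, 10, 1, 11], [2, 10], [0, 12, 3, 16], [0, 13],
      [4, 12, 0], [4, 14, 5], [4, 15], [4, 6], [2, 4]], by decide +kernel⟩

theorem getA : ∀ j (hj : j < sysA.length), j ≠ 1 → j ≠ 5 → (sysA[j]).testBit 3 = false := by
  intro j hj h1 h2
  have h7 : sysA.length = 7 := rfl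
  have : j = 0 ∨ j = 2 ∨ j = 3 ∨ j = 4 ∨ j = 6 := by omega
  rcases this with rfl | rfl | rfl | rfl | rfl <;>
    simp only [sysA, List.getElem_cons_succ, List.getElem_cons_zero] <;> decide

theorem getB : ∀ j (hj : j < sysB.length), j ≠ 0 → j ≠ 1 → (sysB[j]).testBit 2 = false := by
  intro j hj h1 h2
  have h7 : sysB.length = 7 := rfl
  have : j = 2 ∨ j = 3 ∨ j = 4 ∨ j = 5 ∨ j = 6 := by omega
  rcases this with rfl | rfl | rfl | rfl | rfl <;>
    simp only [sysB, List.getElem_cons_succ, List.getElem_cons_zero] <;> decide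

theorem main [Fintype V] (hconn : G.ThreeEdgeConnected) (hred : G.Reduced)
    {EH : Multiset (Sym2 V)} (hsub : EH ≤ G.edges) (hconnH : ConnOn Set.univ EH)
    (hbip : IsBipartition X Y EH) (hX7 : X.card ≤ 7) (hXY : X.card ≤ Y.card)
    (hdeg : ∀ y ∈ Y, 3 ≤ degIn EH y) : G.Supereulerian := by
  by_contra hns
  obtain ⟨v0, -⟩ := hconnH.1
  have : Nonempty V := ⟨v0⟩
  have hnd := edges_nodup hred
  have hdis := hbip.1
  have hcov : ∀ v, v ∈ X ∨ v ∈ Y := by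
    intro v
    have : v ∈ X ∪ Y := by rw [hbip.2.1]; exact Finset.mem_univ v
    exact Finset.mem_union.1 this
  have h3 := three_of hnd hsub hbip hdeg
  have hcat : ∀ c ∈ catC.flatten, Dead G X Y c := catB_sound hred hdis catT_ok
  have happ : ∀ A B : List (List (List ℕ)), (∀ c ∈ A.flatten, Dead G X Y c) →
      (∀ c ∈ B.flatten, Dead G X Y c) → ∀ c ∈ (A ++ B).flatten, Dead G X Y c := by
    intro A B hA hB c hc
    rw [List.flatten_append, List.mem_append] at hc
    exact hc.elim (hA c) (hB c)
  have d7 : ∀ c ∈ lvl7.flatten, Dead G X Y c := by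
    rw [lvl7_eq]
    intro c hc
    rcases List.mem_cons.1 hc with rfl | hc
    · exact dead_exc hred hnd hconn hdis hcov h3 hcat (a := 0) (b := 1) sysB_ok sysB_inc
        (by decide) (by decide) (by decide) rfl rfl getB xxC
    rcases List.mem_cons.1 hc with rfl | hc
    · exact dead_F hns hdis hcov h3 hcat
    rcases List.mem_cons.1 hc with rfl | hc
    · exact dead_exc hred hnd hconn hdis hcov h3 hcat (a := 1) (b := 5) sysA_ok sysA_inc
        (by decide) (by decide) (by decide) rfl rfl getA xxA
    simp at hc
  have d6 := levelF_sound h3 hXY lvl6_ok (happ _ _ hcat d7)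
  have d5 := levelF_sound h3 hXY lvl5_ok (happ _ _ hcat d6)
  have d4 := levelF_sound h3 hXY lvl4_ok (happ _ _ hcat d5)
  have d3 := levelF_sound h3 hXY lvl3_ok (happ _ _ hcat d4)
  have d2 := levelF_sound h3 hXY lvl2_ok (happ _ _ hcat d3)
  have d1 := levelF_sound h3 hXY lvl1_ok (happ _ _ hcat d2)
  obtain ⟨q, hR⟩ := real_nil (G := G) (X := X) (Y := Y) hX7
  refine stepF_sound lvl0_ok d1 h3 hR ?_
  show 0 < Y.card
  rcases hcov v0 with h | h
  · have : 0 < X.card := Finset.card_pos.2 ⟨v0, h⟩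
    omega
  · exact Finset.card_pos.2 ⟨v0, h⟩

end S6

/-- Theorem 3.3(c). Let `G` be a 3-edge-connected reduced graph having a
spanning connected bipartite subgraph `H` with bipartition `{X, Y}` where `|X| ≤ 7`,
`|Y| ≥ |X|` and `d_H(v) ≥ 3` for every `v ∈ Y`.  Then `G` is supereulerian. -/
theorem statement6 {V : Type} [Fintype V] (G : Multigraph V)
    (h3 : G.ThreeEdgeConnected) (hred : G.Reduced)
    (X Y : Finset V) (EH : Multiset (Sym2 V))
    (hsub : EH ≤ G.edges)
    (hconnH : Multigraph.ConnOn Set.univ EH)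
    (hbip : Multigraph.IsBipartition X Y EH)
    (hX7 : X.card ≤ 7) (hXY : X.card ≤ Y.card)
    (hdeg : ∀ y ∈ Y, 3 ≤ Multigraph.degIn EH y) :
    G.Supereulerian := by
  exact S6.main h3 hred hsub hconnH hbip hX7 hXY hdeg
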